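/- Let X be the ergodic Markov shift determined by an irreducible stochastic matrix on a finite state set, and let Y be the mixing Markov shift determined by an irreducible aperiodic stochastic matrix on a finite state set, with h(X) > h(Y). Then there exists a finitary homomorphism from X to Y. -/

import Mathlib

open MeasureTheory ENNReal Filter

noncomputable section

/-- The left shift transformation on bi-infinite sequences: `(shift x) n = x (n+1)`. -/
def shift {A : Type*} : (ℤ → A) → (ℤ → A) := fun x n => x (n + 1)

/-- `φ` is a homomorphism (factor map) from the shift system `(ℤ → A, μ, shift)` to
`(ℤ → B, ν, shift)`, defined on the shift-invariant full-measure domain `D`. -/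
structure IsFactorMap {A B : Type*} [MeasurableSpace A] [MeasurableSpace B]
    (μ : Measure (ℤ → A)) (ν : Measure (ℤ → B))
    (D : Set (ℤ → A)) (φ : (ℤ → A) → (ℤ → B)) : Prop where
  measurable_map : Measurable φ
  dom_measurable : MeasurableSet D
  dom_shift_invariant : shift ⁻¹' D = D
  dom_full : μ D = 1
  pushforward : ν = μ.map φ
  equivariant : ∀ x ∈ D, φ (shift x) = shift (φ x)

/-- The window `[-q, r]` of `x` determines the zero coordinate of the image under `φ`
(among points of the domain `D`). -/
def DeterminesAt {A B : Type*} (D : Set (ℤ → A)) (φ : (ℤ → A) → (ℤ → B))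
    (q r : ℕ) (x : ℤ → A) : Prop :=
  ∀ y ∈ D, (∀ i : ℤ, -(q : ℤ) ≤ i → i ≤ (r : ℤ) → y i = x i) → φ y 0 = φ x 0

/-- A homomorphism `φ` with domain `D` is finitary if for almost every `x` in the domain
there are nonnegative integers `q`, `r` such that the coordinates `x_{-q}, …, x_r`
determine `(φ x)_0`. -/
def IsFinitary {A B : Type*} [MeasurableSpace A] [MeasurableSpace B]
    (μ : Measure (ℤ → A)) (D : Set (ℤ → A)) (φ : (ℤ → A) → (ℤ → B)) : Prop :=
  ∀ᵐ x ∂μ, x ∈ D → ∃ q r : ℕ, DeterminesAt D φ q r x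

/-- The code length `C(x) = q(x) + r(x)` with `q(x), r(x)` minimal such that the window
`[-q(x), r(x)]` determines the zero output coordinate (`⊤` if no finite window works). -/
def codeLength {A B : Type*} (D : Set (ℤ → A)) (φ : (ℤ → A) → (ℤ → B))
    (x : ℤ → A) : ℝ≥0∞ :=
  ⨅ (q : ℕ) (r : ℕ) (_ : DeterminesAt D φ q r x), ((q : ℝ≥0∞) + (r : ℝ≥0∞))

/-- `μ` is the Bernoulli (product) measure on `(ℤ → A)` given by the probability vector `p`. -/
def IsBernoulliMeasure {A : Type*} [MeasurableSpace A] (μ : Measure (ℤ → A)) (p : A → ℝ) : Prop :=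
  ∀ (F : Finset ℤ) (s : ℤ → A),
    μ {x | ∀ i ∈ F, x i = s i} = ENNReal.ofReal (∏ i ∈ F, p (s i))

/-- A strictly positive probability vector on a finite alphabet. -/
def IsProbVector {A : Type*} [Fintype A] (p : A → ℝ) : Prop :=
  (∀ i, 0 < p i) ∧ ∑ i, p i = 1

/-- The entropy `H(p) = -∑ p_i log p_i` of a probability vector. -/
def vecEntropy {A : Type*} [Fintype A] (p : A → ℝ) : ℝ := -∑ i, p i * Real.log (p i)

/-- A finitary isomorphism: a pair of mutually inverse finitary factor maps. -/
def IsFinitaryIsomorphism {A B : Type*} [MeasurableSpace A] [MeasurableSpace B]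
    (μ : Measure (ℤ → A)) (ν : Measure (ℤ → B))
    (D : Set (ℤ → A)) (E : Set (ℤ → B))
    (φ : (ℤ → A) → (ℤ → B)) (ψ : (ℤ → B) → (ℤ → A)) : Prop :=
  IsFactorMap μ ν D φ ∧ IsFactorMap ν μ E ψ ∧
  IsFinitary μ D φ ∧ IsFinitary ν E ψ ∧
  (∀ x ∈ D, φ x ∈ E ∧ ψ (φ x) = x) ∧ (∀ y ∈ E, ψ y ∈ D ∧ φ (ψ y) = y)

/-- A stochastic matrix: nonnegative entries, rows summing to one. -/
def IsStochastic {S : Type*} [Fintype S] (P : Matrix S S ℝ) : Prop :=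
  (∀ i j, 0 ≤ P i j) ∧ ∀ i, ∑ j, P i j = 1

/-- Irreducible and aperiodic (primitive): some power has all entries strictly positive. -/
def IsPrimitive {S : Type*} [Fintype S] [DecidableEq S] (P : Matrix S S ℝ) : Prop :=
  ∃ n : ℕ, ∀ i j, 0 < (P ^ n) i j

/-- Irreducible: every state leads to every state in some positive number of steps. -/
def IsIrreducibleMat {S : Type*} [Fintype S] [DecidableEq S] (P : Matrix S S ℝ) : Prop :=
  ∀ i j, ∃ n : ℕ, 0 < n ∧ 0 < (P ^ n) i j

/-- A stationary probability vector for `P`. -/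
def IsStationaryVector {S : Type*} [Fintype S] (P : Matrix S S ℝ) (ppi : S → ℝ) : Prop :=
  (∀ i, 0 ≤ ppi i) ∧ (∑ i, ppi i = 1) ∧ ∀ j, ∑ i, ppi i * P i j = ppi j

/-- `μ` is the (stationary) Markov measure on `(ℤ → S)` determined by the stochastic
matrix `P` with stationary vector `ppi`. -/
def IsMarkovMeasure {S : Type*} [Fintype S] [MeasurableSpace S]
    (μ : Measure (ℤ → S)) (P : Matrix S S ℝ) (ppi : S → ℝ) : Prop :=
  ∀ (m n : ℤ), m ≤ n → ∀ w : ℤ → S,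
    μ {x | ∀ i : ℤ, m ≤ i → i ≤ n → x i = w i} =
      ENNReal.ofReal (ppi (w m) * ∏ i ∈ Finset.Ico m n, P (w i) (w (i + 1)))

/-- The entropy `h(P) = -∑_{i,j} π_i P(i,j) log P(i,j)` of the Markov shift of `P`. -/
def markovEntropy {S : Type*} [Fintype S] (P : Matrix S S ℝ) (ppi : S → ℝ) : ℝ :=
  -∑ i, ∑ j, ppi i * P i j * Real.log (P i j)

set_option linter.unusedSectionVars false

/-! ### Events depending on finitely many coordinates -/

section Window

variable {ι S : Type*}

/-- The event `E` depends only on the coordinates in `W`. -/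
def DependsOnWindow (W : Set ι) (E : Set (ι → S)) : Prop :=
  ∀ x y : ι → S, (∀ i ∈ W, x i = y i) → x ∈ E → y ∈ E

lemma DependsOnWindow.iff {W : Set ι} {E : Set (ι → S)} (h : DependsOnWindow W E)
    {x y : ι → S} (hxy : ∀ i ∈ W, x i = y i) : x ∈ E ↔ y ∈ E :=
  ⟨h x y hxy, h y x fun i hi => (hxy i hi).symm⟩

variable [Fintype S] [MeasurableSpace S] [DiscreteMeasurableSpace S]

lemma DependsOnWindow.measurableSet {W : Set ι} (hW : W.Finite) {E : Set (ι → S)}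
    (h : DependsOnWindow W E) : MeasurableSet E := by
  classical
  obtain ⟨W, rfl⟩ := hW.exists_finset_coe
  have : E = W.restrict ⁻¹' (W.restrict '' E) := by
    ext x
    refine ⟨fun hx => ⟨x, hx, rfl⟩, ?_⟩
    rintro ⟨y, hy, hyx⟩
    exact h y x (fun i hi => congrFun hyx ⟨i, hi⟩) hy
  rw [this]
  exact Finset.measurable_restrict W (Set.toFinite _).measurableSet

lemma measurableSet_cylinder_eq {W : Set ι} (hW : W.Finite) (w : ι → S) :
    MeasurableSet {x : ι → S | ∀ i ∈ W, x i = w i} :=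
  DependsOnWindow.measurableSet (W := W) hW
    fun _ _ hxy hx i hi => (hxy i hi).symm.trans (hx i hi)

lemma DependsOnWindow.measure_le {W : Set ι} (hW : W.Finite) {E : Set (ι → S)}
    (h : DependsOnWindow W E) {μ ν : Measure (ι → S)}
    (hle : ∀ w ∈ E, μ {x | ∀ i ∈ W, x i = w i} ≤ ν {x | ∀ i ∈ W, x i = w i}) : μ E ≤ ν E := by
  classical
  obtain ⟨W, rfl⟩ := hW.exists_finset_coe
  have key : E = ⋃ f ∈ (Set.toFinite (W.restrict '' E)).toFinset,
      {x | W.restrict x = f} := by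
    ext x
    simp only [Set.Finite.mem_toFinset, Set.mem_iUnion, Set.mem_ofPred_eq, exists_prop,
      exists_eq_right']
    refine ⟨fun hx => ⟨x, hx, rfl⟩, ?_⟩
    rintro ⟨y, hy, hyx⟩
    exact h y x (fun i hi => congrFun hyx ⟨i, hi⟩) hy
  have hd : (↑(Set.toFinite (W.restrict '' E)).toFinset : Set (W → S)).PairwiseDisjoint
      fun f => {x : ι → S | W.restrict x = f} := by
    intro f _ g _ hfg
    refine Set.disjoint_left.2 fun x hx hx' => hfg (hx.symm.trans hx')
  have hm : ∀ f : W → S, MeasurableSet {x : ι → S | W.restrict x = f} := fun f => by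
    change MeasurableSet (W.restrict (π := fun _ => S) ⁻¹' {f})
    exact Finset.measurable_restrict W (measurableSet_singleton f)
  conv_lhs => rw [key]
  conv_rhs => rw [key]
  rw [measure_biUnion_finset hd fun f _ => hm f, measure_biUnion_finset hd fun f _ => hm f]
  refine Finset.sum_le_sum fun f hf => ?_
  obtain ⟨y, hy, rfl⟩ := (Set.Finite.mem_toFinset _).1 hf
  have : {x : ι → S | W.restrict x = W.restrict y} = {x | ∀ i ∈ (W : Set ι), x i = y i} := by
    ext x
    exact ⟨fun hx i hi => congrFun hx ⟨i, hi⟩, fun hx => funext fun i => hx i i.2⟩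
  rw [this]
  exact hle y hy

lemma DependsOnWindow.measure_eq {W : Set ι} (hW : W.Finite) {E : Set (ι → S)}
    (h : DependsOnWindow W E) {μ ν : Measure (ι → S)}
    (hle : ∀ w ∈ E, μ {x | ∀ i ∈ W, x i = w i} = ν {x | ∀ i ∈ W, x i = w i}) : μ E = ν E :=
  le_antisymm (h.measure_le hW fun w hw => (hle w hw).le)
    (h.measure_le hW fun w hw => (hle w hw).ge)

/-- Finite measures which agree on the cylinders over an exhausting family of windows agree. -/
lemma measure_ext_of_windows {μ ν : Measure (ι → S)} [IsFiniteMeasure μ]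
    (h : ∀ I : Finset ι, ∃ W : Set ι, W.Finite ∧ ↑I ⊆ W ∧ ∀ w : ι → S,
      μ {x | ∀ i ∈ W, x i = w i} = ν {x | ∀ i ∈ W, x i = w i}) : μ = ν := by
  have key : ∀ I : Finset ι, μ.map I.restrict = ν.map I.restrict := by
    intro I
    ext s hs
    rw [Measure.map_apply (Finset.measurable_restrict I) hs,
      Measure.map_apply (Finset.measurable_restrict I) hs]
    obtain ⟨W, hW, hIW, hw⟩ := h I
    refine DependsOnWindow.measure_eq (W := W) hW ?_ fun w _ => hw w
    intro x y hxy hx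
    have : I.restrict x = I.restrict y := funext fun i => hxy i (hIW i.2)
    rw [Set.mem_preimage, ← this]
    exact hx
  have : ∀ I : Finset ι, IsFiniteMeasure (μ.map I.restrict) := fun I => inferInstance
  exact IsProjectiveLimit.unique (P := fun I => μ.map I.restrict) (fun I => rfl)
    fun I => (key I).symm

end Window

/-! ### One-sided Markov measures -/

section Chain

variable {S : Type*}

/-- The product of the transition probabilities along the first `n` steps of the path `w`. -/
def pathProd (P : Matrix S S ℝ) (w : ℕ → S) (n : ℕ) : ℝ :=
  ∏ i ∈ Finset.range n, P (w i) (w (i + 1))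

/-- The cylinder of sequences agreeing with `w` on `[0, n]`. -/
def cyl (n : ℕ) (w : ℕ → S) : Set (ℕ → S) := {z | ∀ k ∈ Set.Iic n, z k = w k}

/-- Forgetting the first `n` coordinates. -/
def drop (n : ℕ) (z : ℕ → S) : ℕ → S := fun k => z (n + k)

/-- `ρ` is the law of the Markov chain with transition matrix `P` and initial weights `p`. -/
def IsMC (P : Matrix S S ℝ) (p : S → ℝ) [MeasurableSpace S] (ρ : Measure (ℕ → S)) : Prop :=
  ∀ n w, ρ (cyl n w) = ENNReal.ofReal (p (w 0) * pathProd P w n)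

lemma pathProd_add (P : Matrix S S ℝ) (w : ℕ → S) (n k : ℕ) :
    pathProd P w (n + k) = pathProd P w n * pathProd P (drop n w) k := by
  simp [pathProd, Finset.prod_range_add, drop, add_assoc]

lemma pathProd_congr (P : Matrix S S ℝ) {w w' : ℕ → S} {n : ℕ} (h : ∀ k ≤ n, w k = w' k) :
    pathProd P w n = pathProd P w' n := by
  refine Finset.prod_congr rfl fun i hi => ?_
  have := Finset.mem_range.1 hi
  rw [h i (by omega), h (i + 1) (by omega)]

lemma pathProd_zero (P : Matrix S S ℝ) (w : ℕ → S) : pathProd P w 0 = 1 := by simp [pathProd]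

lemma pathProd_succ' (P : Matrix S S ℝ) (w : ℕ → S) (n : ℕ) :
    pathProd P w (n + 1) = P (w 0) (w 1) * pathProd P (drop 1 w) n := by
  rw [add_comm, pathProd_add]; simp [pathProd]

lemma pathProd_nonneg {P : Matrix S S ℝ} (hP : ∀ i j, 0 ≤ P i j) (w : ℕ → S) (n : ℕ) :
    0 ≤ pathProd P w n := Finset.prod_nonneg fun _ _ => hP _ _

lemma drop_drop (n k : ℕ) (z : ℕ → S) : drop n (drop k z) = drop (k + n) z := by
  funext i; simp [drop, add_assoc]

lemma drop_zero (z : ℕ → S) : drop 0 z = z := by funext i; simp [drop]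

/-- The path following `w` on `[0, n)` and then `u`. -/
def glue (n : ℕ) (w u : ℕ → S) : ℕ → S := fun k => if k < n then w k else u (k - n)

lemma glue_of_lt {n k : ℕ} (w u : ℕ → S) (h : k < n) : glue n w u k = w k := by simp [glue, h]

lemma drop_glue (n : ℕ) (w u : ℕ → S) : drop n (glue n w u) = u := by
  funext k; simp [drop, glue]

lemma cyl_inter_preimage_drop {n k : ℕ} {w u : ℕ → S} (h : w n = u 0) :
    cyl n w ∩ drop n ⁻¹' cyl k u = cyl (n + k) (glue n w u) := by
  ext z
  simp only [cyl, Set.mem_inter_iff, Set.mem_preimage, Set.mem_ofPred_eq, Set.mem_Iic, glue, drop]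
  constructor
  · rintro ⟨h1, h2⟩ i hi
    split_ifs with hin
    · exact h1 i hin.le
    · have := h2 (i - n) (by omega)
      rwa [Nat.add_sub_of_le (by omega)] at this
  · intro hz
    refine ⟨fun i hi => ?_, fun i hi => ?_⟩
    · rw [hz i (by omega)]
      split_ifs with hin
      · rfl
      · obtain rfl : i = n := by omega
        simp [h]
    · rw [hz (n + i) (by omega)]
      simp

lemma cyl_inter_preimage_drop_of_ne {n k : ℕ} {w u : ℕ → S} (h : w n ≠ u 0) :
    cyl n w ∩ drop n ⁻¹' cyl k u = ∅ := by
  ext z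
  simp only [cyl, Set.mem_inter_iff, Set.mem_preimage, Set.mem_ofPred_eq, Set.mem_Iic, drop,
    Set.mem_empty_iff_false, iff_false, not_and]
  intro h1 h2
  exact h ((h1 n le_rfl).symm.trans (by simpa using h2 0 (by omega)))

variable [MeasurableSpace S]

@[fun_prop]
lemma measurable_drop (n : ℕ) : Measurable (drop n : (ℕ → S) → ℕ → S) :=
  measurable_pi_lambda _ fun _ => measurable_pi_apply _

variable [Fintype S] [DiscreteMeasurableSpace S]

lemma measurableSet_cyl (n : ℕ) (w : ℕ → S) : MeasurableSet (cyl n w) :=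
  measurableSet_cylinder_eq (Set.finite_Iic n) w

lemma measure_ext_cyl {μ ν : Measure (ℕ → S)} [IsFiniteMeasure μ]
    (h : ∀ n w, μ (cyl n w) = ν (cyl n w)) : μ = ν := by
  refine measure_ext_of_windows fun I => ⟨Set.Iic (I.sup id), Set.finite_Iic _, ?_, fun w => h _ w⟩
  intro i hi
  exact Finset.le_sup (f := id) hi

variable [DecidableEq S]

/-- The chain law started at the state `i`. -/
def IsChainFrom (P : Matrix S S ℝ) (i : S) (ρ : Measure (ℕ → S)) : Prop :=
  IsMC P (Pi.single i 1) ρ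

lemma IsChainFrom.cyl_self {P : Matrix S S ℝ} {i : S} {ρ : Measure (ℕ → S)}
    (h : IsChainFrom P i ρ) (n : ℕ) {w : ℕ → S} (hw : w 0 = i) :
    ρ (cyl n w) = ENNReal.ofReal (pathProd P w n) := by
  rw [h n w]; simp [hw]

lemma IsMC.univ {P : Matrix S S ℝ} {p : S → ℝ} {ρ : Measure (ℕ → S)}
    (h : IsMC P p ρ) (hp : ∀ i, 0 ≤ p i) : ρ Set.univ = ENNReal.ofReal (∑ i, p i) := by
  have : (Set.univ : Set (ℕ → S)) = ⋃ i ∈ (Finset.univ : Finset S), cyl 0 (fun _ => i) := by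
    ext z; simp [cyl]
  rw [this, measure_biUnion_finset]
  · rw [ENNReal.ofReal_sum_of_nonneg fun i _ => hp i]
    refine Finset.sum_congr rfl fun i _ => ?_
    rw [h 0]; simp [pathProd]
  · intro i _ j _ hij
    refine Set.disjoint_left.2 fun z hz hz' => hij ?_
    exact (hz 0 (by simp)).symm.trans (hz' 0 (by simp))
  · exact fun i _ => measurableSet_cyl _ _

lemma IsMC.isProbabilityMeasure {P : Matrix S S ℝ} {p : S → ℝ} {ρ : Measure (ℕ → S)}
    (h : IsMC P p ρ) (hp : ∀ i, 0 ≤ p i) (hs : ∑ i, p i = 1) : IsProbabilityMeasure ρ :=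
  ⟨by rw [h.univ hp, hs, ENNReal.ofReal_one]⟩

lemma single_one_nonneg (i : S) (j : S) : 0 ≤ (Pi.single i (1 : ℝ) : S → ℝ) j := by
  by_cases h : j = i
  · subst h; simp
  · simp [h]

lemma IsChainFrom.isProbabilityMeasure {P : Matrix S S ℝ} {i : S} {ρ : Measure (ℕ → S)}
    (h : IsChainFrom P i ρ) : IsProbabilityMeasure ρ :=
  IsMC.isProbabilityMeasure h (single_one_nonneg i) (by simp)

/-- The Markov property at a fixed time. -/
lemma IsMC.map_drop_restrict {P : Matrix S S ℝ} {p : S → ℝ} (hp : ∀ i, 0 ≤ p i)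
    (hP : ∀ i j, 0 ≤ P i j) {ρ : Measure (ℕ → S)} (h : IsMC P p ρ) {κ : S → Measure (ℕ → S)}
    (hκ : ∀ i, IsChainFrom P i (κ i)) (n : ℕ) (w : ℕ → S) :
    (ρ.restrict (cyl n w)).map (drop n) = ρ (cyl n w) • κ (w n) := by
  have : IsFiniteMeasure ρ := ⟨by rw [h.univ hp]; exact ENNReal.ofReal_lt_top⟩
  refine measure_ext_cyl fun k u => ?_
  rw [Measure.map_apply (measurable_drop n) (measurableSet_cyl _ _),
    Measure.restrict_apply (measurable_drop n (measurableSet_cyl _ _)), Set.inter_comm,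
    Measure.smul_apply, smul_eq_mul]
  by_cases hwu : w n = u 0
  · rw [cyl_inter_preimage_drop hwu, h, h, (hκ (w n)).cyl_self k hwu.symm,
      ← ENNReal.ofReal_mul (mul_nonneg (hp _) (pathProd_nonneg hP _ _)), pathProd_add, drop_glue]
    congr 1
    have h0 : glue n w u 0 = w 0 := by
      rcases Nat.eq_zero_or_pos n with rfl | hn
      · simp [glue, hwu]
      · simp [glue, hn]
    rw [h0, mul_assoc]
    congr 2
    refine pathProd_congr P fun i hi => ?_
    rcases hi.lt_or_eq with hi | rfl
    · simp [glue, hi]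
    · simp [glue, hwu]
  · rw [cyl_inter_preimage_drop_of_ne hwu, hκ (w n) k u]
    simp [Ne.symm hwu]

end Chain

/-! ### Stochastic matrices -/

section Matrices

variable {S : Type*} [Fintype S] [DecidableEq S]

lemma IsStochastic.le_one {P : Matrix S S ℝ} (hP : IsStochastic P) (i j : S) : P i j ≤ 1 := by
  rw [← hP.2 i]
  exact Finset.single_le_sum (fun k _ => hP.1 i k) (Finset.mem_univ j)

lemma IsStochastic.pow {P : Matrix S S ℝ} (hP : IsStochastic P) (n : ℕ) :
    IsStochastic (P ^ n) := by
  induction n with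
  | zero =>
    refine ⟨fun i j => ?_, fun i => ?_⟩
    · rw [pow_zero, Matrix.one_apply]; split_ifs <;> norm_num
    · simp [Matrix.one_apply]
  | succ n ih =>
    refine ⟨fun i j => ?_, fun i => ?_⟩
    · rw [pow_succ, Matrix.mul_apply]
      exact Finset.sum_nonneg fun k _ => mul_nonneg (ih.1 _ _) (hP.1 _ _)
    · simp_rw [pow_succ, Matrix.mul_apply]
      rw [Finset.sum_comm]
      simp_rw [← Finset.mul_sum, hP.2, mul_one, ih.2]

lemma IsStationaryVector.pow {P : Matrix S S ℝ} {p : S → ℝ} (h : IsStationaryVector P p) (n : ℕ)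
    (j : S) : ∑ i, p i * (P ^ n) i j = p j := by
  induction n generalizing j with
  | zero => simp [Matrix.one_apply]
  | succ n ih =>
    simp_rw [pow_succ, Matrix.mul_apply, Finset.mul_sum]
    rw [Finset.sum_comm]
    simp_rw [← mul_assoc, ← Finset.sum_mul, ih, h.2.2]

lemma IsStationaryVector.pos {P : Matrix S S ℝ} {p : S → ℝ} (h : IsStationaryVector P p)
    (hP : IsStochastic P) (hirr : IsIrreducibleMat P) (j : S) : 0 < p j := by
  obtain ⟨i, hi⟩ : ∃ i, 0 < p i := by
    by_contra! hcon
    have := h.2.1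
    rw [Finset.sum_eq_zero fun i _ => le_antisymm (hcon i) (h.1 i)] at this
    norm_num at this
  obtain ⟨n, -, hn⟩ := hirr i j
  rw [← h.pow n j]
  refine lt_of_lt_of_le (mul_pos hi hn) ?_
  exact Finset.single_le_sum (f := fun k => p k * (P ^ n) k j)
    (fun k _ => mul_nonneg (h.1 k) ((hP.pow n).1 k j)) (Finset.mem_univ i)

lemma pow_mulVec_eq {P : Matrix S S ℝ} {g : S → ℝ} (hg : ∀ i, ∑ j, P i j * g j = g i) (n : ℕ)
    (i : S) : ∑ j, (P ^ n) i j * g j = g i := by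
  induction n generalizing i with
  | zero => simp [Matrix.one_apply]
  | succ n ih =>
    simp_rw [pow_succ', Matrix.mul_apply, Finset.sum_mul]
    rw [Finset.sum_comm]
    simp_rw [mul_assoc, ← Finset.mul_sum, ih, hg]

lemma harmonic_const {P : Matrix S S ℝ} (hP : IsStochastic P) (hirr : IsIrreducibleMat P)
    {g : S → ℝ} (hg : ∀ i, ∑ j, P i j * g j = g i) (i j : S) : g i = g j := by
  have : Nonempty S := ⟨i⟩
  obtain ⟨k, hk⟩ := Finite.exists_max g
  suffices h : ∀ j, g j = g k by rw [h i, h j]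
  intro j
  obtain ⟨n, -, hn⟩ := hirr k j
  have h1 := pow_mulVec_eq hg n k
  have h2 : ∑ j, (P ^ n) k j * (g k - g j) = 0 := by
    simp_rw [mul_sub, Finset.sum_sub_distrib, h1, ← Finset.sum_mul, (hP.pow n).2, one_mul, sub_self]
  rw [Finset.sum_eq_zero_iff_of_nonneg
    (fun l _ => mul_nonneg ((hP.pow n).1 k l) (sub_nonneg.2 (hk l)))] at h2
  rcases mul_eq_zero.1 (h2 j (Finset.mem_univ j)) with h | h
  · exact absurd h hn.ne'
  · linarith

/-- The Poisson equation for an irreducible finite chain. -/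
lemma exists_poisson {P : Matrix S S ℝ} (hP : IsStochastic P) (hirr : IsIrreducibleMat P)
    {p : S → ℝ} (hp : IsStationaryVector P p) {f : S → ℝ} (hf : ∑ i, p i * f i = 0) :
    ∃ g : S → ℝ, ∀ i, f i = g i - ∑ j, P i j * g j := by
  have hne : Nonempty S := by
    by_contra hcon
    have := hp.2.1
    rw [not_nonempty_iff] at hcon
    simp at this
  obtain ⟨i₀⟩ := hne
  let L : (S → ℝ) →ₗ[ℝ] (S → ℝ) := LinearMap.id - Matrix.toLin' P
  have hL : ∀ g i, L g i = g i - ∑ j, P i j * g j := fun g i => by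
    simp [L, Matrix.toLin'_apply, Matrix.mulVec, dotProduct]
  let ℓ : (S → ℝ) →ₗ[ℝ] ℝ := ∑ i, p i • LinearMap.proj i
  have hℓ : ∀ g, ℓ g = ∑ i, p i * g i := fun g => by
    simp [ℓ, LinearMap.sum_apply]
  have hker : Module.finrank ℝ (LinearMap.ker L) ≤ 1 := by
    have hle : LinearMap.ker L ≤ Submodule.span ℝ {(fun _ => (1 : ℝ) : S → ℝ)} := by
      intro g hg
      rw [LinearMap.mem_ker] at hg
      have hh : ∀ i, ∑ j, P i j * g j = g i := fun i => by
        have := congrFun hg i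
        rw [hL] at this
        simp at this
        linarith
      rw [Submodule.mem_span_singleton]
      refine ⟨g i₀, funext fun i => ?_⟩
      simp [harmonic_const hP hirr hh i₀ i]
    exact (Submodule.finrank_mono hle).trans ((finrank_span_le_card _).trans (by simp))
  have hrange : LinearMap.range L ≤ LinearMap.ker ℓ := by
    rintro _ ⟨g, rfl⟩
    rw [LinearMap.mem_ker, hℓ]
    simp_rw [hL, mul_sub, Finset.sum_sub_distrib, Finset.mul_sum]
    rw [Finset.sum_comm, sub_eq_zero]
    refine Finset.sum_congr rfl fun j _ => ?_
    simp_rw [← mul_assoc]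
    rw [← Finset.sum_mul, hp.2.2]
  have hsurj : LinearMap.range ℓ = ⊤ := by
    rw [LinearMap.range_eq_top]
    intro c
    refine ⟨fun _ => c, ?_⟩
    rw [hℓ, ← Finset.sum_mul, hp.2.1, one_mul]
  have h1 := LinearMap.finrank_range_add_finrank_ker L
  have h2 := LinearMap.finrank_range_add_finrank_ker ℓ
  rw [hsurj, finrank_top, Module.finrank_self] at h2
  have heq : LinearMap.range L = LinearMap.ker ℓ :=
    Submodule.eq_of_le_of_finrank_le hrange (by omega)
  have hmem : f ∈ LinearMap.ker ℓ := by rw [LinearMap.mem_ker, hℓ, hf]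
  rw [← heq] at hmem
  obtain ⟨g, hg⟩ := hmem
  exact ⟨g, fun i => by rw [← hg, hL]⟩

end Matrices

/-! ### One-sided restrictions of Markov measures -/

section TwoSided

variable {S : Type*}

/-- The future of a two-sided sequence seen from time `τ`. -/
def fut (τ : ℤ) (x : ℤ → S) : ℕ → S := fun n => x (τ + n)

variable [MeasurableSpace S]

@[fun_prop]
lemma measurable_fut (τ : ℤ) : Measurable (fut τ : (ℤ → S) → ℕ → S) :=
  measurable_pi_lambda _ fun _ => measurable_pi_apply _

variable [Fintype S] [DecidableEq S] [DiscreteMeasurableSpace S]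

lemma prod_Ico_int_eq_range (f : ℤ → ℝ) (τ : ℤ) (n : ℕ) :
    ∏ i ∈ Finset.Ico τ (τ + n), f i = ∏ k ∈ Finset.range n, f (τ + k) := by
  induction n with
  | zero => simp
  | succ n ih =>
    rw [Finset.prod_range_succ, ← ih]
    have : Finset.Ico τ (τ + (n + 1 : ℕ)) = insert (τ + n) (Finset.Ico τ (τ + n)) := by
      ext i; simp; omega
    rw [this, Finset.prod_insert (by simp), mul_comm]

lemma IsMarkovMeasure.isMC_fut {P : Matrix S S ℝ} {p : S → ℝ} {μ : Measure (ℤ → S)}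
    (h : IsMarkovMeasure μ P p) (τ : ℤ) : IsMC P p (μ.map (fut τ)) := by
  intro n w
  rw [Measure.map_apply (measurable_fut τ) (measurableSet_cyl n w)]
  have := h τ (τ + n) (by omega) (fun i => w (i - τ).toNat)
  rw [prod_Ico_int_eq_range] at this
  convert this using 2
  · ext x
    simp only [cyl, fut, Set.mem_preimage, Set.mem_ofPred_eq, Set.mem_Iic]
    constructor
    · intro hx i h1 h2
      have := hx (i - τ).toNat (by omega)
      rwa [show τ + ((i - τ).toNat : ℤ) = i by omega] at this
    · intro hx k hk
      have := hx (τ + k) (by omega) (by omega)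
      simpa using this
  · simp [pathProd]
    refine Or.inl (Finset.prod_congr rfl fun i _ => ?_)
    congr 2
    omega

lemma IsMarkovMeasure.isProbabilityMeasure {P : Matrix S S ℝ} {p : S → ℝ} {μ : Measure (ℤ → S)}
    (h : IsMarkovMeasure μ P p) (hp : IsStationaryVector P p) : IsProbabilityMeasure μ := by
  have := (h.isMC_fut 0).isProbabilityMeasure hp.1 hp.2.1
  refine ⟨?_⟩
  have h1 : μ.map (fut 0) Set.univ = 1 := measure_univ
  rwa [Measure.map_apply (measurable_fut 0) MeasurableSet.univ] at h1

/-- Translation of a two-sided sequence. -/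
def seqTranslate (j : ℤ) (x : ℤ → S) : ℤ → S := fun n => x (n + j)

@[fun_prop]
lemma measurable_seqTranslate (j : ℤ) : Measurable (seqTranslate j : (ℤ → S) → ℤ → S) :=
  measurable_pi_lambda _ fun _ => measurable_pi_apply _

lemma finset_int_subset_Icc (I : Finset ℤ) : ∃ N : ℕ, (I : Set ℤ) ⊆ Set.Icc (-(N : ℤ)) N := by
  refine ⟨I.sup Int.natAbs, fun i hi => ?_⟩
  have : i.natAbs ≤ I.sup Int.natAbs := Finset.le_sup (f := Int.natAbs) hi
  simp only [Set.mem_Icc]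
  omega

lemma measure_ext_int {μ ν : Measure (ℤ → S)} [IsFiniteMeasure μ]
    (h : ∀ (m n : ℤ), m ≤ n → ∀ w : ℤ → S, μ {x | ∀ i : ℤ, m ≤ i → i ≤ n → x i = w i}
      = ν {x | ∀ i : ℤ, m ≤ i → i ≤ n → x i = w i}) : μ = ν := by
  refine measure_ext_of_windows fun I => ?_
  obtain ⟨N, hN⟩ := finset_int_subset_Icc I
  refine ⟨_, Set.finite_Icc _ _, hN, fun w => ?_⟩
  have := h (-N) N (by omega) w
  simpa only [Set.mem_Icc, and_imp] using this

lemma IsMarkovMeasure.map_seqTranslate {P : Matrix S S ℝ} {p : S → ℝ} {μ : Measure (ℤ → S)}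
    (h : IsMarkovMeasure μ P p) (hp : IsStationaryVector P p) (j : ℤ) :
    μ.map (seqTranslate j) = μ := by
  have := h.isProbabilityMeasure hp
  refine measure_ext_int fun m n hmn w => ?_
  have hm : MeasurableSet {x : ℤ → S | ∀ i : ℤ, m ≤ i → i ≤ n → x i = w i} := by
    have := measurableSet_cylinder_eq (Set.finite_Icc m n) w
    simpa only [Set.mem_Icc, and_imp] using this
  rw [Measure.map_apply (measurable_seqTranslate j) hm, h m n hmn w]
  have h2 := h (m + j) (n + j) (by omega) (fun i => w (i - j))
  convert h2 using 2
  · ext x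
    simp only [seqTranslate, Set.mem_preimage, Set.mem_ofPred_eq]
    constructor
    · intro hx i h1 h2
      have := hx (i - j) (by omega) (by omega)
      simpa using this
    · intro hx i h1 h2
      have := hx (i + j) (by omega) (by omega)
      simpa using this
  · simp only [add_sub_cancel_right]
    congr 1
    rw [← Finset.map_add_right_Ico, Finset.prod_map]
    refine Finset.prod_congr rfl fun i _ => ?_
    simp [show i + j + 1 - j = i + 1 by ring]

end TwoSided

/-! ### Chains started at a state -/

section Started

variable {S : Type*} [MeasurableSpace S] [Fintype S] [DecidableEq S] [DiscreteMeasurableSpace S]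

lemma IsMC.exists_chains {P : Matrix S S ℝ} {p : S → ℝ} (hp : ∀ i, 0 < p i)
    {ρ : Measure (ℕ → S)} (h : IsMC P p ρ) :
    ∃ κ : S → Measure (ℕ → S), ∀ i, IsChainFrom P i (κ i) := by
  refine ⟨fun i => (ENNReal.ofReal (p i))⁻¹ • ρ.restrict (cyl 0 fun _ => i), fun i n w => ?_⟩
  rw [Measure.smul_apply, Measure.restrict_apply (measurableSet_cyl n w), smul_eq_mul]
  by_cases hw : w 0 = i
  · have : cyl n w ∩ cyl 0 (fun _ => i) = cyl n w := by
      refine Set.inter_eq_left.2 fun z hz k hk => ?_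
      obtain rfl : k = 0 := by simpa using hk
      exact (hz 0 (by simp)).trans hw
    rw [this, h n w, hw, ENNReal.ofReal_mul (hp i).le, ← mul_assoc,
      ENNReal.inv_mul_cancel (by simp [hp i]) ENNReal.ofReal_ne_top]
    simp
  · have : cyl n w ∩ cyl 0 (fun _ => i) = ∅ := by
      ext z
      simp only [Set.mem_inter_iff, Set.mem_empty_iff_false, iff_false, not_and]
      exact fun hz hz' => hw ((hz 0 (by simp)).symm.trans (hz' 0 (by simp)))
    rw [this]
    simp [hw]

variable {P : Matrix S S ℝ} {p : S → ℝ} {ρ : Measure (ℕ → S)} {κ : S → Measure (ℕ → S)}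

lemma IsMC.lintegral_cyl_drop (hp : ∀ i, 0 ≤ p i) (hP : ∀ i j, 0 ≤ P i j) (h : IsMC P p ρ)
    (hκ : ∀ i, IsChainFrom P i (κ i)) (n : ℕ) (w : ℕ → S) {F : (ℕ → S) → ℝ≥0∞}
    (hF : Measurable F) :
    ∫⁻ z in cyl n w, F (drop n z) ∂ρ = ρ (cyl n w) * ∫⁻ z, F z ∂κ (w n) := by
  rw [← lintegral_map hF (measurable_drop n), h.map_drop_restrict hp hP hκ, lintegral_smul_measure,
    smul_eq_mul]

lemma IsMC.cyl_inter_drop (hp : ∀ i, 0 ≤ p i) (hP : ∀ i j, 0 ≤ P i j) (h : IsMC P p ρ)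
    (hκ : ∀ i, IsChainFrom P i (κ i)) (n : ℕ) (w : ℕ → S) {F : Set (ℕ → S)}
    (hF : MeasurableSet F) :
    ρ (cyl n w ∩ drop n ⁻¹' F) = ρ (cyl n w) * κ (w n) F := by
  have := congrArg (fun m => m F) (h.map_drop_restrict hp hP hκ n w)
  simp only [Measure.smul_apply, smul_eq_mul] at this
  rw [← this, Measure.map_apply (measurable_drop n) hF,
    Measure.restrict_apply (measurable_drop n hF), Set.inter_comm]

/-- The Markov property for events of the past. -/
lemma IsMC.past_inter_drop_le (hp : ∀ i, 0 ≤ p i) (hP : ∀ i j, 0 ≤ P i j) (h : IsMC P p ρ)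
    (hκ : ∀ i, IsChainFrom P i (κ i)) {n : ℕ} {E : Set (ℕ → S)}
    (hE : DependsOnWindow (Set.Iic n) E) {F : Set (ℕ → S)} (hF : MeasurableSet F) {c : ℝ≥0∞}
    (hc : ∀ w ∈ E, κ (w n) F ≤ c) : ρ (E ∩ drop n ⁻¹' F) ≤ ρ E * c := by
  have key : (ρ.restrict (drop n ⁻¹' F)) E ≤ (c • ρ) E := by
    refine hE.measure_le (Set.finite_Iic n) fun w hw => ?_
    change (ρ.restrict (drop n ⁻¹' F)) (cyl n w) ≤ (c • ρ) (cyl n w)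
    rw [Measure.restrict_apply (measurableSet_cyl n w), h.cyl_inter_drop hp hP hκ n w hF,
      Measure.smul_apply, smul_eq_mul, mul_comm]
    gcongr
    exact hc w hw
  rw [Measure.restrict_apply (hE.measurableSet (Set.finite_Iic n)), Measure.smul_apply,
    smul_eq_mul] at key
  rwa [mul_comm]

/-- First step decomposition. -/
lemma IsChainFrom.lintegral_first_step (hP : ∀ i j, 0 ≤ P i j)
    (hκ : ∀ i, IsChainFrom P i (κ i)) (i : S) {F : (ℕ → S) → ℝ≥0∞} (hF : Measurable F) :
    ∫⁻ z, F z ∂κ i = ∑ j, ENNReal.ofReal (P i j) * ∫⁻ z, F (glue 1 (fun _ => i) z) ∂κ j := by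
  let W : S → ℕ → S := fun j k => if k = 0 then i else j
  have hm : Measurable (glue 1 (fun _ => i) : (ℕ → S) → ℕ → S) := by
    refine measurable_pi_lambda _ fun k => ?_
    unfold glue
    split_ifs
    · exact measurable_const
    · exact measurable_pi_apply _
  have hcyl : ∀ j, κ i (cyl 1 (W j)) = ENNReal.ofReal (P i j) := fun j => by
    rw [(hκ i).cyl_self 1 (by simp [W])]
    simp [pathProd, W]
  have hae : ∀ᵐ z ∂κ i, z ∈ ⋃ j ∈ (Finset.univ : Finset S), cyl 1 (W j) := by
    have hE : DependsOnWindow (Set.Iic 1) (⋃ j ∈ (Finset.univ : Finset S), cyl 1 (W j))ᶜ := by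
      intro x y hxy hx hy
      refine hx ?_
      simp only [Set.mem_iUnion] at hy ⊢
      obtain ⟨j, hj, hy⟩ := hy
      exact ⟨j, hj, fun k hk => (hxy k hk).trans (hy k hk)⟩
    have : (κ i) (⋃ j ∈ (Finset.univ : Finset S), cyl 1 (W j))ᶜ
        ≤ (0 : Measure (ℕ → S)) (⋃ j ∈ (Finset.univ : Finset S), cyl 1 (W j))ᶜ := by
      refine hE.measure_le (Set.finite_Iic 1) fun w hw => ?_
      change κ i (cyl 1 w) ≤ _
      have hw0 : w 0 ≠ i := by
        intro h0
        refine hw ?_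
        simp only [Set.mem_iUnion]
        refine ⟨w 1, Finset.mem_univ _, fun k hk => ?_⟩
        have : k ≤ 1 := hk
        interval_cases k <;> simp [W, h0]
      rw [hκ i 1 w]
      simp [hw0]
    rw [ae_iff]
    exact le_antisymm this bot_le
  have hdisj : (↑(Finset.univ : Finset S) : Set S).PairwiseDisjoint fun j => cyl 1 (W j) := by
    intro j _ k _ hjk
    refine Set.disjoint_left.2 fun z hz hz' => hjk ?_
    simpa [W] using (hz 1 (by simp)).symm.trans (hz' 1 (by simp))
  rw [← Measure.restrict_eq_self_of_ae_mem hae,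
    lintegral_biUnion_finset hdisj (fun j _ => measurableSet_cyl _ _)]
  refine Finset.sum_congr rfl fun j _ => ?_
  have h1 := IsMC.lintegral_cyl_drop (single_one_nonneg i) hP (hκ i) hκ 1 (W j) (hF.comp hm)
  rw [hcyl] at h1
  simp only [Function.comp_def] at h1
  have h2 : κ (W j 1) = κ j := by simp [W]
  rw [h2] at h1
  rw [← h1]
  refine setLIntegral_congr_fun (measurableSet_cyl _ _) fun z hz => ?_
  have : glue 1 (fun _ => i) (drop 1 z) = z := by
    funext k
    rcases Nat.eq_zero_or_pos k with rfl | hk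
    · simpa [glue, W] using (hz 0 (by simp)).symm
    · simp only [glue, drop, show ¬ k < 1 by omega, if_false]
      congr 1; omega
  simp only [this]

lemma IsChainFrom.ae_start {i : S} (h : IsChainFrom P i ρ) : ∀ᵐ z ∂ρ, z 0 = i := by
  have hE : DependsOnWindow (Set.Iic 0) {z : ℕ → S | z 0 ≠ i} := by
    intro x y hxy hx
    have := hxy 0 (by simp)
    simpa [← this] using hx
  have : ρ {z : ℕ → S | z 0 ≠ i} ≤ (0 : Measure (ℕ → S)) {z : ℕ → S | z 0 ≠ i} := by
    refine hE.measure_le (Set.finite_Iic 0) fun w hw => ?_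
    change ρ (cyl 0 w) ≤ _
    rw [h 0 w]
    simp [show w 0 ≠ i from hw]
  rw [ae_iff]
  simpa using this

lemma IsMC.ae_pathProd_pos (hP : ∀ i j, 0 ≤ P i j) (h : IsMC P p ρ) (n : ℕ) :
    ∀ᵐ z ∂ρ, 0 < pathProd P z n := by
  have hE : DependsOnWindow (Set.Iic n) {z : ℕ → S | ¬ 0 < pathProd P z n} := by
    intro x y hxy hx
    have := pathProd_congr P hxy
    simpa [← this] using hx
  have : ρ {z : ℕ → S | ¬ 0 < pathProd P z n}
      ≤ (0 : Measure (ℕ → S)) {z : ℕ → S | ¬ 0 < pathProd P z n} := by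
    refine hE.measure_le (Set.finite_Iic n) fun w hw => ?_
    change ρ (cyl n w) ≤ _
    rw [h n w, le_antisymm (not_lt.1 hw) (pathProd_nonneg hP w n)]
    simp
  rw [ae_iff]
  simpa using this

end Started

/-! ### Weak law of large numbers and asymptotic equipartition -/

section LawOfLargeNumbers

variable {S : Type*} [MeasurableSpace S] [Fintype S] [DecidableEq S] [DiscreteMeasurableSpace S]

lemma measurable_of_Iic_dependence {β : Type*} [MeasurableSpace β] (n : ℕ) {F : (ℕ → S) → β}
    (hF : ∀ x y, (∀ k ≤ n, x k = y k) → F x = F y) : Measurable F := by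
  intro s _
  refine DependsOnWindow.measurableSet (Set.finite_Iic n) fun x y hxy hx => ?_
  rw [Set.mem_preimage, ← hF x y hxy]
  exact hx

/-- Additive functional of the first `n` transitions. -/
def birk (f : S → S → ℝ) (n : ℕ) (z : ℕ → S) : ℝ := ∑ k ∈ Finset.range n, f (z k) (z (k + 1))

lemma measurable_birk (f : S → S → ℝ) (n : ℕ) : Measurable (birk f n) := by
  refine measurable_of_Iic_dependence n fun x y hxy => ?_
  refine Finset.sum_congr rfl fun k hk => ?_
  have := Finset.mem_range.1 hk
  rw [hxy k (by omega), hxy (k + 1) (by omega)]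

lemma birk_glue (f : S → S → ℝ) (n : ℕ) (i : S) (z : ℕ → S) :
    birk f (n + 1) (glue 1 (fun _ => i) z) = f i (z 0) + birk f n z := by
  rw [birk, Finset.sum_range_succ', add_comm]
  simp [glue, birk]

variable {P : Matrix S S ℝ} {κ : S → Measure (ℕ → S)}

lemma lintegral_sq_birk_le (hP : IsStochastic P) (hκ : ∀ i, IsChainFrom P i (κ i))
    {d : S → S → ℝ} (hd : ∀ i, ∑ j, P i j * d i j = 0) {D : ℝ} (hD : ∀ i j, d i j ^ 2 ≤ D)
    (n : ℕ) (i : S) (s : ℝ) :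
    ∫⁻ z, ENNReal.ofReal ((s + birk d n z) ^ 2) ∂κ i ≤ ENNReal.ofReal (s ^ 2 + n * D) := by
  induction n generalizing i s with
  | zero =>
    have := (hκ i).isProbabilityMeasure
    simp [birk]
  | succ n ih =>
    have hD0 : 0 ≤ D := (sq_nonneg _).trans (hD i i)
    have hm : Measurable fun z : ℕ → S => ENNReal.ofReal ((s + birk d (n + 1) z) ^ 2) :=
      (((measurable_birk d (n + 1)).const_add s).pow_const 2).ennreal_ofReal
    rw [IsChainFrom.lintegral_first_step hP.1 hκ i hm]
    calc ∑ j, ENNReal.ofReal (P i j) * ∫⁻ z, ENNReal.ofReal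
            ((s + birk d (n + 1) (glue 1 (fun _ => i) z)) ^ 2) ∂κ j
        ≤ ∑ j, ENNReal.ofReal (P i j * ((s + d i j) ^ 2 + n * D)) := by
          refine Finset.sum_le_sum fun j _ => ?_
          rw [ENNReal.ofReal_mul (hP.1 i j)]
          gcongr
          refine le_trans (le_of_eq ?_) (ih j (s + d i j))
          refine lintegral_congr_ae ?_
          filter_upwards [(hκ j).ae_start] with z hz
          rw [birk_glue, hz, add_assoc]
      _ = ENNReal.ofReal (∑ j, P i j * ((s + d i j) ^ 2 + n * D)) := by
          rw [ENNReal.ofReal_sum_of_nonneg]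
          intro j _
          have := hP.1 i j
          positivity
      _ ≤ ENNReal.ofReal (s ^ 2 + (n + 1 : ℕ) * D) := by
          refine ENNReal.ofReal_le_ofReal ?_
          have h1 : ∑ j, P i j * ((s + d i j) ^ 2 + n * D)
              = (s ^ 2 + n * D) * ∑ j, P i j + 2 * s * ∑ j, P i j * d i j
                + ∑ j, P i j * d i j ^ 2 := by
            rw [Finset.mul_sum, Finset.mul_sum, ← Finset.sum_add_distrib,
              ← Finset.sum_add_distrib]
            exact Finset.sum_congr rfl fun j _ => by ring
          have h2 : ∑ j, P i j * d i j ^ 2 ≤ ∑ j, P i j * D :=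
            Finset.sum_le_sum fun j _ => mul_le_mul_of_nonneg_left (hD i j) (hP.1 i j)
          rw [← Finset.sum_mul, hP.2] at h2
          rw [h1, hP.2, hd]
          push_cast
          linarith

theorem weak_law (hP : IsStochastic P) (hirr : IsIrreducibleMat P) {p : S → ℝ}
    (hp : IsStationaryVector P p) (hκ : ∀ i, IsChainFrom P i (κ i)) (f : S → S → ℝ) (i : S)
    {ε : ℝ} (hε : 0 < ε) :
    Tendsto (fun n : ℕ => κ i {z | ε * n < |birk f n z - n * ∑ i, ∑ j, p i * P i j * f i j|})
      atTop (nhds 0) := by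
  set m := ∑ i, ∑ j, p i * P i j * f i j with hmdef
  obtain ⟨g, hg⟩ := exists_poisson hP hirr hp (f := fun i => ∑ j, P i j * f i j - m) (by
    simp_rw [mul_sub, Finset.sum_sub_distrib, ← Finset.sum_mul, hp.2.1, one_mul, hmdef,
      Finset.mul_sum, mul_assoc, sub_self])
  obtain ⟨G, hG⟩ : ∃ G : ℝ, ∀ i, |g i| ≤ G :=
    ⟨∑ i, |g i|, fun i => Finset.single_le_sum (fun k _ => abs_nonneg (g k)) (Finset.mem_univ i)⟩
  let d : S → S → ℝ := fun i j => f i j - m - g i + g j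
  have hd : ∀ i, ∑ j, P i j * d i j = 0 := by
    intro i
    have h1 : ∑ j, P i j * d i j = ∑ j, P i j * f i j - (m + g i) * ∑ j, P i j
        + ∑ j, P i j * g j := by
      rw [Finset.mul_sum, ← Finset.sum_sub_distrib, ← Finset.sum_add_distrib]
      exact Finset.sum_congr rfl fun j _ => by simp only [d]; ring
    rw [h1, hP.2]
    linarith [hg i]
  obtain ⟨D, hD⟩ : ∃ D : ℝ, ∀ i j, d i j ^ 2 ≤ D :=
    ⟨∑ i, ∑ j, d i j ^ 2, fun i j => (Finset.single_le_sum (f := fun j => d i j ^ 2)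
      (fun k _ => sq_nonneg _) (Finset.mem_univ j)).trans
      (Finset.single_le_sum (f := fun i => ∑ j, d i j ^ 2)
        (fun k _ => Finset.sum_nonneg fun _ _ => sq_nonneg _) (Finset.mem_univ i))⟩
  have htel : ∀ n (z : ℕ → S), birk d n z = birk f n z - n * m - g (z 0) + g (z n) := by
    intro n z
    induction n with
    | zero => simp [birk]
    | succ n ih =>
      have h1 : birk d (n + 1) z = birk d n z + d (z n) (z (n + 1)) := Finset.sum_range_succ _ _
      have h2 : birk f (n + 1) z = birk f n z + f (z n) (z (n + 1)) := Finset.sum_range_succ _ _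
      rw [h1, ih, h2]
      simp only [d]
      push_cast
      ring
  have hbound : ∀ᶠ n : ℕ in atTop, κ i {z | ε * n < |birk f n z - n * m|}
      ≤ ENNReal.ofReal (4 * D / ε ^ 2 / n) := by
    filter_upwards [eventually_gt_atTop 0, eventually_ge_atTop ⌈4 * G / ε⌉₊] with n hn0 hn
    have hn' : 4 * G ≤ ε * n := by
      have := (Nat.ceil_le.1 hn)
      rw [div_le_iff₀ hε] at this
      linarith
    have hnpos : (0 : ℝ) < n := by exact_mod_cast hn0
    have hsub : {z : ℕ → S | ε * n < |birk f n z - n * m|}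
        ⊆ {z | ENNReal.ofReal ((ε * n / 2) ^ 2) ≤ ENNReal.ofReal ((0 + birk d n z) ^ 2)} := by
      intro z hz
      refine ENNReal.ofReal_le_ofReal ?_
      have hz' : ε * n < |birk f n z - n * m| := hz
      have h1 : |birk f n z - n * m| ≤ |birk d n z| + 2 * G := by
        have : birk f n z - n * m = birk d n z + g (z 0) - g (z n) := by rw [htel]; ring
        rw [this]
        have h3 := abs_sub (birk d n z + g (z 0)) (g (z n))
        have h4 := abs_add_le (birk d n z) (g (z 0))
        linarith [hG (z 0), hG (z n)]
      rw [zero_add, ← sq_abs (birk d n z)]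
      have : 0 ≤ ε * n / 2 := by positivity
      gcongr
      linarith
    have hm : Measurable fun z : ℕ → S => ENNReal.ofReal ((0 + birk d n z) ^ 2) :=
      (((measurable_birk d n).const_add 0).pow_const 2).ennreal_ofReal
    refine (measure_mono hsub).trans ((meas_ge_le_lintegral_div hm.aemeasurable
      (by rw [Ne, ENNReal.ofReal_eq_zero, not_le]; positivity) ENNReal.ofReal_ne_top).trans ?_)
    refine (ENNReal.div_le_div_right (lintegral_sq_birk_le hP hκ hd hD n i 0) _).trans ?_
    rw [← ENNReal.ofReal_div_of_pos (by positivity)]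
    refine ENNReal.ofReal_le_ofReal (le_of_eq ?_)
    field_simp
    ring
  have hlim : Tendsto (fun n : ℕ => ENNReal.ofReal (4 * D / ε ^ 2 / n)) atTop (nhds 0) := by
    rw [← ENNReal.ofReal_zero]
    exact ENNReal.tendsto_ofReal (tendsto_const_div_atTop_nhds_zero_nat _)
  exact tendsto_of_tendsto_of_tendsto_of_le_of_le' tendsto_const_nhds hlim
    (Eventually.of_forall fun _ => bot_le) hbound

lemma log_pathProd_eq {P : Matrix S S ℝ} {z : ℕ → S} {n : ℕ} (h : 0 < pathProd P z n) :
    Real.log (pathProd P z n) = - birk (fun i j => -Real.log (P i j)) n z := by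
  unfold pathProd birk at *
  rw [Real.log_prod fun k hk => Finset.prod_ne_zero_iff.1 h.ne' k hk]
  simp

lemma markovEntropy_eq (P : Matrix S S ℝ) (p : S → ℝ) :
    markovEntropy P p = ∑ i, ∑ j, p i * P i j * -Real.log (P i j) := by
  simp [markovEntropy]

theorem aep (hP : IsStochastic P) (hirr : IsIrreducibleMat P) {p : S → ℝ}
    (hp : IsStationaryVector P p) (hκ : ∀ i, IsChainFrom P i (κ i)) (i : S) {ε : ℝ} (hε : 0 < ε) :
    Tendsto (fun n : ℕ => κ i {z | ¬ (Real.exp (-((markovEntropy P p + ε) * n)) ≤ pathProd P z n ∧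
      pathProd P z n ≤ Real.exp (-((markovEntropy P p - ε) * n)))}) atTop (nhds 0) := by
  refine tendsto_of_tendsto_of_tendsto_of_le_of_le tendsto_const_nhds
    (weak_law hP hirr hp hκ (fun i j => -Real.log (P i j)) i hε) (fun _ => bot_le) fun n => ?_
  refine measure_mono_ae ?_
  filter_upwards [IsMC.ae_pathProd_pos hP.1 (hκ i) n] with z hz hz'
  have hlog := log_pathProd_eq hz
  have hz'' : ¬ (Real.exp (-((markovEntropy P p + ε) * n)) ≤ pathProd P z n ∧
      pathProd P z n ≤ Real.exp (-((markovEntropy P p - ε) * n))) := hz'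
  rw [← Real.le_log_iff_exp_le hz, ← Real.log_le_iff_le_exp hz, hlog] at hz''
  change ε * n < |birk _ n z - n * _|
  rw [← markovEntropy_eq]
  by_contra! hcon
  rw [abs_le] at hcon
  exact hz'' ⟨by linarith, by linarith⟩

end LawOfLargeNumbers

section Cesaro

variable {S : Type*} [Fintype S] [DecidableEq S]

/-- Cesàro convergence of the powers of an irreducible matrix, uniformly in the starting time. -/
lemma exists_cesaro_bound {P : Matrix S S ℝ} (hP : IsStochastic P) (hirr : IsIrreducibleMat P)
    {p : S → ℝ} (hp : IsStationaryVector P p) (b v : S) :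
    ∃ C : ℝ, ∀ m J : ℕ, ∑ j ∈ Finset.range J, (P ^ (m + j)) b v ≤ J * p v + C := by
  obtain ⟨g, hg⟩ := exists_poisson hP hirr hp (f := fun i => (if i = v then 1 else 0) - p v) (by
    simp_rw [mul_sub, Finset.sum_sub_distrib, ← Finset.sum_mul, hp.2.1]
    simp)
  let G : ℝ := ∑ i, |g i|
  have hG : ∀ n : ℕ, |∑ j, (P ^ n) b j * g j| ≤ G := fun n => by
    refine (Finset.abs_sum_le_sum_abs _ _).trans (Finset.sum_le_sum fun j _ => ?_)
    rw [abs_mul, abs_of_nonneg ((hP.pow n).1 b j)]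
    exact mul_le_of_le_one_left (abs_nonneg _) ((hP.pow n).le_one b j)
  have hstep : ∀ n : ℕ, (P ^ n) b v =
      p v + ∑ j, (P ^ n) b j * g j - ∑ j, (P ^ (n + 1)) b j * g j := by
    intro n
    have h1 : ∑ j, (P ^ n) b j * ((if j = v then 1 else 0) - p v) = (P ^ n) b v - p v := by
      simp_rw [mul_sub, Finset.sum_sub_distrib, ← Finset.sum_mul, (hP.pow n).2]
      simp
    have h2 : ∑ j, (P ^ n) b j * ((if j = v then 1 else 0) - p v)
        = ∑ j, (P ^ n) b j * g j - ∑ j, (P ^ (n + 1)) b j * g j := by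
      simp_rw [hg, mul_sub, Finset.sum_sub_distrib]
      congr 1
      simp_rw [pow_succ, Matrix.mul_apply, Finset.mul_sum, Finset.sum_mul]
      rw [Finset.sum_comm]
      simp_rw [mul_assoc]
    linarith
  refine ⟨2 * G, fun m J => ?_⟩
  have hsum : ∑ j ∈ Finset.range J, (P ^ (m + j)) b v
      = J * p v + ∑ j, (P ^ m) b j * g j - ∑ j, (P ^ (m + J)) b j * g j := by
    induction J with
    | zero => simp
    | succ J ih =>
      rw [Finset.sum_range_succ, ih, hstep (m + J)]
      push_cast
      rw [← add_assoc]
      ring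
  have h1 := abs_le.1 (hG m)
  have h2 := abs_le.1 (hG (m + J))
  rw [hsum]
  linarith

end Cesaro

/-! ### Dyadic cells -/

section Dyadic

/-- The uniform distribution on `[0, 1)`. -/
def unif : Measure ℝ := volume.restrict (Set.Ico 0 1)

instance : IsProbabilityMeasure unif := ⟨by simp [unif]⟩

lemma ae_unif_mem : ∀ᵐ U ∂unif, U ∈ Set.Ico (0 : ℝ) 1 := ae_restrict_mem measurableSet_Ico

/-- The dyadic cell of level `n` with index `k`. -/
def cell (n k : ℕ) : Set ℝ := Set.Ico (k / 2 ^ n : ℝ) ((k + 1) / 2 ^ n)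

lemma measurableSet_cell (n k : ℕ) : MeasurableSet (cell n k) := measurableSet_Ico

lemma mem_cell_iff {n k : ℕ} {U : ℝ} : U ∈ cell n k ↔ 0 ≤ U ∧ ⌊2 ^ n * U⌋₊ = k := by
  have h2 : (0 : ℝ) < 2 ^ n := by positivity
  unfold cell
  rw [Set.mem_Ico, div_le_iff₀ h2, lt_div_iff₀ h2]
  constructor
  · rintro ⟨h1, h3⟩
    have hU : 0 ≤ U := by
      by_contra! hneg
      have : (0 : ℝ) ≤ k := Nat.cast_nonneg k
      nlinarith
    refine ⟨hU, (Nat.floor_eq_iff (by positivity)).2 ⟨by linarith, by linarith⟩⟩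
  · rintro ⟨hU, h⟩
    have := (Nat.floor_eq_iff (by positivity)).1 h
    exact ⟨by linarith [this.1], by linarith [this.2]⟩

lemma mem_cell_floor {U : ℝ} (hU : 0 ≤ U) (n : ℕ) : U ∈ cell n ⌊2 ^ n * U⌋₊ :=
  mem_cell_iff.2 ⟨hU, rfl⟩

lemma floor_lt_two_pow {U : ℝ} (hU : U ∈ Set.Ico (0 : ℝ) 1) (n : ℕ) : ⌊2 ^ n * U⌋₊ < 2 ^ n := by
  rw [Nat.floor_lt (by have := hU.1; positivity)]
  push_cast
  have : (0 : ℝ) < 2 ^ n := by positivity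
  nlinarith [hU.2]

lemma cell_subset {n k : ℕ} (hk : k < 2 ^ n) : cell n k ⊆ Set.Ico 0 1 := by
  intro U hU
  have h2 : (0 : ℝ) < 2 ^ n := by positivity
  refine ⟨(mem_cell_iff.1 hU).1, hU.2.trans_le ?_⟩
  rw [div_le_one h2]
  exact_mod_cast hk

lemma volume_cell (n k : ℕ) : volume (cell n k) = ENNReal.ofReal (2 ^ n)⁻¹ := by
  rw [cell, Real.volume_Ico]
  congr 1
  field_simp
  ring

lemma floor_two_pow_of_le {U U' : ℝ} {i j : ℕ} (hij : i ≤ j)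
    (h : ⌊2 ^ j * U⌋₊ = ⌊2 ^ j * U'⌋₊) : ⌊2 ^ i * U⌋₊ = ⌊2 ^ i * U'⌋₊ := by
  have key : ∀ V : ℝ, ⌊2 ^ i * V⌋₊ = ⌊2 ^ j * V⌋₊ / 2 ^ (j - i) := fun V => by
    have := Nat.floor_div_natCast (2 ^ j * V) (2 ^ (j - i))
    rw [← this]
    congr 1
    push_cast
    rw [_root_.eq_div_iff (by positivity), mul_right_comm, ← pow_add, Nat.add_sub_cancel' hij]
  rw [key, key, h]

lemma lintegral_affine {a : ℝ} (ha : 0 < a) (b : ℝ) {H : ℝ → ℝ≥0∞} (hH : Measurable H) :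
    ∫⁻ U, H (a * U + b) ∂unif = ENNReal.ofReal a⁻¹ * ∫⁻ V in Set.Ico b (a + b), H V := by
  have hmap : Measure.map (fun U : ℝ => a * U + b) volume = ENNReal.ofReal a⁻¹ • volume := by
    have h1 : (fun U : ℝ => a * U + b) = (fun x => x + b) ∘ (fun x => a * x) := rfl
    rw [h1, ← Measure.map_map (by fun_prop) (by fun_prop), Real.map_volume_mul_left ha.ne',
      Measure.map_smul, map_add_right_eq_self, abs_of_pos (inv_pos.2 ha)]
  have hpre : Set.Ico (0 : ℝ) 1 = (fun U : ℝ => a * U + b) ⁻¹' Set.Ico b (a + b) := by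
    ext U
    simp only [Set.mem_Ico, Set.mem_preimage]
    constructor
    · rintro ⟨h1, h2⟩
      constructor <;> nlinarith
    · rintro ⟨h1, h2⟩
      constructor
      · by_contra! hneg; nlinarith
      · by_contra! hneg; nlinarith
  rw [unif, hpre, ← lintegral_map (μ := volume.restrict _) hH (by fun_prop),
    ← Measure.restrict_map (by fun_prop) measurableSet_Ico, hmap, Measure.restrict_smul,
    lintegral_smul_measure, smul_eq_mul]

lemma lintegral_sub_cell (n k : ℕ) {H : ℝ → ℝ≥0∞} (hH : Measurable H) :
    ∫⁻ U, H ((k + U) / 2 ^ n) ∂unif = 2 ^ n * ∫⁻ V in cell n k, H V := by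
  have := lintegral_affine (a := (2 ^ n)⁻¹) (by positivity) (k / 2 ^ n) hH
  rw [inv_inv, ENNReal.ofReal_pow (by norm_num)] at this
  simp only [ENNReal.ofReal_ofNat] at this
  rw [cell]
  have h2 : ((2 ^ n)⁻¹ + k / 2 ^ n : ℝ) = (k + 1) / 2 ^ n := by field_simp; ring
  rw [h2] at this
  rw [← this]
  refine lintegral_congr fun U => ?_
  congr 1
  field_simp
  ring

lemma fract_of_mem_cell {n k : ℕ} {U : ℝ} (hU : U ∈ cell n k) :
    Int.fract (2 ^ n * U) = 2 ^ n * U - k := by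
  have h := mem_cell_iff.1 hU
  have h0 : (0 : ℝ) ≤ 2 ^ n * U := mul_nonneg (by positivity) h.1
  rw [Int.fract, ← natCast_floor_eq_intCast_floor h0, h.2]

lemma lintegral_fract_cell (n k : ℕ) {e : ℝ → ℝ≥0∞} (he : Measurable e) :
    ∫⁻ U in cell n k, e (Int.fract (2 ^ n * U)) = volume (cell n k) * ∫⁻ U, e U ∂unif := by
  have h1 := lintegral_sub_cell n k (H := fun V => e (2 ^ n * V - k)) (by fun_prop)
  have h2 : ∀ U : ℝ, 2 ^ n * ((k + U) / 2 ^ n) - k = U := fun U => by field_simp; ring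
  simp only [h2] at h1
  rw [h1, volume_cell, ← mul_assoc, ENNReal.ofReal_inv_of_pos (by positivity),
    ENNReal.ofReal_pow (by norm_num)]
  simp only [ENNReal.ofReal_ofNat]
  rw [ENNReal.inv_mul_cancel (by simp) (by simp), one_mul]
  exact setLIntegral_congr_fun (measurableSet_cell n k) fun U hU => by
    simp only [fract_of_mem_cell hU]

lemma lintegral_unif_eq_sum_cell (n : ℕ) (H : ℝ → ℝ≥0∞) :
    ∫⁻ U, H U ∂unif = ∑ k ∈ Finset.range (2 ^ n), ∫⁻ U in cell n k, H U := by
  rw [← lintegral_biUnion_finset _ fun k _ => measurableSet_cell n k]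
  · rw [unif]
    congr 2
    ext U
    simp only [Set.mem_iUnion, Finset.mem_range, exists_prop]
    exact ⟨fun hU => ⟨_, floor_lt_two_pow hU n, mem_cell_floor hU.1 n⟩,
      fun ⟨k, hk, hU⟩ => cell_subset hk hU⟩
  · intro k _ l _ hkl
    exact Set.disjoint_left.2 fun U hU hU' =>
      hkl ((mem_cell_iff.1 hU).2.symm.trans (mem_cell_iff.1 hU').2)

end Dyadic

/-! ### Generating a finite distribution from a uniform variable, using few binary digits -/

section Generator

variable {V : Type*}

/-- `pick` samples from `q` by reading the first `c U` binary digits of `U`. -/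
structure IsGenerator (q : V → ℝ) (c : ℝ → ℕ) (pick : ℝ → V) (good : Set ℝ) : Prop where
  measurable_cost : Measurable c
  measurableSet_pick : ∀ A : Set V, MeasurableSet (pick ⁻¹' A)
  ae_good : ∀ᵐ U ∂unif, U ∈ good
  good_subset : good ⊆ Set.Ico 0 1
  stable : ∀ U ∈ good, ∀ U' ∈ Set.Ico (0 : ℝ) 1, ⌊2 ^ c U * U⌋₊ = ⌊2 ^ c U * U'⌋₊ →
    U' ∈ good ∧ c U' = c U ∧ pick U' = pick U
  pick_le : ∀ v, unif (pick ⁻¹' {v}) ≤ ENNReal.ofReal (q v)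
  cost_le : ∀ v, ∫⁻ U in pick ⁻¹' {v}, ENNReal.ofReal (√(2 ^ c U)) ∂unif
    ≤ ENNReal.ofReal (14 * √(q v))

lemma IsGenerator.lintegral_mul {q : V → ℝ} {c : ℝ → ℕ} {pick : ℝ → V} {good : Set ℝ}
    (h : IsGenerator q c pick good) (C : ℕ → V → ℝ≥0∞) {e : ℝ → ℝ≥0∞} (he : Measurable e) :
    ∫⁻ U, C (c U) (pick U) * e (Int.fract (2 ^ c U * U)) ∂unif
      = (∫⁻ U, C (c U) (pick U) ∂unif) * ∫⁻ U, e U ∂unif := by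
  let G : ℕ × ℕ → Set ℝ := fun jk => {U | U ∈ cell jk.1 jk.2 ∧ U ∈ good ∧ c U = jk.1}
  have hG : ∀ jk, G jk = ∅ ∨ (G jk = cell jk.1 jk.2 ∧ ∃ v, ∀ U ∈ G jk, pick U = v) := by
    intro jk
    rcases Set.eq_empty_or_nonempty (G jk) with h0 | ⟨U₀, hU₀, hg, hc⟩
    · exact Or.inl h0
    · right
      have hk : jk.2 < 2 ^ jk.1 := by
        rw [← (mem_cell_iff.1 hU₀).2]
        exact floor_lt_two_pow (h.good_subset hg) _
      have key : ∀ U ∈ cell jk.1 jk.2, U ∈ good ∧ c U = c U₀ ∧ pick U = pick U₀ := fun U hU =>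
        h.stable U₀ hg U (cell_subset hk hU) (by
          rw [hc, (mem_cell_iff.1 hU).2, (mem_cell_iff.1 hU₀).2])
      refine ⟨Set.Subset.antisymm (fun U hU => hU.1) fun U hU => ⟨hU, (key U hU).1, ?_⟩,
        pick U₀, fun U hU => (key U hU.1).2.2⟩
      rw [(key U hU).2.1, hc]
  have hGm : ∀ jk, MeasurableSet (G jk) := fun jk => by
    rcases hG jk with h0 | ⟨h0, -⟩
    · rw [h0]; exact MeasurableSet.empty
    · rw [h0]; exact measurableSet_cell _ _
  have hGd : Pairwise (Function.onFun Disjoint G) := by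
    intro jk jk' hne
    refine Set.disjoint_left.2 fun U hU hU' => hne ?_
    have h1 : jk.1 = jk'.1 := hU.2.2.symm.trans hU'.2.2
    refine Prod.ext h1 ?_
    rw [← (mem_cell_iff.1 hU.1).2, h1, (mem_cell_iff.1 hU'.1).2]
  have hunif : unif = volume.restrict (⋃ jk, G jk) := by
    refine Measure.restrict_congr_set ?_
    have h1 := h.ae_good
    rw [unif, ae_restrict_iff' measurableSet_Ico] at h1
    filter_upwards [h1] with U hU
    refine propext ⟨fun hI => ?_, fun hI => ?_⟩
    · exact Set.mem_iUnion.2 ⟨(c U, ⌊2 ^ c U * U⌋₊), mem_cell_floor hI.1 _, hU hI, rfl⟩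
    · obtain ⟨jk, hjk⟩ := Set.mem_iUnion.1 hI
      exact h.good_subset hjk.2.1
  have hsum : ∀ F : ℝ → ℝ≥0∞, ∫⁻ U, F U ∂unif = ∑' jk, ∫⁻ U in G jk, F U := fun F => by
    rw [hunif, lintegral_iUnion hGm hGd]
  rw [hsum, hsum (fun U => C (c U) (pick U)), ← ENNReal.tsum_mul_right]
  refine tsum_congr fun jk => ?_
  rcases hG jk with h0 | ⟨h0, v, hv⟩
  · simp [h0]
  · have h1 : ∫⁻ U in G jk, C (c U) (pick U) * e (Int.fract (2 ^ c U * U))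
        = ∫⁻ U in G jk, C jk.1 v * e (Int.fract (2 ^ jk.1 * U)) :=
      setLIntegral_congr_fun (hGm jk) fun U hU => by simp only [hv U hU, hU.2.2]
    have h2 : ∫⁻ U in G jk, C (c U) (pick U) = ∫⁻ _ in G jk, C jk.1 v :=
      setLIntegral_congr_fun (hGm jk) fun U hU => by simp only [hv U hU, hU.2.2]
    rw [h1, h2, setLIntegral_const, lintegral_const_mul _ (by fun_prop), h0,
      lintegral_fract_cell _ _ he, mul_assoc]

lemma exists_interval_cover [DecidableEq V] (q : V → ℝ) (s : Finset V) :
    ∃ F : V → ℝ, ∀ U : ℝ, 0 ≤ U → U < ∑ v ∈ s, q v → ∃ v ∈ s, F v ≤ U ∧ U < F v + q v := by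
  induction s using Finset.induction_on with
  | empty => exact ⟨fun _ => 0, fun U h0 h1 => by simp at h1; linarith⟩
  | insert v s hv ih =>
    obtain ⟨F, hF⟩ := ih
    refine ⟨Function.update F v (∑ v ∈ s, q v), fun U h0 h1 => ?_⟩
    rw [Finset.sum_insert hv] at h1
    by_cases hU : U < ∑ v ∈ s, q v
    · obtain ⟨w, hw, hw'⟩ := hF U h0 hU
      refine ⟨w, Finset.mem_insert_of_mem hw, ?_⟩
      rwa [Function.update_of_ne (by rintro rfl; exact hv hw)]
    · refine ⟨v, Finset.mem_insert_self _ _, ?_⟩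
      rw [Function.update_self]
      exact ⟨not_lt.1 hU, by linarith⟩

lemma geometric_tail_sqrt_le {x : ℝ} (hx : 0 < x) :
    ∑' j : ℕ, (if ((2 : ℝ) ^ j)⁻¹ ≤ x then ENNReal.ofReal (4 * (√(2 ^ j))⁻¹) else 0)
      ≤ ENNReal.ofReal (14 * √x) := by
  have hex : ∃ j : ℕ, ((2 : ℝ) ^ j)⁻¹ ≤ x := by
    obtain ⟨j, hj⟩ := exists_pow_lt_of_lt_one hx (by norm_num : (2⁻¹ : ℝ) < 1)
    exact ⟨j, by rw [← inv_pow]; exact hj.le⟩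
  classical
  set j₀ := Nat.find hex with hj₀
  have hspec := Nat.find_spec hex
  set s : ℝ := (√2)⁻¹ with hs
  have hs0 : 0 < s := by positivity
  have hs2 : s ^ 2 = 1 / 2 := by
    rw [hs, inv_pow, Real.sq_sqrt (by norm_num)]; norm_num
  have hs1 : s ≤ 5 / 7 := by nlinarith
  have hterm : ∀ j : ℕ, (√((2 : ℝ) ^ j))⁻¹ = s ^ j := fun j => by
    rw [hs, inv_pow]
    congr 1
    rw [Real.sqrt_eq_iff_mul_self_eq (by positivity) (by positivity), ← mul_pow,
      Real.mul_self_sqrt (by norm_num)]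
  have hsum : HasSum (fun j : ℕ => 4 * s ^ (j + j₀)) (4 * ((1 - s)⁻¹ * s ^ j₀)) := by
    have := ((hasSum_geometric_of_lt_one hs0.le (by linarith)).mul_left (s ^ j₀)).mul_left 4
    simpa only [pow_add, mul_comm (s ^ j₀)] using this
  calc ∑' j : ℕ, (if ((2 : ℝ) ^ j)⁻¹ ≤ x then ENNReal.ofReal (4 * (√(2 ^ j))⁻¹) else 0)
      ≤ ∑' j : ℕ, (if j₀ ≤ j then ENNReal.ofReal (4 * s ^ j) else 0) := by
        refine ENNReal.tsum_le_tsum fun j => ?_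
        by_cases hj : ((2 : ℝ) ^ j)⁻¹ ≤ x
        · rw [if_pos hj, if_pos (Nat.find_min' hex hj), hterm]
        · rw [if_neg hj]; exact bot_le
    _ = ∑' j : ℕ, ENNReal.ofReal (4 * s ^ (j + j₀)) := by
        rw [← ENNReal.summable.sum_add_tsum_nat_add' (k := j₀) (f := fun j : ℕ =>
          if j₀ ≤ j then ENNReal.ofReal (4 * s ^ j) else 0)]
        rw [Finset.sum_eq_zero fun j hj => if_neg (not_le.2 (Finset.mem_range.1 hj)), zero_add]
        exact tsum_congr fun j => if_pos (Nat.le_add_left _ _)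
    _ = ENNReal.ofReal (4 * (s ^ j₀ * (1 - s)⁻¹)) := by
        rw [mul_comm (s ^ j₀), ← ENNReal.ofReal_tsum_of_nonneg (fun j => by positivity)
          hsum.summable, hsum.tsum_eq]
    _ ≤ ENNReal.ofReal (14 * √x) := by
        refine ENNReal.ofReal_le_ofReal ?_
        have h1 : s ^ j₀ ≤ √x := by
          rw [← hterm, ← Real.sqrt_inv]
          exact Real.sqrt_le_sqrt hspec
        have h2 : (1 - s)⁻¹ ≤ 7 / 2 := by
          rw [inv_le_comm₀ (by linarith) (by norm_num)]; linarith
        have h3 : s ^ j₀ * (1 - s)⁻¹ ≤ √x * (7 / 2) :=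
          mul_le_mul h1 h2 (inv_nonneg.2 (by linarith)) (Real.sqrt_nonneg x)
        linarith

lemma exists_generator [Fintype V] [Nonempty V] (q : V → ℝ) (hq : ∀ v, 0 ≤ q v)
    (hq1 : ∑ v, q v = 1) : ∃ (c : ℝ → ℕ) (pick : ℝ → V) (good : Set ℝ),
      IsGenerator q c pick good := by
  classical
  obtain ⟨F, hF⟩ := exists_interval_cover q Finset.univ
  rw [hq1] at hF
  let pr : ℕ → ℕ → V → Prop := fun j k v =>
    F v ≤ k / 2 ^ j ∧ ((k : ℝ) + 1) / 2 ^ j ≤ F v + q v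
  have hprcell : ∀ {j k v U}, pr j k v → U ∈ cell j k → U ∈ Set.Ico (F v) (F v + q v) :=
    fun h hU => ⟨h.1.trans hU.1, hU.2.trans_le h.2⟩
  let hit : ℕ → ℝ → Prop := fun j U => ∃ v, pr j ⌊2 ^ j * U⌋₊ v
  have hhitm : ∀ j, MeasurableSet {U | hit j U} := fun j => by
    have : Measurable fun U : ℝ => ⌊2 ^ j * U⌋₊ := Nat.measurable_floor.comp (by fun_prop)
    exact this (MeasurableSet.of_discrete (s := {k | ∃ v, pr j k v}))
  have hex : ∀ U, ∃ j, hit j U ∨ ∀ i, ¬ hit i U := fun U => by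
    by_cases h : ∃ j, hit j U
    · exact h.imp fun j hj => Or.inl hj
    · exact ⟨0, Or.inr fun i hi => h ⟨i, hi⟩⟩
  let c : ℝ → ℕ := fun U => Nat.find (hex U)
  have hcm : Measurable c := by
    refine measurable_find hex fun j => ?_
    have : {x | hit j x ∨ ∀ i, ¬ hit i x} = {x | hit j x} ∪ ⋂ i, {x | hit i x}ᶜ := by
      ext x; simp
    rw [this]
    exact (hhitm j).union (MeasurableSet.iInter fun i => (hhitm i).compl)
  let pk : ℕ → ℕ → V := fun j k =>
    if h : ∃ v, pr j k v then h.choose else Classical.arbitrary V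
  let pick : ℝ → V := fun U => pk (c U) ⌊2 ^ c U * U⌋₊
  let good : Set ℝ := {U | U ∈ Set.Ico (0 : ℝ) 1 ∧ ∃ j, hit j U}
  have hchit : ∀ U ∈ good, hit (c U) U := fun U hU => by
    rcases Nat.find_spec (hex U) with h | h
    · exact h
    · obtain ⟨j, hj⟩ := hU.2
      exact absurd hj (h j)
  have hmin : ∀ U, ∀ i < c U, ¬ hit i U := fun U i hi h => Nat.find_min (hex U) hi (Or.inl h)
  have hpick : ∀ U ∈ good, pr (c U) ⌊2 ^ c U * U⌋₊ (pick U) := fun U hU => by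
    have h := hchit U hU
    change pr (c U) ⌊2 ^ c U * U⌋₊ (pk (c U) ⌊2 ^ c U * U⌋₊)
    simp only [pk]
    rw [dif_pos h]
    exact h.choose_spec
  have hpickm : ∀ A : Set V, MeasurableSet (pick ⁻¹' A) := fun A => by
    have h1 : Measurable fun U : ℝ => ⌊2 ^ c U * U⌋₊ := by
      refine Nat.measurable_floor.comp (Measurable.mul ?_ measurable_id)
      exact (measurable_from_nat (f := fun n => (2 : ℝ) ^ n)).comp hcm
    exact (hcm.prodMk h1) (MeasurableSet.of_discrete (s := {jk : ℕ × ℕ | pk jk.1 jk.2 ∈ A}))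
  have hgood : ∀ᵐ U ∂unif, U ∈ good := by
    have hfin : ∀ᵐ U ∂unif, U ∉ Set.range F := by
      have : (volume : Measure ℝ) (Set.range F) = 0 := (Set.finite_range F).measure_zero _
      exact ae_restrict_of_ae (measure_eq_zero_iff_ae_notMem.1 this)
    filter_upwards [hfin, ae_unif_mem] with U hU hI
    obtain ⟨v, -, h1, h2⟩ := hF U hI.1 hI.2
    have h1' : F v < U := lt_of_le_of_ne h1 fun h => hU ⟨v, h⟩
    obtain ⟨j, hj⟩ := exists_pow_lt_of_lt_one
      (lt_min (sub_pos.2 h1') (sub_pos.2 h2)) (by norm_num : (2⁻¹ : ℝ) < 1)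
    rw [inv_pow] at hj
    have hj1 := hj.trans_le (min_le_left _ _)
    have hj2 := hj.trans_le (min_le_right _ _)
    have hc := mem_cell_floor hI.1 j
    have e : ((⌊2 ^ j * U⌋₊ : ℝ) + 1) / 2 ^ j = ⌊2 ^ j * U⌋₊ / 2 ^ j + (2 ^ j)⁻¹ := by
      field_simp
    refine ⟨hI, j, v, ?_, ?_⟩
    · have := hc.2
      rw [e] at this
      linarith
    · have := hc.1
      rw [e]
      linarith
  have hsub : ∀ v, pick ⁻¹' {v} ∩ good ⊆ Set.Ico (F v) (F v + q v) := fun v U hU => by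
    have h1 := hpick U hU.2
    rw [show pick U = v from hU.1] at h1
    exact hprcell h1 (mem_cell_floor hU.2.1.1 _)
  have hae : ∀ A : Set ℝ, unif A ≤ volume (A ∩ good) := fun A => by
    calc unif A ≤ unif (A ∩ good) := measure_mono_ae (by
          filter_upwards [hgood] with U hU hA using ⟨hA, hU⟩)
      _ ≤ volume (A ∩ good) := Measure.restrict_apply_le _ _
  refine ⟨c, pick, good, hcm, hpickm, hgood, fun U hU => hU.1, ?_, fun v => ?_, fun v => ?_⟩
  · intro U hU U' hU' hfl
    have hiff : ∀ i ≤ c U, (hit i U' ↔ hit i U) := fun i hi => by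
      simp only [hit, floor_two_pow_of_le hi hfl]
    have hg' : U' ∈ good := ⟨hU', c U, (hiff _ le_rfl).2 (hchit U hU)⟩
    have hcc : c U' = c U := by
      refine le_antisymm (Nat.find_min' (hex U') (Or.inl ((hiff _ le_rfl).2 (hchit U hU)))) ?_
      by_contra! hlt
      exact hmin U _ hlt ((hiff _ hlt.le).1 (hchit U' hg'))
    refine ⟨hg', hcc, ?_⟩
    simp only [pick, hcc, hfl]
  · refine (hae _).trans ((measure_mono (hsub v)).trans ?_)
    rw [Real.volume_Ico]
    simp
  · have hlevel : ∀ j, unif (pick ⁻¹' {v} ∩ c ⁻¹' {j})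
        ≤ if ((2 : ℝ) ^ j)⁻¹ ≤ q v then ENNReal.ofReal (4 * (2 ^ j)⁻¹) else 0 := by
      intro j
      split_ifs with hjq
      · rcases j with _ | j
        · refine prob_le_one.trans ?_
          rw [← ENNReal.ofReal_one]
          exact ENNReal.ofReal_le_ofReal (by norm_num)
        · have hs : (pick ⁻¹' {v} ∩ c ⁻¹' {j + 1}) ∩ good
              ⊆ Set.Ico (F v) (F v + (2 ^ j)⁻¹) ∪ Set.Ico (F v + q v - (2 ^ j)⁻¹) (F v + q v) := by
            rintro U ⟨⟨hv, hc⟩, hg⟩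
            have hI := hsub v ⟨hv, hg⟩
            by_contra hcon
            simp only [Set.mem_union, Set.mem_Ico, not_or, not_and, not_lt] at hcon
            have h1 := hcon.1 hI.1
            have h2 : U < F v + q v - (2 ^ j)⁻¹ := by
              by_contra! h; exact absurd (hcon.2 h) (not_le.2 hI.2)
            have hcj : c U = j + 1 := hc
            refine hmin U j (by omega) ⟨v, ?_, ?_⟩
            · have := (mem_cell_floor hg.1.1 j).2
              have e : ((⌊2 ^ j * U⌋₊ : ℝ) + 1) / 2 ^ j = ⌊2 ^ j * U⌋₊ / 2 ^ j + (2 ^ j)⁻¹ := by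
                field_simp
              rw [e] at this
              linarith
            · have := (mem_cell_floor hg.1.1 j).1
              have e : ((⌊2 ^ j * U⌋₊ : ℝ) + 1) / 2 ^ j = ⌊2 ^ j * U⌋₊ / 2 ^ j + (2 ^ j)⁻¹ := by
                field_simp
              rw [e]
              linarith
          refine (hae _).trans ((measure_mono hs).trans ((measure_union_le _ _).trans ?_))
          rw [Real.volume_Ico, Real.volume_Ico, ← ENNReal.ofReal_add (by simp) (by simp)]
          refine ENNReal.ofReal_le_ofReal (le_of_eq ?_)
          rw [pow_succ, mul_inv]
          ring
      · rw [nonpos_iff_eq_zero]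
        refine le_antisymm ((hae _).trans ?_) bot_le
        rw [nonpos_iff_eq_zero]
        convert measure_empty (μ := volume)
        ext U
        simp only [Set.mem_inter_iff, Set.mem_empty_iff_false, iff_false]
        rintro ⟨⟨hv, hc⟩, hg⟩
        have h1 := hpick U hg
        rw [show pick U = v from hv, show c U = j from hc] at h1
        refine hjq ?_
        have e : ((⌊2 ^ j * U⌋₊ : ℝ) + 1) / 2 ^ j = ⌊2 ^ j * U⌋₊ / 2 ^ j + (2 ^ j)⁻¹ := by
          field_simp
        have h2 := h1.2
        rw [e] at h2
        linarith [h1.1]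
    have hsplit : ∫⁻ U in pick ⁻¹' {v}, ENNReal.ofReal (√(2 ^ c U)) ∂unif
        = ∑' j : ℕ, ENNReal.ofReal (√(2 ^ j)) * unif (pick ⁻¹' {v} ∩ c ⁻¹' {j}) := by
      have h1 : pick ⁻¹' {v} = ⋃ j, pick ⁻¹' {v} ∩ c ⁻¹' {j} := by
        ext U; simp
      have hm : ∀ j, MeasurableSet (pick ⁻¹' {v} ∩ c ⁻¹' {j}) := fun j =>
        (hpickm _).inter (hcm (measurableSet_singleton j))
      conv_lhs => rw [h1]
      rw [lintegral_iUnion hm]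
      · refine tsum_congr fun j => ?_
        rw [← setLIntegral_const]
        exact setLIntegral_congr_fun (hm j) fun U hU => by
          simp only [show c U = j from hU.2]
      · intro i j hij
        exact Set.disjoint_left.2 fun U hU hU' => hij (hU.2.symm.trans hU'.2)
    rw [hsplit]
    rcases (hq v).eq_or_lt with h0 | hpos
    · refine le_trans (le_of_eq (ENNReal.tsum_eq_zero.2 fun j => ?_)) bot_le
      have := hlevel j
      rw [if_neg (by rw [← h0, not_le]; positivity)] at this
      rw [nonpos_iff_eq_zero.1 this, mul_zero]
    · refine le_trans (ENNReal.tsum_le_tsum fun j => ?_)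
        (geometric_tail_sqrt_le hpos)
      refine (mul_le_mul_right (hlevel j) _).trans ?_
      split_ifs
      · rw [← ENNReal.ofReal_mul (by positivity)]
        refine ENNReal.ofReal_le_ofReal (le_of_eq ?_)
        have h1 : √((2 : ℝ) ^ j) ≠ 0 := by positivity
        have h2 : √((2 : ℝ) ^ j) * √((2 : ℝ) ^ j) = 2 ^ j := Real.mul_self_sqrt (by positivity)
        rw [← h2]
        field_simp
        rw [Real.sqrt_sq (by positivity)]
      · simp

end Generator

/-! ### Splitting the fibres of a map into pieces of dyadic size -/

section DyadicIndex

variable {A B : Type*}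

/-- Each fibre of `f` on `T` is partitioned by `nb` into pieces, the piece with `nb = n` being
enumerated by `ix` as `0, …, 2 ^ n - 1`. -/
def IsDyadicIndex (T : Finset A) (f : A → B) (nb ix : A → ℕ) : Prop :=
  ∀ w ∈ T, ix w < 2 ^ nb w ∧
    ∀ k < 2 ^ nb w, ∃! w', w' ∈ T ∧ f w' = f w ∧ nb w' = nb w ∧ ix w' = k

lemma exists_dyadic_split [DecidableEq A] (n : ℕ) : ∀ T : Finset A, T.card < 2 ^ n →
    ∃ nb ix : A → ℕ, ∀ w ∈ T, nb w < n ∧ ix w < 2 ^ nb w ∧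
      ∀ k < 2 ^ nb w, ∃! w', w' ∈ T ∧ nb w' = nb w ∧ ix w' = k := by
  induction n with
  | zero =>
    intro T hT
    refine ⟨0, 0, fun w hw => ?_⟩
    have : T = ∅ := by simpa using hT
    simp [this] at hw
  | succ n ih =>
    intro T hT
    by_cases hlt : T.card < 2 ^ n
    · obtain ⟨nb, ix, h⟩ := ih T hlt
      exact ⟨nb, ix, fun w hw => ⟨(h w hw).1.trans (Nat.lt_succ_self n), (h w hw).2⟩⟩
    · obtain ⟨T', hT', hcard⟩ := Finset.exists_subset_card_eq (not_lt.1 hlt)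
      have hrest : (T \ T').card < 2 ^ n := by
        rw [Finset.card_sdiff_of_subset hT', hcard]
        rw [pow_succ] at hT
        omega
      obtain ⟨nb, ix, h⟩ := ih _ hrest
      let e : T' ≃ Fin (2 ^ n) := T'.equivFinOfCardEq hcard
      refine ⟨fun w => if w ∈ T' then n else nb w,
        fun w => if hw : w ∈ T' then e ⟨w, hw⟩ else ix w, fun w hw => ?_⟩
      by_cases hw' : w ∈ T'
      · simp only [hw', if_true, dif_pos]
        refine ⟨Nat.lt_succ_self n, (e ⟨w, hw'⟩).2, fun k hk => ?_⟩
        refine ⟨(e.symm ⟨k, hk⟩ : A), ?_, ?_⟩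
        · simp [hT' (e.symm ⟨k, hk⟩).2]
        · rintro y ⟨hy, hy2, hy3⟩
          have hyT : y ∈ T' := by
            by_contra hyT
            rw [if_neg hyT] at hy2
            have := (h y (Finset.mem_sdiff.2 ⟨hy, hyT⟩)).1
            omega
          rw [dif_pos hyT] at hy3
          have : e ⟨y, hyT⟩ = ⟨k, hk⟩ := Fin.ext hy3
          rw [← this, Equiv.symm_apply_apply]
      · simp only [hw', if_false, dif_neg, not_false_iff]
        obtain ⟨h1, h2, h3⟩ := h w (Finset.mem_sdiff.2 ⟨hw, hw'⟩)
        refine ⟨h1.trans (Nat.lt_succ_self n), h2, fun k hk => ?_⟩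
        obtain ⟨y, ⟨hy1, hy2, hy3⟩, hu⟩ := h3 k hk
        have hyT := (Finset.mem_sdiff.1 hy1).2
        refine ⟨y, ⟨(Finset.mem_sdiff.1 hy1).1, by simp [hyT, hy2], by simp [hyT, hy3]⟩, ?_⟩
        rintro y' ⟨hy', hy2', hy3'⟩
        have hyT' : y' ∉ T' := fun hmem => by
          rw [if_pos hmem] at hy2'
          omega
        simp only [hyT', if_false, dif_neg, not_false_iff] at hy2' hy3'
        exact hu y' ⟨Finset.mem_sdiff.2 ⟨hy', hyT'⟩, hy2', hy3'⟩

lemma exists_isDyadicIndex (T : Finset A) (f : A → B) {n : ℕ} (hn : T.card < 2 ^ n) :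
    ∃ nb ix : A → ℕ, IsDyadicIndex T f nb ix ∧ ∀ w ∈ T, nb w < n := by
  classical
  choose nb ix h using fun b : B => exists_dyadic_split n (T.filter fun w => f w = b)
    ((Finset.card_filter_le _ _).trans_lt hn)
  refine ⟨fun w => nb (f w) w, fun w => ix (f w) w, fun w hw => ?_, fun w hw => ?_⟩
  · obtain ⟨-, h2, h3⟩ := h (f w) w (Finset.mem_filter.2 ⟨hw, rfl⟩)
    refine ⟨h2, fun k hk => ?_⟩
    obtain ⟨y, ⟨hy1, hy2, hy3⟩, hu⟩ := h3 k hk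
    have hy := Finset.mem_filter.1 hy1
    refine ⟨y, ⟨hy.1, hy.2, by simp [hy.2, hy2], by simp [hy.2, hy3]⟩, ?_⟩
    rintro y' ⟨ha, hb, hc, hd⟩
    simp only [hb] at hc hd
    exact hu y' ⟨Finset.mem_filter.2 ⟨ha, hb⟩, hc, hd⟩
  · exact (h (f w) w (Finset.mem_filter.2 ⟨hw, rfl⟩)).1

/-- The set of pieces. -/
def dyadicPieces [DecidableEq B] (T : Finset A) (f : A → B) (nb : A → ℕ) : Finset (B × ℕ) :=
  T.image fun w => (f w, nb w)

lemma IsDyadicIndex.sum_eq [DecidableEq B] {T : Finset A} {f : A → B} {nb ix : A → ℕ}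
    (h : IsDyadicIndex T f nb ix) {M : Type*} [AddCommMonoid M] (φ : B → ℕ → ℕ → M) :
    ∑ w ∈ T, φ (f w) (nb w) (ix w)
      = ∑ y ∈ dyadicPieces T f nb, ∑ k ∈ Finset.range (2 ^ y.2), φ y.1 y.2 k := by
  rw [← Finset.sum_fiberwise_of_maps_to (t := dyadicPieces T f nb)
    (g := fun w => (f w, nb w)) (fun w hw => Finset.mem_image_of_mem _ hw)]
  refine Finset.sum_congr rfl fun y hy => ?_
  obtain ⟨w₀, hw₀, rfl⟩ := Finset.mem_image.1 hy
  refine Finset.sum_bij (fun w _ => ix w) ?_ ?_ ?_ ?_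
  · intro w hw
    obtain ⟨hw, he⟩ := Finset.mem_filter.1 hw
    have h2 : nb w = nb w₀ := congrArg Prod.snd he
    rw [Finset.mem_range, ← h2]
    exact (h w hw).1
  · intro w hw w' hw' hix
    obtain ⟨hw, he⟩ := Finset.mem_filter.1 hw
    obtain ⟨hw', he'⟩ := Finset.mem_filter.1 hw'
    simp only [Prod.mk.injEq] at he he'
    refine ((h w hw).2 (ix w) (h w hw).1).unique ⟨hw, rfl, rfl, rfl⟩ ⟨hw', ?_, ?_, hix.symm⟩
    · rw [he'.1, he.1]
    · rw [he'.2, he.2]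
  · intro k hk
    obtain ⟨w, ⟨hw, h1, h2, h3⟩, -⟩ := (h w₀ hw₀).2 k (Finset.mem_range.1 hk)
    exact ⟨w, Finset.mem_filter.2 ⟨hw, by simp [h1, h2]⟩, h3⟩
  · intro w hw
    obtain ⟨hw, he⟩ := Finset.mem_filter.1 hw
    simp only [Prod.mk.injEq] at he
    rw [he.1, he.2]

lemma IsDyadicIndex.sum_lintegral {T : Finset A} {f : A → B} {nb ix : A → ℕ}
    (h : IsDyadicIndex T f nb ix) (g : B → ℕ → ℝ≥0∞) {H : ℝ → ℝ≥0∞} (hH : Measurable H) :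
    ∑ w ∈ T, g (f w) (nb w) * ∫⁻ U, H ((ix w + U) / 2 ^ nb w) ∂unif
      = (∑ w ∈ T, g (f w) (nb w)) * ∫⁻ U, H U ∂unif := by
  classical
  simp_rw [lintegral_sub_cell _ _ hH]
  rw [h.sum_eq fun b n k => g b n * (2 ^ n * ∫⁻ V in cell n k, H V), h.sum_eq fun b n _ => g b n,
    Finset.sum_mul]
  refine Finset.sum_congr rfl fun y _ => ?_
  rw [← Finset.mul_sum, ← Finset.mul_sum, ← lintegral_unif_eq_sum_cell]
  simp only [Finset.sum_const, Finset.card_range, nsmul_eq_mul]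
  push_cast
  ring

lemma IsDyadicIndex.sum_sqrt_le {T : Finset A} {f : A → ℝ} (hf : ∀ w, 0 ≤ f w) {nb ix : A → ℕ}
    (h : IsDyadicIndex T f nb ix) {θ : ℝ} (hθ : 0 ≤ θ) :
    ∑ w ∈ T, √(f w * θ / 2 ^ nb w)
      ≤ (∑ w ∈ T, f w + (dyadicPieces T f nb).card * θ) / 2 := by
  classical
  rw [h.sum_eq fun b n _ => √(b * θ / 2 ^ n), h.sum_eq fun b _ _ => b]
  have h1 : ((dyadicPieces T f nb).card : ℝ) * θ = ∑ y ∈ dyadicPieces T f nb, θ := by simp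
  rw [h1, ← Finset.sum_add_distrib, Finset.sum_div]
  refine Finset.sum_le_sum fun y hy => ?_
  obtain ⟨w, -, rfl⟩ := Finset.mem_image.1 hy
  simp only [Finset.sum_const, Finset.card_range, nsmul_eq_mul]
  push_cast
  have hw := hf w
  have h2 : (2 : ℝ) ^ nb w * √(f w * θ / 2 ^ nb w) = √(2 ^ nb w * f w * θ) := by
    rw [eq_comm, Real.sqrt_eq_iff_mul_self_eq (by positivity) (by positivity)]
    have := Real.mul_self_sqrt (show 0 ≤ f w * θ / 2 ^ nb w by positivity)
    have h3 : (2 : ℝ) ^ nb w * √(f w * θ / 2 ^ nb w) * (2 ^ nb w * √(f w * θ / 2 ^ nb w))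
        = 2 ^ nb w * 2 ^ nb w * (f w * θ / 2 ^ nb w) := by
      rw [mul_mul_mul_comm, this]
    rw [h3]
    field_simp
  rw [h2]
  refine Real.sqrt_le_iff.2 ⟨by positivity, ?_⟩
  nlinarith [sq_nonneg (2 ^ nb w * f w - θ)]

end DyadicIndex

/-! ### Counting the values of path probabilities -/

section Counting

variable {S : Type*} [Fintype S] [DecidableEq S]

/-- The number of occurrences of the transition `e` among the first `n` steps of `w`. -/
def transCount (w : ℕ → S) (n : ℕ) (e : S × S) : ℕ :=
  ((Finset.range n).filter fun i => (w i, w (i + 1)) = e).card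

lemma transCount_lt (w : ℕ → S) (n : ℕ) (e : S × S) : transCount w n e < n + 1 :=
  Nat.lt_succ_of_le ((Finset.card_filter_le _ _).trans (by simp))

lemma pathProd_eq_prod_transCount (P : Matrix S S ℝ) (w : ℕ → S) (n : ℕ) :
    pathProd P w n = ∏ e : S × S, P e.1 e.2 ^ transCount w n e := by
  rw [pathProd, ← Finset.prod_fiberwise_of_maps_to (t := Finset.univ)
    (g := fun i => (w i, w (i + 1))) (fun _ _ => Finset.mem_univ _)]
  refine Finset.prod_congr rfl fun e _ => ?_
  rw [transCount, ← Finset.prod_const]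
  refine Finset.prod_congr rfl fun i hi => ?_
  rw [← (Finset.mem_filter.1 hi).2]

lemma card_image_pathProd_le {A : Type*} (P : Matrix S S ℝ) (n : ℕ) (T : Finset A) (W : A → ℕ → S) :
    (T.image fun w => pathProd P (W w) n).card ≤ (n + 1) ^ (Fintype.card S ^ 2) := by
  have hsub : (T.image fun w => pathProd P (W w) n) ⊆
      (Finset.univ : Finset (S × S → Fin (n + 1))).image
        fun c => ∏ e : S × S, P e.1 e.2 ^ (c e : ℕ) := by
    intro x hx
    obtain ⟨w, -, rfl⟩ := Finset.mem_image.1 hx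
    refine Finset.mem_image.2 ⟨fun e => ⟨transCount (W w) n e, transCount_lt _ _ _⟩,
      Finset.mem_univ _, ?_⟩
    rw [pathProd_eq_prod_transCount]
  refine (Finset.card_le_card hsub).trans (Finset.card_image_le.trans ?_)
  simp [sq]

lemma card_dyadicPieces_le {A : Type*} {T : Finset A} {f : A → ℝ} {nb : A → ℕ} {n m : ℕ}
    (hf : (T.image f).card ≤ m) (hnb : ∀ w ∈ T, nb w < n) :
    (dyadicPieces T f nb).card ≤ m * n := by
  classical
  have : dyadicPieces T f nb ⊆ (T.image f) ×ˢ Finset.range n := by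
    intro y hy
    obtain ⟨w, hw, rfl⟩ := Finset.mem_image.1 hy
    exact Finset.mem_product.2 ⟨Finset.mem_image_of_mem f hw, Finset.mem_range.2 (hnb w hw)⟩
  refine (Finset.card_le_card this).trans ?_
  rw [Finset.card_product, Finset.card_range]
  exact Nat.mul_le_mul_right n hf

end Counting

/-! ### Markers -/

section MarkerWord

variable {S : Type*}

lemma glue_of_le {n k : ℕ} {w u : ℕ → S} (h : w n = u 0) (hk : k ≤ n) : glue n w u k = w k := by
  rcases hk.lt_or_eq with hk | rfl
  · exact glue_of_lt w u hk
  · simp [glue, h]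

lemma glue_of_ge {n k : ℕ} (w u : ℕ → S) (hk : n ≤ k) : glue n w u k = u (k - n) := by
  simp [glue, Nat.not_lt.2 hk]

lemma pathProd_glue (P : Matrix S S ℝ) {n : ℕ} {w u : ℕ → S} (h : w n = u 0) (k : ℕ) :
    pathProd P (glue n w u) (n + k) = pathProd P w n * pathProd P u k := by
  rw [pathProd_add, drop_glue, pathProd_congr P fun k hk => glue_of_le h hk]

variable [Fintype S] [DecidableEq S] {P : Matrix S S ℝ}

lemma pathProd_le_one (hP : IsStochastic P) (w : ℕ → S) (n : ℕ) : pathProd P w n ≤ 1 :=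
  Finset.prod_le_one (fun _ _ => hP.1 _ _) fun _ _ => hP.le_one _ _

lemma pathProd_anti (hP : IsStochastic P) (w : ℕ → S) {n k : ℕ} (h : n ≤ k) :
    pathProd P w k ≤ pathProd P w n := by
  obtain ⟨d, rfl⟩ := Nat.exists_eq_add_of_le h
  rw [pathProd_add]
  exact mul_le_of_le_one_right (pathProd_nonneg hP.1 _ _) (pathProd_le_one hP _ _)

lemma markovEntropy_nonneg (hP : IsStochastic P) {p : S → ℝ} (hp : ∀ i, 0 ≤ p i) :
    0 ≤ markovEntropy P p := by
  rw [markovEntropy, neg_nonneg]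
  refine Finset.sum_nonpos fun i _ => Finset.sum_nonpos fun j _ => ?_
  exact mul_nonpos_of_nonneg_of_nonpos (mul_nonneg (hp i) (hP.1 i j))
    (Real.log_nonpos (hP.1 i j) (hP.le_one i j))

lemma exists_branching (hP : IsStochastic P) {p : S → ℝ} (h : 0 < markovEntropy P p) :
    ∃ a j j', j' ≠ j ∧ 0 < P a j ∧ 0 < P a j' := by
  by_contra! hcon
  have key : ∀ i j, P i j = 0 ∨ P i j = 1 := by
    intro i j
    by_contra! h01
    have h0 := lt_of_le_of_ne (hP.1 i j) h01.1.symm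
    have : ∑ k, P i k = P i j :=
      Finset.sum_eq_single j (fun k _ hk => le_antisymm (hcon i j k hk h0) (hP.1 i k)) (by simp)
    exact h01.2 (by rw [← this, hP.2 i])
  have : markovEntropy P p = 0 := by
    rw [markovEntropy, neg_eq_zero]
    refine Finset.sum_eq_zero fun i _ => Finset.sum_eq_zero fun j _ => ?_
    rcases key i j with h | h <;> simp [h]
  linarith

lemma exists_path (hP : IsStochastic P) {n : ℕ} {i j : S} (h : 0 < (P ^ n) i j) :
    ∃ w : ℕ → S, w 0 = i ∧ w n = j ∧ 0 < pathProd P w n := by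
  induction n generalizing i with
  | zero =>
    have : i = j := by
      by_contra hne
      simp [hne] at h
    exact ⟨fun _ => i, rfl, this, by simp [pathProd]⟩
  | succ n ih =>
    rw [pow_succ', Matrix.mul_apply] at h
    obtain ⟨k, hk⟩ : ∃ k, 0 < P i k * (P ^ n) k j := by
      by_contra! hcon
      exact h.not_ge (Finset.sum_nonpos fun k _ => hcon k)
    have h1 : 0 < P i k := pos_of_mul_pos_left hk ((hP.pow n).1 k j)
    have h2 : 0 < (P ^ n) k j := pos_of_mul_pos_right hk (hP.1 i k)
    obtain ⟨w, hw0, hwn, hw⟩ := ih h2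
    refine ⟨glue 1 (fun _ => i) w, by simp [glue], by simp [glue, hwn], ?_⟩
    rw [pathProd_succ', drop_glue]
    simp only [glue, hw0, zero_lt_one, if_true, lt_irrefl, if_false, Nat.sub_self]
    positivity

lemma exists_first_path (hP : IsStochastic P) (hirr : IsIrreducibleMat P) (i a : S) :
    ∃ n, ∃ w : ℕ → S, w 0 = i ∧ w n = a ∧ 0 < pathProd P w n ∧ ∀ k < n, w k ≠ a := by
  classical
  have hex : ∃ n, ∃ w : ℕ → S, w 0 = i ∧ w n = a ∧ 0 < pathProd P w n := by
    obtain ⟨n, -, h⟩ := hirr i a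
    exact ⟨n, exists_path hP h⟩
  obtain ⟨w, h0, hn, hw⟩ := Nat.find_spec hex
  refine ⟨Nat.find hex, w, h0, hn, hw, fun k hk hka => Nat.find_min hex hk ⟨w, h0, hka, ?_⟩⟩
  exact hw.trans_le (pathProd_anti hP w hk.le)

lemma exists_loop (hP : IsStochastic P) (hirr : IsIrreducibleMat P) {a j : S} (h : 0 < P a j) :
    ∃ l, ∃ w : ℕ → S, 0 < l ∧ w 0 = a ∧ w 1 = j ∧ w l = a ∧ (∀ k, 0 < k → k < l → w k ≠ a) ∧
      0 < pathProd P w l ∧ pathProd P w l ≤ P a j := by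
  obtain ⟨n, w, h0, hn, hw, hk⟩ := exists_first_path hP hirr j a
  have hprod : pathProd P (glue 1 (fun _ => a) w) (n + 1) = P a j * pathProd P w n := by
    rw [pathProd_succ', drop_glue]
    simp [glue, h0]
  refine ⟨n + 1, glue 1 (fun _ => a) w, by omega, by simp [glue], by simp [glue, h0],
    by simp [glue, hn], fun k hk0 hkn => ?_, ?_, ?_⟩
  · rw [glue_of_ge _ _ (by omega)]
    exact hk _ (by omega)
  · rw [hprod]; positivity
  · rw [hprod]
    exact mul_le_of_le_one_right h.le (pathProd_le_one hP _ _)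

/-- Following the loop `w` of length `l` exactly `n` times and then resting at `a`. -/
def repLoop (a : S) (l : ℕ) (w : ℕ → S) : ℕ → ℕ → S
  | 0 => fun _ => a
  | n + 1 => glue l w (repLoop a l w n)

lemma repLoop_zero {a : S} {l : ℕ} (hl : 0 < l) {w : ℕ → S} (h0 : w 0 = a) (n : ℕ) :
    repLoop a l w n 0 = a := by
  cases n with
  | zero => rfl
  | succ n => rw [repLoop, glue_of_lt _ _ hl, h0]

lemma repLoop_end {a : S} {l : ℕ} (w : ℕ → S) (n : ℕ) :
    repLoop a l w n (n * l) = a := by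
  induction n with
  | zero => rfl
  | succ n ih =>
    rw [repLoop, glue_of_ge _ _ (by rw [Nat.add_mul]; omega)]
    convert ih using 2
    rw [Nat.add_mul]; omega

lemma pathProd_repLoop {a : S} {l : ℕ} (hl : 0 < l) {w : ℕ → S} (h0 : w 0 = a) (hla : w l = a)
    (n : ℕ) : pathProd P (repLoop a l w n) (n * l) = pathProd P w l ^ n := by
  induction n with
  | zero => simp [pathProd]
  | succ n ih =>
    rw [repLoop, Nat.add_mul, one_mul, add_comm,
      pathProd_glue P (by rw [hla, repLoop_zero hl h0]), ih, pow_succ']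

lemma repLoop_next {a j : S} {l : ℕ} (hl : 0 < l) {w : ℕ → S} (h0 : w 0 = a) (h1 : w 1 = j)
    (hla : w l = a) (hin : ∀ k, 0 < k → k < l → w k ≠ a) (n : ℕ) {o : ℕ} (ho : o < n * l)
    (hoa : repLoop a l w n o = a) : repLoop a l w n (o + 1) = j := by
  induction n generalizing o with
  | zero => simp at ho
  | succ n ih =>
    have hg : w l = repLoop a l w n 0 := by rw [hla, repLoop_zero hl h0]
    rw [repLoop] at hoa ⊢
    by_cases hol : o < l
    · rw [glue_of_lt _ _ hol] at hoa
      rw [glue_of_le hg (by omega)]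
      rcases Nat.eq_zero_or_pos o with rfl | ho0
      · exact h1
      · exact absurd hoa (hin o ho0 hol)
    · push Not at hol
      rw [glue_of_ge _ _ hol] at hoa
      rw [glue_of_ge _ _ (by omega), show o + 1 - l = (o - l) + 1 by omega]
      refine ih ?_ hoa
      rw [Nat.add_mul] at ho; omega

/-- `m` on `[0, r]` is a word from `a` to `a` of positive probability which does not overlap
itself in more than one letter. -/
structure IsMarker (P : Matrix S S ℝ) (a : S) (m : ℕ → S) (r : ℕ) : Prop where
  pos : 0 < r
  start : m 0 = a
  last : m r = a
  prob_pos : 0 < pathProd P m r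
  not_overlap : ∀ o, 0 < o → o < r → ∃ k, o + k ≤ r ∧ m (o + k) ≠ m k

/-- A positive entropy chain has arbitrarily long markers of arbitrarily small probability. -/
lemma exists_isMarker (hP : IsStochastic P) (hirr : IsIrreducibleMat P) {p : S → ℝ}
    (h : 0 < markovEntropy P p) :
    ∃ a, ∀ (R : ℕ) (ε : ℝ), 0 < ε → ∃ m r, R ≤ r ∧ r * pathProd P m r ≤ ε ∧ IsMarker P a m r := by
  obtain ⟨a, j, j', hjj, hj, hj'⟩ := exists_branching hP h
  obtain ⟨l₁, w₁, hl₁, h₁0, h₁1, h₁l, h₁in, h₁pos, -⟩ := exists_loop hP hirr hj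
  obtain ⟨l₂, w₂, hl₂, h₂0, h₂1, h₂l, h₂in, h₂pos, h₂le⟩ := exists_loop hP hirr hj'
  set β := pathProd P w₂ l₂ with hβ
  have hβ1 : β < 1 := by
    refine h₂le.trans_lt ?_
    have : P a j + P a j' ≤ 1 := by
      rw [← hP.2 a, ← Finset.sum_pair hjj.symm]
      exact Finset.sum_le_sum_of_subset_of_nonneg (Finset.subset_univ _) fun i _ _ => hP.1 a i
    linarith
  refine ⟨a, fun R ε hε => ?_⟩
  have hlim : Tendsto (fun n : ℕ => (l₁ + n * l₂ : ℝ) * (pathProd P w₁ l₁ * β ^ n))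
      atTop (nhds 0) := by
    have e1 := tendsto_pow_atTop_nhds_zero_of_lt_one h₂pos.le hβ1
    have e2 := tendsto_self_mul_const_pow_of_lt_one h₂pos.le hβ1
    have := (e1.const_mul (l₁ * pathProd P w₁ l₁)).add (e2.const_mul (l₂ * pathProd P w₁ l₁))
    simp only [mul_zero, add_zero] at this
    refine this.congr fun n => ?_
    ring
  obtain ⟨n, hn, hnR⟩ := ((hlim.eventually (ge_mem_nhds hε)).and (eventually_ge_atTop R)).exists
  have hglue : w₁ l₁ = repLoop a l₂ w₂ n 0 := by rw [h₁l, repLoop_zero hl₂ h₂0]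
  have hprod : pathProd P (glue l₁ w₁ (repLoop a l₂ w₂ n)) (l₁ + n * l₂)
      = pathProd P w₁ l₁ * β ^ n := by
    rw [pathProd_glue P hglue, pathProd_repLoop hl₂ h₂0 h₂l]
  refine ⟨glue l₁ w₁ (repLoop a l₂ w₂ n), l₁ + n * l₂, ?_, ?_, ?_⟩
  · have : n * 1 ≤ n * l₂ := Nat.mul_le_mul_left n hl₂
    omega
  · rw [hprod]; push_cast; exact hn
  · have hm1 : glue l₁ w₁ (repLoop a l₂ w₂ n) 1 = j := by rw [glue_of_le hglue hl₁, h₁1]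
    have hm0 : glue l₁ w₁ (repLoop a l₂ w₂ n) 0 = a := by rw [glue_of_lt _ _ hl₁, h₁0]
    refine ⟨by omega, hm0, ?_, ?_, ?_⟩
    · rw [glue_of_ge _ _ (by omega), Nat.add_sub_cancel_left, repLoop_end]
    · rw [hprod]; positivity
    · intro o ho hor
      by_contra! hcon
      have e0 := hcon 0 (by omega)
      have e1 := hcon 1 (by omega)
      rw [hm1] at e1
      rw [add_zero, hm0] at e0
      by_cases hol : o < l₁
      · rw [glue_of_lt _ _ hol] at e0
        exact h₁in o ho hol e0
      · push Not at hol
        rw [glue_of_ge _ _ hol] at e0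
        rw [glue_of_ge _ _ (by omega), show o + 1 - l₁ = (o - l₁) + 1 by omega,
          repLoop_next hl₂ h₂0 h₂1 h₂l h₂in n (by omega) e0] at e1
        exact hjj e1

end MarkerWord

/-! ### Occurrences of a marker -/

section Occurrences

variable {S : Type*}

/-- The word `m` on `[0, r]` occurs in `z` starting at `s`. -/
def MarkAt (m : ℕ → S) (r : ℕ) (z : ℕ → S) (s : ℕ) : Prop := ∀ k ≤ r, z (s + k) = m k

/-- No occurrence ends at a time `≤ n`. -/
def noMark (m : ℕ → S) (r n : ℕ) : Set (ℕ → S) := {z | ∀ s, s + r ≤ n → ¬ MarkAt m r z s}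

/-- The first occurrence ends at time `n`. -/
def firstMark (m : ℕ → S) (r n : ℕ) : Set (ℕ → S) :=
  {z | r ≤ n ∧ MarkAt m r z (n - r) ∧ ∀ s, s + r < n → ¬ MarkAt m r z s}

/-- The end of the first occurrence (with a default value if there is none). -/
def markLen (m : ℕ → S) (r : ℕ) (z : ℕ → S) : ℕ := sInf {s | MarkAt m r z s} + r

variable {m : ℕ → S} {r : ℕ}

lemma MarkAt.congr {z z' : ℕ → S} {s : ℕ} (h : ∀ k ≤ s + r, z k = z' k) (hz : MarkAt m r z s) :
    MarkAt m r z' s := fun k hk => by rw [← h _ (by omega), hz k hk]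

lemma markAt_drop (z : ℕ → S) (n s : ℕ) : MarkAt m r (drop n z) s ↔ MarkAt m r z (n + s) := by
  simp [MarkAt, drop, add_assoc]

lemma dependsOnWindow_noMark (n : ℕ) : DependsOnWindow (Set.Iic n) (noMark m r n) :=
  fun _ _ hxy hx s hs hy => hx s hs (hy.congr fun k hk => (hxy k (by simp; omega)).symm)

lemma dependsOnWindow_firstMark (n : ℕ) : DependsOnWindow (Set.Iic n) (firstMark m r n) :=
  fun _ _ hxy hx => ⟨hx.1, hx.2.1.congr fun k hk => hxy k (by have := hx.1; simp; omega),
    fun s hs hy => hx.2.2 s hs (hy.congr fun k hk => (hxy k (by simp; omega)).symm)⟩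

lemma noMark_anti {n k : ℕ} (h : n ≤ k) : noMark m r k ⊆ noMark m r n :=
  fun _ hz s hs => hz s (hs.trans h)

lemma markLen_of_mem_firstMark {z : ℕ → S} {n : ℕ} (h : z ∈ firstMark m r n) :
    markLen m r z = n := by
  have hne : {s | MarkAt m r z s}.Nonempty := ⟨n - r, h.2.1⟩
  have h1 : sInf {s | MarkAt m r z s} ≤ n - r := Nat.sInf_le h.2.1
  have h2 : ¬ sInf {s | MarkAt m r z s} + r < n := fun hlt => h.2.2 _ hlt (Nat.sInf_mem hne)
  have := h.1
  rw [markLen]; omega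

lemma mem_firstMark_markLen {z : ℕ → S} {s : ℕ} (h : MarkAt m r z s) :
    z ∈ firstMark m r (markLen m r z) ∧ markLen m r z ≤ s + r := by
  have hne : {s | MarkAt m r z s}.Nonempty := ⟨s, h⟩
  refine ⟨⟨Nat.le_add_left _ _, ?_, fun s' hs' hm => ?_⟩, Nat.add_le_add_right (Nat.sInf_le h) r⟩
  · rw [markLen, Nat.add_sub_cancel]; exact Nat.sInf_mem hne
  · have h1 : sInf {s | MarkAt m r z s} ≤ s' := Nat.sInf_le hm
    rw [markLen] at hs'; omega

lemma le_markLen (z : ℕ → S) : r ≤ markLen m r z := Nat.le_add_left _ _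

lemma noMark_eq_union (n : ℕ) : noMark m r n = noMark m r (n + 1) ∪ firstMark m r (n + 1) := by
  ext z
  constructor
  · intro hz
    by_cases hr : r ≤ n + 1 ∧ MarkAt m r z (n + 1 - r)
    · exact Or.inr ⟨hr.1, hr.2, fun s hs => hz s (by omega)⟩
    · refine Or.inl fun s hs hm => ?_
      rcases hs.lt_or_eq with h | h
      · exact hz s (by omega) hm
      · exact hr ⟨by omega, by rwa [show n + 1 - r = s by omega]⟩
  · rintro (hz | hz)
    · exact noMark_anti (Nat.le_succ n) hz
    · exact fun s hs => hz.2.2 s (by omega)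

lemma disjoint_noMark_firstMark (n : ℕ) : Disjoint (noMark m r n) (firstMark m r n) :=
  Set.disjoint_left.2 fun _ h1 h2 => h1 (n - r) (by have := h2.1; omega) h2.2.1

lemma noMark_zero (hr : 0 < r) : noMark m r 0 = Set.univ :=
  Set.eq_univ_of_forall fun _ s hs => by omega

lemma disjoint_firstMark : Pairwise (Function.onFun Disjoint (firstMark m r)) :=
  fun _ _ hij => Set.disjoint_left.2 fun _ h1 h2 =>
    hij ((markLen_of_mem_firstMark h1).symm.trans (markLen_of_mem_firstMark h2))

variable [Fintype S] [DecidableEq S] {P : Matrix S S ℝ} {a : S}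

lemma IsMarker.add_le (h : IsMarker P a m r) {z : ℕ → S} {s s' : ℕ} (hs : MarkAt m r z s)
    (hs' : MarkAt m r z s') (hlt : s < s') : s + r ≤ s' := by
  by_contra! hcon
  obtain ⟨k, hk, hne⟩ := h.not_overlap (s' - s) (by omega) (by omega)
  apply hne
  rw [← hs _ hk, ← hs' k (by omega)]
  congr 1; omega

lemma IsMarker.eq_last (h : IsMarker P a m r) {z : ℕ → S} {n : ℕ} (hz : z ∈ firstMark m r n) :
    z n = a := by
  have h1 := hz.2.1 r le_rfl
  have := hz.1
  rwa [Nat.sub_add_cancel this, h.last] at h1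

variable [MeasurableSpace S] [DiscreteMeasurableSpace S]

lemma measurableSet_noMark (n : ℕ) : MeasurableSet (noMark m r n) :=
  (dependsOnWindow_noMark n).measurableSet (Set.finite_Iic n)

lemma measurableSet_firstMark (n : ℕ) : MeasurableSet (firstMark m r n) :=
  (dependsOnWindow_firstMark n).measurableSet (Set.finite_Iic n)

lemma measurable_markLen : Measurable (markLen m r : (ℕ → S) → ℕ) := by
  have hm : ∀ s, MeasurableSet {z : ℕ → S | MarkAt m r z s} := fun s =>
    DependsOnWindow.measurableSet (Set.finite_Iic (s + r))
      fun x y hxy hx => MarkAt.congr hxy hx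
  refine measurable_to_countable' fun n => ?_
  have : markLen m r ⁻¹' {n} = firstMark m r n ∪
      (if n = r then (⋃ s, {z : ℕ → S | MarkAt m r z s})ᶜ else ∅) := by
    ext z
    by_cases hz : ∃ s, MarkAt m r z s
    · have hz' := mem_firstMark_markLen hz.choose_spec
      have : z ∉ (⋃ s, {z : ℕ → S | MarkAt m r z s})ᶜ := by simpa using hz
      simp only [Set.mem_preimage, Set.mem_singleton_iff, Set.mem_union]
      constructor
      · rintro rfl; exact Or.inl hz'.1
      · rintro (h | h)
        · exact markLen_of_mem_firstMark h
        · split_ifs at h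
          · exact absurd h this
          · simp at h
    · have h0 : {s | MarkAt m r z s} = ∅ := by
        ext s; simpa using fun h => hz ⟨s, h⟩
      have h1 : z ∉ firstMark m r n := fun h => hz ⟨_, h.2.1⟩
      have h2 : z ∈ (⋃ s, {z : ℕ → S | MarkAt m r z s})ᶜ := by simpa using hz
      simp only [Set.mem_preimage, Set.mem_singleton_iff, Set.mem_union, h1, false_or, markLen, h0,
        Nat.sInf_empty, zero_add]
      split_ifs with h
      · exact iff_of_true h.symm h2
      · simp [Ne.symm h]
  rw [this]
  refine (measurableSet_firstMark n).union ?_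
  split_ifs
  · exact (MeasurableSet.iUnion hm).compl
  · exact MeasurableSet.empty

variable {κ : S → Measure (ℕ → S)}

/-- Markers occur within a bounded time up to arbitrarily small probability. -/
lemma IsMarker.exists_noMark_le (h : IsMarker P a m r) (hP : IsStochastic P)
    (hirr : IsIrreducibleMat P) (hκ : ∀ i, IsChainFrom P i (κ i)) {ε : ℝ≥0∞} (hε : 0 < ε) :
    ∃ J, ∀ i, κ i (noMark m r J) ≤ ε := by
  have hprob : ∀ i, IsProbabilityMeasure (κ i) := fun i => (hκ i).isProbabilityMeasure
  have hne : Nonempty S := ⟨a⟩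
  have hpath : ∀ i, ∃ n, κ i (noMark m r n) < 1 := by
    intro i
    obtain ⟨n, w, h0, hn, hw, -⟩ := exists_first_path hP hirr i a
    have hg : w n = m 0 := by rw [hn, h.start]
    refine ⟨n + r, ?_⟩
    have hsub : noMark m r (n + r) ⊆ (cyl (n + r) (glue n w m))ᶜ := by
      intro z hz hcyl
      refine hz n le_rfl fun k hk => ?_
      rw [hcyl (n + k) (by simpa using hk), glue_of_ge _ _ (by omega), Nat.add_sub_cancel_left]
    refine (measure_mono hsub).trans_lt ?_
    rw [prob_compl_eq_one_sub (measurableSet_cyl _ _)]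
    refine ENNReal.sub_lt_self ENNReal.one_ne_top one_ne_zero ?_
    rw [(hκ i).cyl_self _ (by rw [glue_of_le hg (Nat.zero_le n), h0]), pathProd_glue P hg]
    simpa using mul_pos hw h.prob_pos
  choose n hn using hpath
  set N := Finset.univ.sup n
  set q := Finset.univ.sup fun i => κ i (noMark m r (n i)) with hq
  have hq1 : q < 1 := (Finset.sup_lt_iff (by simp)).2 fun i _ => hn i
  have hqN : ∀ i, κ i (noMark m r N) ≤ q := fun i =>
    (measure_mono (noMark_anti (Finset.le_sup (Finset.mem_univ i)))).trans
      (Finset.le_sup (f := fun i => κ i (noMark m r (n i))) (Finset.mem_univ i))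
  have key : ∀ k i, κ i (noMark m r (k * N)) ≤ q ^ k := by
    intro k
    induction k with
    | zero => intro i; simpa using prob_le_one
    | succ k ih =>
      intro i
      have hsub : noMark m r ((k + 1) * N) ⊆ noMark m r N ∩ drop N ⁻¹' noMark m r (k * N) := by
        intro z hz
        refine ⟨noMark_anti (by nlinarith) hz, fun s hs hm => hz (N + s) ?_ ?_⟩
        · rw [Nat.add_mul]; omega
        · exact (markAt_drop z N s).1 hm
      refine (measure_mono hsub).trans ?_
      refine (IsMC.past_inter_drop_le (single_one_nonneg i) hP.1 (hκ i) hκ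
        (dependsOnWindow_noMark N) (measurableSet_noMark _) fun w _ => ih (w N)).trans ?_
      rw [pow_succ']
      gcongr
      exact hqN i
  obtain ⟨k, hk⟩ := ((ENNReal.tendsto_pow_atTop_nhds_zero_of_lt_one hq1).eventually
    (ge_mem_nhds hε)).exists
  exact ⟨k * N, fun i => (key k i).trans hk⟩

lemma noMark_drop_le (hP : IsStochastic P)
    (hκ : ∀ i, IsChainFrom P i (κ i)) {p : S → ℝ} (hp : ∀ i, 0 ≤ p i) (hp1 : ∑ i, p i = 1)
    {ρ : Measure (ℕ → S)} (hρ : IsMC P p ρ) {J : ℕ} {ε : ℝ≥0∞}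
    (hJ : ∀ i, κ i (noMark m r J) ≤ ε) (n : ℕ) : ρ (drop n ⁻¹' noMark m r J) ≤ ε := by
  have := hρ.isProbabilityMeasure hp hp1
  have h1 := hρ.past_inter_drop_le hp hP.1 hκ (n := n) (E := Set.univ) (fun _ _ _ _ => trivial)
    (measurableSet_noMark (m := m) (r := r) J) (c := ε) (fun w _ => hJ _)
  simpa using h1

lemma IsMarker.measure_iInter_noMark (h : IsMarker P a m r) (hP : IsStochastic P)
    (hirr : IsIrreducibleMat P) (hκ : ∀ i, IsChainFrom P i (κ i)) (i : S) :
    κ i (⋂ n, noMark m r n) = 0 := by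
  refine nonpos_iff_eq_zero.1 (le_of_forall_gt fun ε hε => ?_)
  obtain ⟨δ, hδ, hδε⟩ := exists_between hε
  obtain ⟨J, hJ⟩ := h.exists_noMark_le hP hirr hκ hδ
  exact ((measure_mono (Set.iInter_subset _ J)).trans (hJ i)).trans_lt hδε

lemma IsMarker.ae_mem_iUnion_firstMark (h : IsMarker P a m r) (hP : IsStochastic P)
    (hirr : IsIrreducibleMat P) (hκ : ∀ i, IsChainFrom P i (κ i)) (i : S) :
    ∀ᵐ z ∂κ i, z ∈ ⋃ n, firstMark m r n := by
  rw [ae_iff]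
  refine measure_mono_null (fun z hz => ?_) (h.measure_iInter_noMark hP hirr hκ i)
  simp only [Set.mem_iUnion, not_exists, Set.mem_ofPred_eq] at hz
  exact Set.mem_iInter.2 fun n s _ hm => hz _ (mem_firstMark_markLen hm).1

lemma IsMarker.firstMark_le (h : IsMarker P a m r) (hP : IsStochastic P)
    (hκ : ∀ i, IsChainFrom P i (κ i)) (i : S) (n : ℕ) :
    κ i (firstMark m r (n + r)) ≤ κ i (noMark m r n) * ENNReal.ofReal (pathProd P m r) := by
  have hsub : firstMark m r (n + r) ⊆ noMark m r n ∩ drop n ⁻¹' cyl r m := by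
    intro z hz
    refine ⟨fun s hs => hz.2.2 s ?_, fun k hk => ?_⟩
    · have := h.pos; omega
    · have := hz.2.1 k hk
      rwa [Nat.add_sub_cancel] at this
  refine (measure_mono hsub).trans (IsMC.past_inter_drop_le (single_one_nonneg i) hP.1 (hκ i) hκ
    (dependsOnWindow_noMark n) (measurableSet_cyl _ _) fun w _ => ?_)
  rw [hκ (w n) r m]
  refine ENNReal.ofReal_le_ofReal (mul_le_of_le_one_left h.prob_pos.le ?_)
  by_cases hwn : m 0 = w n
  · simp [hwn]
  · simp [hwn]

/-- A renewal sequence with small jumps has small hazard. -/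
lemma hazard_le {ρ R : ℕ → ℝ} {p : ℝ} {r : ℕ} (hr : 0 < r) (hR : ∀ n, 0 ≤ R n)
    (hρ : ∀ n, 0 ≤ ρ n) (hrec : ∀ n, R n = R (n + 1) + ρ (n + 1)) (hlt : ∀ n < r, ρ n = 0)
    (hp : 0 ≤ p) (hle : ∀ n, ρ (n + r) ≤ R n * p) (hpr : r * p ≤ 1 / 4) (n : ℕ) :
    ρ (n + 1) ≤ 2 * p * R n := by
  have hanti : Antitone R := antitone_nat_of_succ_le fun n => by linarith [hrec n, hρ (n + 1)]
  induction n using Nat.strong_induction_on with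
  | _ n ih =>
    by_cases hn : n + 1 < r
    · rw [hlt _ hn]; have := hR n; positivity
    push Not at hn
    obtain ⟨s, hs⟩ : ∃ s, n + 1 = s + r := ⟨n + 1 - r, by omega⟩
    have hsn : n = s + (r - 1) := by omega
    have key : ∀ k, k ≤ r - 1 → R s * (1 - k * (2 * p)) ≤ R (s + k) := by
      intro k
      induction k with
      | zero => intro; simp
      | succ k ihk =>
        intro hk
        have h1 := ihk (by omega)
        have h2 := ih (s + k) (by omega)
        have h3 := hrec (s + k)
        have h4 : R (s + k) ≤ R s := hanti (by omega)
        have h5 : 2 * p * R (s + k) ≤ 2 * p * R s := by gcongr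
        rw [show s + (k + 1) = s + k + 1 by ring]
        push_cast
        nlinarith
    have h1 := key (r - 1) le_rfl
    rw [← hsn] at h1
    have h2 : ((r - 1 : ℕ) : ℝ) * p ≤ 1 / 4 :=
      (mul_le_mul_of_nonneg_right (by exact_mod_cast Nat.sub_le r 1) hp).trans hpr
    have h3 : R s ≤ 2 * R n := by nlinarith [hR s]
    calc ρ (n + 1) = ρ (s + r) := by rw [hs]
      _ ≤ R s * p := hle s
      _ ≤ 2 * R n * p := by gcongr
      _ = _ := by ring

end Occurrences

/-! ### Words and functions of the past -/

section Words

variable {S : Type*}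

/-- The extension of a word on `[0, n]` to an infinite sequence. -/
def wordExt {n : ℕ} (w : Fin (n + 1) → S) : ℕ → S := fun k => w (Fin.ofNat (n + 1) k)

/-- The restriction of a sequence to `[0, n]`. -/
def wordRes (n : ℕ) (z : ℕ → S) : Fin (n + 1) → S := fun i => z i

lemma wordExt_wordRes {n k : ℕ} (z : ℕ → S) (hk : k ≤ n) : wordExt (wordRes n z) k = z k := by
  simp [wordExt, wordRes, Nat.mod_eq_of_lt (Nat.lt_succ_of_le hk)]

lemma wordRes_eq_iff {n : ℕ} {z : ℕ → S} {w : Fin (n + 1) → S} :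
    wordRes n z = w ↔ z ∈ cyl n (wordExt w) := by
  constructor
  · rintro rfl k hk
    exact (wordExt_wordRes z hk).symm
  · intro h
    funext i
    have := h i (Nat.lt_succ_iff.1 i.2)
    simpa [wordExt, wordRes] using this

lemma wordRes_congr {n : ℕ} {z z' : ℕ → S} (h : ∀ k ≤ n, z k = z' k) :
    wordRes n z = wordRes n z' := funext fun i => h i (Nat.lt_succ_iff.1 i.2)

lemma lintegral_eq_sum_fiber {Ω V : Type*} [MeasurableSpace Ω] [Fintype V] (ρ : Measure Ω)
    {g : Ω → V} (hg : ∀ v, MeasurableSet (g ⁻¹' {v})) (H : Ω → ℝ≥0∞) :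
    ∫⁻ x, H x ∂ρ = ∑ v, ∫⁻ x in g ⁻¹' {v}, H x ∂ρ := by
  have hU : (⋃ v ∈ (Finset.univ : Finset V), g ⁻¹' {v}) = Set.univ := by ext; simp
  rw [← lintegral_biUnion_finset, hU, setLIntegral_univ]
  · exact fun v _ w _ hvw => Set.disjoint_left.2 fun x hx hx' => hvw (hx.symm.trans hx')
  · exact fun v _ => hg v

variable [Fintype S] [MeasurableSpace S] [DiscreteMeasurableSpace S]

lemma lintegral_eq_sum_words (ρ : Measure (ℕ → S)) (n : ℕ) (H : (ℕ → S) → ℝ≥0∞) :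
    ∫⁻ z, H z ∂ρ = ∑ w : Fin (n + 1) → S, ∫⁻ z in cyl n (wordExt w), H z ∂ρ := by
  have hc : ∀ w : Fin (n + 1) → S, wordRes n ⁻¹' {w} = cyl n (wordExt w) := fun w => by
    ext z; exact wordRes_eq_iff
  rw [lintegral_eq_sum_fiber ρ (g := wordRes n) fun w => by
    rw [hc]; exact measurableSet_cyl _ _]
  simp_rw [hc]

variable [DecidableEq S] {P : Matrix S S ℝ} {p : S → ℝ} {ρ : Measure (ℕ → S)}
  {κ : S → Measure (ℕ → S)}

/-- The Markov property for a function of the past times a function of the future. -/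
lemma IsMC.lintegral_past_mul_drop (hp : ∀ i, 0 ≤ p i) (hP : ∀ i j, 0 ≤ P i j) (h : IsMC P p ρ)
    (hκ : ∀ i, IsChainFrom P i (κ i)) (n : ℕ) {F G : (ℕ → S) → ℝ≥0∞}
    (hF : ∀ x y, (∀ k ≤ n, x k = y k) → F x = F y) (hG : Measurable G) :
    ∫⁻ z, F z * G (drop n z) ∂ρ = ∫⁻ z, F z * ∫⁻ y, G y ∂κ (z n) ∂ρ := by
  rw [lintegral_eq_sum_words ρ n, lintegral_eq_sum_words ρ n]
  refine Finset.sum_congr rfl fun w _ => ?_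
  set u := wordExt w
  have h1 : ∀ z ∈ cyl n u, F z * G (drop n z) = F u * G (drop n z) := fun z hz => by
    rw [hF z u hz]
  have h2 : ∀ z ∈ cyl n u, F z * ∫⁻ y, G y ∂κ (z n) = F u * ∫⁻ y, G y ∂κ (u n) := fun z hz => by
    rw [hF z u hz, hz n (Set.mem_Iic.2 le_rfl)]
  rw [setLIntegral_congr_fun (measurableSet_cyl n u) h1,
    setLIntegral_congr_fun (measurableSet_cyl n u) h2,
    lintegral_const_mul _ (show Measurable fun z => G (drop n z) from
      hG.comp (measurable_drop n)),
    h.lintegral_cyl_drop hp hP hκ n u hG, setLIntegral_const]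
  ring

lemma IsChainFrom.lintegral_one_step {i : S} (h : IsChainFrom P i ρ) (s : S) :
    ∫⁻ y, (if y 1 = s then 1 else 0) ∂ρ = ENNReal.ofReal (P i s) := by
  have hm : MeasurableSet {y : ℕ → S | y 1 = s} :=
    DependsOnWindow.measurableSet (Set.finite_Iic 1) fun x y hxy hx => by
      change y 1 = s
      rw [← hxy 1 (Set.mem_Iic.2 le_rfl)]; exact hx
  have h1 : ∫⁻ y, (if y 1 = s then 1 else 0) ∂ρ = ρ {y | y 1 = s} := by
    rw [← lintegral_indicator_one hm]
    refine lintegral_congr fun y => ?_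
    by_cases hy : y 1 = s <;> simp [hy]
  have h2 : ρ {y | y 1 = s} = ρ (cyl 1 (fun k => if k = 0 then i else s)) := by
    refine measure_congr ?_
    filter_upwards [h.ae_start] with y hy
    refine propext ⟨fun (hs : y 1 = s) k hk => ?_, fun hc => ?_⟩
    · have : k = 0 ∨ k = 1 := by have := Set.mem_Iic.1 hk; omega
      rcases this with rfl | rfl
      · simpa using hy
      · simpa using hs
    · change y 1 = s
      simpa using hc 1 (Set.mem_Iic.2 le_rfl)
  rw [h1, h2, h.cyl_self 1 (by simp)]
  simp [pathProd]

end Words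

/-! ### Randomized stopping at visits to a state with a prescribed law -/

section Stopping

variable {S : Type*} [DecidableEq S]

/-- Probability of stopping at time `i` if not stopped before. -/
def stopProb (f : ℕ → ℝ≥0∞) (b : S) (i : ℕ) (y : ℕ → S) : ℝ≥0∞ := if y i = b then f i else 0

/-- Probability of stopping exactly at time `l`. -/
def stopWeight (f : ℕ → ℝ≥0∞) (b : S) (l : ℕ) (y : ℕ → S) : ℝ≥0∞ :=
  (∏ i ∈ Finset.Ico 1 l, (1 - stopProb f b i y)) * stopProb f b l y

lemma stopProb_congr (f : ℕ → ℝ≥0∞) (b : S) {i : ℕ} {x y : ℕ → S} (h : x i = y i) :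
    stopProb f b i x = stopProb f b i y := by rw [stopProb, stopProb, h]

lemma stopWeight_congr (f : ℕ → ℝ≥0∞) (b : S) {l : ℕ} {x y : ℕ → S} (h : ∀ k ≤ l, x k = y k) :
    stopWeight f b l x = stopWeight f b l y := by
  rw [stopWeight, stopWeight, stopProb_congr f b (h l le_rfl)]
  congr 1
  refine Finset.prod_congr rfl fun i hi => ?_
  rw [stopProb_congr f b (h i (Finset.mem_Ico.1 hi).2.le)]

lemma stopWeight_of_ne (f : ℕ → ℝ≥0∞) {b : S} {l : ℕ} {y : ℕ → S} (h : y l ≠ b) :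
    stopWeight f b l y = 0 := by simp [stopWeight, stopProb, h]

lemma stopProb_le_one {f : ℕ → ℝ≥0∞} (hf : ∀ t, f t ≤ 1) (b : S) (i : ℕ) (y : ℕ → S) :
    stopProb f b i y ≤ 1 := by
  rw [stopProb]; split_ifs
  · exact hf i
  · exact zero_le_one

lemma sum_stopWeight_add {f : ℕ → ℝ≥0∞} (hf : ∀ t, f t ≤ 1) (b : S) (y : ℕ → S) (n : ℕ) :
    ∑ l ∈ Finset.Ico 1 (n + 1), stopWeight f b l y
      + ∏ i ∈ Finset.Ico 1 (n + 1), (1 - stopProb f b i y) = 1 := by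
  induction n with
  | zero => simp
  | succ n ih =>
    rw [Finset.sum_Ico_succ_top (by omega), Finset.prod_Ico_succ_top (by omega), stopWeight,
      add_assoc, ← mul_add, add_tsub_cancel_of_le (stopProb_le_one hf b _ y), mul_one, ih]

lemma tsum_stopWeight_le {f : ℕ → ℝ≥0∞} (hf : ∀ t, f t ≤ 1) (b : S) (y : ℕ → S) :
    ∑' l, stopWeight f b (l + 1) y ≤ 1 := by
  refine ENNReal.tsum_le_of_sum_range_le fun n => ?_
  rw [← sum_stopWeight_add hf b y n, Finset.sum_Ico_eq_sum_range]
  simp only [Nat.add_sub_cancel, add_comm]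
  exact le_add_self

variable [Fintype S]

/-- Mass at time `t` of the chain started at `b` from which mass `ρ s` at `b` has been removed at
each time `s ≤ t`. -/
def stopMass (Q : Matrix S S ℝ) (b : S) (ρ : ℕ → ℝ) : ℕ → S → ℝ
  | 0 => Pi.single b 1
  | t + 1 => Matrix.vecMul (stopMass Q b ρ t) Q - ρ (t + 1) • Pi.single b 1

variable {Q : Matrix S S ℝ} {b : S} {ρ R : ℕ → ℝ}

lemma sum_vecMul (hQ : IsStochastic Q) (x : S → ℝ) :
    ∑ s, Matrix.vecMul x Q s = ∑ s, x s := by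
  simp only [Matrix.vecMul, dotProduct]
  rw [Finset.sum_comm]
  refine Finset.sum_congr rfl fun i _ => ?_
  rw [← Finset.mul_sum, hQ.2, mul_one]

lemma sum_stopMass (hQ : IsStochastic Q) (hR0 : R 0 = 1)
    (hrec : ∀ n, R n = R (n + 1) + ρ (n + 1)) (t : ℕ) : ∑ s, stopMass Q b ρ t s = R t := by
  induction t with
  | zero => simp [stopMass, hR0]
  | succ t ih =>
    simp only [stopMass, Pi.sub_apply, Pi.smul_apply, smul_eq_mul, Finset.sum_sub_distrib,
      ← Finset.mul_sum, sum_vecMul hQ, ih]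
    simp
    linarith [hrec t]

lemma stopMass_add (s n : ℕ) : stopMass Q b ρ (s + n) = Matrix.vecMul (stopMass Q b ρ s) (Q ^ n)
    - ∑ i ∈ Finset.range n, ρ (s + n - i) • Matrix.vecMul (Pi.single b 1) (Q ^ i) := by
  induction n with
  | zero => simp
  | succ n ih =>
    rw [← add_assoc, stopMass, ih, Matrix.sub_vecMul, Matrix.vecMul_vecMul, ← pow_succ,
      Finset.sum_range_succ', sub_sub]
    congr 2
    · rw [Matrix.sum_vecMul]
      refine Finset.sum_congr rfl fun i _ => ?_
      rw [Matrix.smul_vecMul, Matrix.vecMul_vecMul, ← pow_succ]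
      congr 2; omega
    · simp

lemma vecMul_nonneg (hQ : IsStochastic Q) {x : S → ℝ} (hx : ∀ s, 0 ≤ x s) (s : S) :
    0 ≤ Matrix.vecMul x Q s := Finset.sum_nonneg fun i _ => mul_nonneg (hx i) (hQ.1 i s)

lemma stopMass_nonneg (hQ : IsStochastic Q) (hR0 : R 0 = 1) (hR : ∀ n, 0 ≤ R n)
    (hρ : ∀ n, 0 ≤ ρ n) (hrec : ∀ n, R n = R (n + 1) + ρ (n + 1)) {n₀ r : ℕ}
    (hn₀ : 0 < n₀) (hr : n₀ ≤ r) (hlt : ∀ n < r, ρ n = 0) {η δ : ℝ}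
    (hη : ∀ i j, η ≤ (Q ^ n₀) i j) (hδ : 0 ≤ δ) (hhaz : ∀ n, ρ (n + 1) ≤ δ * R n)
    (hδη : n₀ * δ ≤ η) (t : ℕ) (s : S) : 0 ≤ stopMass Q b ρ t s := by
  have hanti : Antitone R := antitone_nat_of_succ_le fun n => by linarith [hrec n, hρ (n + 1)]
  induction t using Nat.strong_induction_on generalizing s with
  | _ t ih =>
    by_cases ht : t < n₀
    · have h1 := stopMass_add (Q := Q) (b := b) (ρ := ρ) 0 t
      rw [zero_add] at h1
      rw [h1, Finset.sum_eq_zero, sub_zero]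
      · refine vecMul_nonneg (hQ.pow t) (fun s => ?_) s
        change 0 ≤ (Pi.single b (1 : ℝ) : S → ℝ) s
        rw [Pi.single_apply]
        split_ifs <;> norm_num
      · intro i _
        rw [hlt _ (by omega), zero_smul]
    · push Not at ht
      obtain ⟨d, rfl⟩ := Nat.exists_eq_add_of_le' ht
      rw [stopMass_add, Pi.sub_apply, Finset.sum_apply, sub_nonneg]
      calc ∑ i ∈ Finset.range n₀, (ρ (d + n₀ - i) • Matrix.vecMul (Pi.single b 1) (Q ^ i)) s
          ≤ ∑ i ∈ Finset.range n₀, δ * R d := by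
            refine Finset.sum_le_sum fun i hi => ?_
            have hi := Finset.mem_range.1 hi
            rw [Pi.smul_apply, smul_eq_mul, Matrix.single_one_vecMul]
            have h1 := hhaz (d + n₀ - i - 1)
            rw [show d + n₀ - i - 1 + 1 = d + n₀ - i by omega] at h1
            have h2 : R (d + n₀ - i - 1) ≤ R d := hanti (by omega)
            calc _ ≤ ρ (d + n₀ - i) * 1 :=
                  mul_le_mul_of_nonneg_left ((hQ.pow i).le_one b s) (hρ _)
              _ ≤ δ * R d := by
                rw [mul_one]
                exact h1.trans (mul_le_mul_of_nonneg_left h2 hδ)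
        _ = n₀ * δ * R d := by simp; ring
        _ ≤ η * R d := mul_le_mul_of_nonneg_right hδη (hR d)
        _ = ∑ i, stopMass Q b ρ d i * η := by
            rw [← Finset.sum_mul, sum_stopMass hQ hR0 hrec, mul_comm]
        _ ≤ _ := by
            refine Finset.sum_le_sum fun i _ => ?_
            exact mul_le_mul_of_nonneg_left (hη i s) (ih d (by omega) i)

variable [MeasurableSpace S] [DiscreteMeasurableSpace S] {κ : S → Measure (ℕ → S)}

/-- There is a randomized stopping rule, stopping only at visits to `b`, with law `ρ`. -/
lemma exists_stopping (hQ : IsStochastic Q) (hκ : ∀ i, IsChainFrom Q i (κ i))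
    (hα : ∀ t s, 0 ≤ stopMass Q b ρ t s) (hρ : ∀ n, 0 ≤ ρ n) :
    ∃ f : ℕ → ℝ≥0∞, (∀ t, f t ≤ 1) ∧
      ∀ l, 0 < l → ∫⁻ y, stopWeight f b l y ∂κ b = ENNReal.ofReal (ρ l) := by
  set β : ℕ → S → ℝ := fun t => Matrix.vecMul (stopMass Q b ρ t) Q with hβ
  have hβ0 : ∀ t s, 0 ≤ β t s := fun t s => vecMul_nonneg hQ (hα t) s
  have hρβ : ∀ t, ρ (t + 1) ≤ β t b := fun t => by
    have := hα (t + 1) b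
    simpa [stopMass, hβ] using this
  set g : ℕ → ℝ := fun t => ρ t / β (t - 1) b with hg
  have hg0 : ∀ t, 0 ≤ g t := fun t => div_nonneg (hρ t) (hβ0 _ _)
  have hgβ : ∀ t, g (t + 1) * β t b = ρ (t + 1) := fun t => by
    simp only [hg, Nat.add_sub_cancel]
    by_cases h0 : β t b = 0
    · rw [h0, mul_zero]
      exact le_antisymm (hρ _) (by have := hρβ t; rwa [h0] at this)
    · rw [div_mul_cancel₀ _ h0]
  have hg1 : ∀ t, g (t + 1) ≤ 1 := fun t => div_le_one_of_le₀ (hρβ t) (hβ0 _ _)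
  set f : ℕ → ℝ≥0∞ := fun t => ENNReal.ofReal (min (g t) 1) with hf
  have hf' : ∀ t, f (t + 1) = ENNReal.ofReal (g (t + 1)) := fun t => by
    simp only [hf]; rw [min_eq_left (hg1 t)]
  have hf1 : ∀ t, f t ≤ 1 := fun t => by
    simp only [hf]
    exact ENNReal.ofReal_le_one.2 (min_le_right _ _)
  set F : ℕ → (ℕ → S) → ℝ≥0∞ := fun t y => ∏ i ∈ Finset.Ico 1 (t + 1), (1 - stopProb f b i y)
  have hFc : ∀ t x y, (∀ k ≤ t, x k = y k) → F t x = F t y := fun t x y h => by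
    refine Finset.prod_congr rfl fun i hi => ?_
    rw [stopProb_congr f b (h i (by have := Finset.mem_Ico.1 hi; omega))]
  have hFm : ∀ t, Measurable (F t) := fun t => measurable_of_Iic_dependence t (hFc t)
  have hind : ∀ (t : ℕ) (s : S), Measurable fun y : ℕ → S => if y t = s then (1 : ℝ≥0∞) else 0 :=
    fun t s => measurable_of_Iic_dependence t fun x y h => by rw [h t le_rfl]
  have hFI : ∀ (t t' : ℕ) (s : S), Measurable fun y => F t y * (if y t' = s then 1 else 0) :=
    fun t t' s => (hFm t).mul (hind t' s)
  have step : ∀ t, (∀ s, ∫⁻ y, F t y * (if y t = s then 1 else 0) ∂κ b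
      = ENNReal.ofReal (stopMass Q b ρ t s)) →
      ∀ s, ∫⁻ y, F t y * (if y (t + 1) = s then 1 else 0) ∂κ b = ENNReal.ofReal (β t s) := by
    intro t ht s
    refine (IsMC.lintegral_past_mul_drop (single_one_nonneg b) hQ.1 (hκ b) hκ t (hFc t)
      (hind 1 s)).trans ?_
    simp_rw [(hκ _).lintegral_one_step s]
    have h2 : ∀ y : ℕ → S, F t y * ENNReal.ofReal (Q (y t) s)
        = ∑ i, F t y * (if y t = i then 1 else 0) * ENNReal.ofReal (Q i s) := fun y => by
      rw [Finset.sum_eq_single (y t)]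
      · simp
      · intro i _ hi; simp [hi.symm]
      · simp
    simp_rw [h2]
    rw [lintegral_finsetSum _ fun i _ => (hFI t t i).mul_const _]
    simp_rw [lintegral_mul_const _ (hFI t t _), ht]
    rw [hβ]
    simp only [Matrix.vecMul, dotProduct]
    rw [ENNReal.ofReal_sum_of_nonneg fun i _ => mul_nonneg (hα t i) (hQ.1 i s)]
    exact Finset.sum_congr rfl fun i _ => (ENNReal.ofReal_mul (hα t i)).symm
  have main : ∀ t s, ∫⁻ y, F t y * (if y t = s then 1 else 0) ∂κ b
      = ENNReal.ofReal (stopMass Q b ρ t s) := by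
    intro t
    induction t with
    | zero =>
      intro s
      have hpr := (hκ b).isProbabilityMeasure
      have h1 : ∀ᵐ y ∂κ b, F 0 y * (if y 0 = s then 1 else 0) = if b = s then 1 else 0 := by
        filter_upwards [(hκ b).ae_start] with y hy
        simp [F, hy]
      rw [lintegral_congr_ae h1, lintegral_const, measure_univ, mul_one, stopMass]
      by_cases hbs : b = s
      · subst hbs; simp
      · simp [hbs, Ne.symm hbs]
    | succ t ih =>
      intro s
      have h1 : ∀ y, F (t + 1) y * (if y (t + 1) = s then 1 else 0)
          = (1 - if s = b then f (t + 1) else 0) *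
            (F t y * (if y (t + 1) = s then 1 else 0)) := fun y => by
        simp only [F]
        rw [Finset.prod_Ico_succ_top (by omega)]
        by_cases hy : y (t + 1) = s
        · simp only [hy, if_true, mul_one, stopProb]; ring
        · simp [hy]
      simp_rw [h1]
      rw [lintegral_const_mul _ (hFI t _ s), step t ih]
      by_cases hs : s = b
      · subst hs
        rw [if_pos rfl, hf', ← ENNReal.ofReal_one, ← ENNReal.ofReal_sub _ (hg0 _),
          ← ENNReal.ofReal_mul (by linarith [hg1 t])]
        congr 1
        simp only [stopMass, Pi.sub_apply, Pi.smul_apply, smul_eq_mul, Pi.single_eq_same]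
        linarith [hgβ t]
      · simp [hs, stopMass, hβ]
  refine ⟨f, hf1, fun l hl => ?_⟩
  obtain ⟨t, rfl⟩ : ∃ t, l = t + 1 := ⟨l - 1, by omega⟩
  have h1 : ∀ y, stopWeight f b (t + 1) y
      = f (t + 1) * (F t y * (if y (t + 1) = b then 1 else 0)) := fun y => by
    simp only [stopWeight, stopProb, F]
    by_cases hy : y (t + 1) = b
    · simp only [hy, if_true, mul_one]; ring
    · simp [hy]
  simp_rw [h1]
  rw [lintegral_const_mul _ (hFI t _ b), step t (main t), hf',
    ← ENNReal.ofReal_mul (hg0 _), hgβ]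

end Stopping

/-! ### Block codes -/

/-- The data of a block code: a marker word, which cuts the input into blocks, for each block a
number of random bits extracted from it and their value, and for each block length a rule
producing an output block from a real seed, reading a certain number of its binary digits. -/
structure BlockCode (S₁ S₂ : Type*) where
  mark : ℕ → S₁
  markEnd : ℕ
  markEnd_pos : 0 < markEnd
  bits : ℕ → (ℕ → S₁) → ℕ
  index : ℕ → (ℕ → S₁) → ℕ
  cost : ℕ → ℝ → ℕ
  out : ℕ → ℝ → ℕ → S₂
  good : ℕ → Set ℝ

namespace BlockCode

variable {S₁ S₂ : Type*} (C : BlockCode S₁ S₂)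

/-- The length of the first block. -/
def len (z : ℕ → S₁) : ℕ := markLen C.mark C.markEnd z

/-- The seed for the first block: the bits extracted from the block, followed by `U`. -/
def seed (z : ℕ → S₁) (U : ℝ) : ℝ := (C.index (C.len z) z + U) / 2 ^ C.bits (C.len z) z

/-- The unused part of the seed. -/
def next (z : ℕ → S₁) (U : ℝ) : ℝ :=
  Int.fract (2 ^ C.cost (C.len z) (C.seed z U) * C.seed z U)

lemma len_pos (z : ℕ → S₁) : 0 < C.len z := C.markEnd_pos.trans_le (le_markLen z)

/-- The output of the code. -/
def run (z : ℕ → S₁) (U : ℝ) (t : ℕ) : S₂ :=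
  if t < C.len z then C.out (C.len z) (C.seed z U) t
  else run (drop (C.len z) z) (C.next z U) (t - C.len z)
termination_by t
decreasing_by have := C.len_pos z; omega

lemma run_of_lt {z : ℕ → S₁} {t : ℕ} (h : t < C.len z) (U : ℝ) :
    C.run z U t = C.out (C.len z) (C.seed z U) t := by rw [run, if_pos h]

lemma run_of_ge {z : ℕ → S₁} {t : ℕ} (h : C.len z ≤ t) (U : ℝ) :
    C.run z U t = C.run (drop (C.len z) z) (C.next z U) (t - C.len z) := by
  rw [run, if_neg (Nat.not_lt.2 h)]

/-- The end of the `n`-th block. -/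
def blockEnd : ℕ → (ℕ → S₁) → ℕ
  | 0, _ => 0
  | n + 1, z => C.len z + blockEnd n (drop (C.len z) z)

/-- The number of bits extracted from the first `n` blocks. -/
def bitsIn : ℕ → (ℕ → S₁) → ℕ
  | 0, _ => 0
  | n + 1, z => C.bits (C.len z) z + bitsIn n (drop (C.len z) z)

/-- The number of bits used in the first `n` blocks. -/
def bitsOut : ℕ → (ℕ → S₁) → ℝ → ℕ
  | 0, _, _ => 0
  | n + 1, z, U => C.cost (C.len z) (C.seed z U) + bitsOut n (drop (C.len z) z) (C.next z U)

/-- The seeds of the first `n` blocks are good. -/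
def AllGood : ℕ → (ℕ → S₁) → ℝ → Prop
  | 0, _, _ => True
  | n + 1, z, U => C.seed z U ∈ C.good (C.len z) ∧ AllGood n (drop (C.len z) z) (C.next z U)

/-- The regularity properties of block codes used for the pathwise analysis. -/
structure IsLocal : Prop where
  bits_congr : ∀ l z z', (∀ k ≤ l, z k = z' k) → C.bits l z = C.bits l z'
  index_congr : ∀ l z z', (∀ k ≤ l, z k = z' k) → C.index l z = C.index l z'
  index_lt : ∀ l z, C.index l z < 2 ^ C.bits l z
  add_le : ∀ z s s', MarkAt C.mark C.markEnd z s → MarkAt C.mark C.markEnd z s' → s < s' →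
    s + C.markEnd ≤ s'
  stable : ∀ l U U', U ∈ C.good l → U' ∈ Set.Ico (0 : ℝ) 1 →
    ⌊2 ^ C.cost l U * U⌋₊ = ⌊2 ^ C.cost l U * U'⌋₊ →
      C.cost l U' = C.cost l U ∧ C.out l U' = C.out l U

variable {C}

lemma next_mem (z : ℕ → S₁) (U : ℝ) : C.next z U ∈ Set.Ico (0 : ℝ) 1 :=
  ⟨Int.fract_nonneg _, Int.fract_lt_one _⟩

lemma IsLocal.seed_mem (hC : C.IsLocal) (z : ℕ → S₁) {U : ℝ} (hU : U ∈ Set.Ico (0 : ℝ) 1) :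
    C.seed z U ∈ Set.Ico (0 : ℝ) 1 := by
  have h1 : (C.index (C.len z) z : ℝ) + 1 ≤ 2 ^ C.bits (C.len z) z := by
    exact_mod_cast hC.index_lt (C.len z) z
  refine ⟨div_nonneg (add_nonneg (Nat.cast_nonneg _) hU.1) (by positivity), ?_⟩
  rw [seed, div_lt_one (by positivity)]
  linarith [hU.2]

lemma IsLocal.markAt_drop_len (hC : C.IsLocal) {z : ℕ → S₁} {s : ℕ}
    (hs : MarkAt C.mark C.markEnd z s) (h : C.len z < s + C.markEnd) :
    C.len z ≤ s ∧ MarkAt C.mark C.markEnd (drop (C.len z) z) (s - C.len z) := by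
  have h1 := (mem_firstMark_markLen hs).1
  have h2 : C.markEnd ≤ C.len z := h1.1
  have h3 : C.len z - C.markEnd + C.markEnd ≤ s := hC.add_le z _ _ h1.2.1 hs (by omega)
  have h4 : C.len z ≤ s := by omega
  refine ⟨h4, (markAt_drop _ _ _).2 ?_⟩
  rwa [Nat.add_sub_cancel' h4]

lemma len_le {z : ℕ → S₁} {s : ℕ} (hs : MarkAt C.mark C.markEnd z s) :
    C.len z ≤ s + C.markEnd := (mem_firstMark_markLen hs).2

lemma len_congr {z z' : ℕ → S₁} {s : ℕ} (hs : MarkAt C.mark C.markEnd z s)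
    (h : ∀ k ≤ s + C.markEnd, z k = z' k) : C.len z' = C.len z := by
  have h1 := mem_firstMark_markLen hs
  exact markLen_of_mem_firstMark
    (dependsOnWindow_firstMark _ z z' (fun k hk => h k ((Set.mem_Iic.1 hk).trans h1.2)) h1.1)

lemma IsLocal.seed_congr (hC : C.IsLocal) {z z' : ℕ → S₁} {s : ℕ}
    (hs : MarkAt C.mark C.markEnd z s) (h : ∀ k ≤ s + C.markEnd, z k = z' k) (U : ℝ) :
    C.seed z' U = C.seed z U := by
  have h1 : ∀ k ≤ C.len z, z' k = z k := fun k hk => (h k (hk.trans (len_le hs))).symm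
  rw [seed, seed, len_congr hs h, hC.index_congr _ _ _ h1, hC.bits_congr _ _ _ h1]

/-- The output up to the end of a marker is determined by the input up to the end of the marker. -/
lemma IsLocal.run_congr (hC : C.IsLocal) {z z' : ℕ → S₁} {s t : ℕ}
    (hs : MarkAt C.mark C.markEnd z s) (h : ∀ k ≤ s + C.markEnd, z k = z' k)
    (ht : t < s + C.markEnd) (U : ℝ) : C.run z' U t = C.run z U t := by
  induction t using Nat.strong_induction_on generalizing z z' s U with
  | _ t ih =>
    have hl := len_congr hs h
    by_cases htl : t < C.len z
    · rw [C.run_of_lt htl, C.run_of_lt (by rwa [hl]), hC.seed_congr hs h, hl]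
    · push Not at htl
      have hd := hC.markAt_drop_len hs (by omega)
      have hn : C.next z' U = C.next z U := by rw [next, next, hC.seed_congr hs h, hl]
      rw [C.run_of_ge htl, C.run_of_ge (by rwa [hl]), hl, hn]
      refine ih _ (by have := C.len_pos z; omega) hd.2 (fun k hk => h _ (by omega)) (by omega) _

/-- A run passes through each marker. -/
lemma IsLocal.exists_run_drop (hC : C.IsLocal) {z : ℕ → S₁} {s : ℕ}
    (hs : MarkAt C.mark C.markEnd z s) (U : ℝ) : ∃ U' ∈ Set.Ico (0 : ℝ) 1,
      ∀ t, C.run z U (s + C.markEnd + t) = C.run (drop (s + C.markEnd) z) U' t := by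
  induction s using Nat.strong_induction_on generalizing z U with
  | _ s ih =>
    rcases (len_le hs).lt_or_eq with hlt | heq
    · have hd := hC.markAt_drop_len hs hlt
      obtain ⟨U', hU', h⟩ := ih (s - C.len z) (by have := C.len_pos z; omega) hd.2 (C.next z U)
      refine ⟨U', hU', fun t => ?_⟩
      rw [C.run_of_ge (by omega)]
      have e1 : s + C.markEnd + t - C.len z = s - C.len z + C.markEnd + t := by omega
      have e2 : C.len z + (s - C.len z + C.markEnd) = s + C.markEnd := by omega
      rw [e1, h t, drop_drop, e2]
    · refine ⟨C.next z U, next_mem z U, fun t => ?_⟩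
      rw [C.run_of_ge (by omega), heq, Nat.add_sub_cancel_left]

lemma mul_le_blockEnd (n : ℕ) (z : ℕ → S₁) : n * C.markEnd ≤ C.blockEnd n z := by
  induction n generalizing z with
  | zero => simp
  | succ n ih =>
    have h1 := ih (drop (C.len z) z)
    have h2 : C.markEnd ≤ C.len z := le_markLen z
    rw [blockEnd, Nat.add_mul]; omega

lemma exists_block (z : ℕ → S₁) (t : ℕ) : ∃ n, C.blockEnd n z ≤ t ∧ t < C.blockEnd (n + 1) z := by
  classical
  have hex : ∃ n, t < C.blockEnd n z := by
    refine ⟨t + 1, ?_⟩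
    have h1 := mul_le_blockEnd (C := C) (t + 1) z
    have h2 : (t + 1) * 1 ≤ (t + 1) * C.markEnd := Nat.mul_le_mul_left _ C.markEnd_pos
    omega
  obtain ⟨n, hn⟩ : ∃ n, Nat.find hex = n + 1 := by
    refine Nat.exists_eq_succ_of_ne_zero fun h0 => ?_
    have := Nat.find_spec hex
    rw [h0] at this
    simp [blockEnd] at this
  refine ⟨n, ?_, hn ▸ Nat.find_spec hex⟩
  exact Nat.not_lt.1 (Nat.find_min hex (by omega))

lemma IsLocal.blockEnd_succ_le (hC : C.IsLocal) {n : ℕ} {z : ℕ → S₁} {s t : ℕ}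
    (hs : MarkAt C.mark C.markEnd z s) (ht : t < s + C.markEnd) (hn : C.blockEnd n z ≤ t) :
    C.blockEnd (n + 1) z ≤ s + C.markEnd := by
  induction n generalizing z s t with
  | zero => exact len_le hs
  | succ n ih =>
    rw [blockEnd] at hn
    have hd := hC.markAt_drop_len hs (by omega)
    have := ih (t := t - C.len z) hd.2 (by omega) (by omega)
    rw [blockEnd]; omega

lemma floor_seed {D i k : ℕ} {U : ℝ} (hU : 0 ≤ U) :
    ⌊2 ^ (D + k) * ((i + U) / 2 ^ k)⌋₊ = 2 ^ D * i + ⌊2 ^ D * U⌋₊ := by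
  have h : (2 : ℝ) ^ (D + k) * ((i + U) / 2 ^ k) = ((2 ^ D * i : ℕ) : ℝ) + 2 ^ D * U := by
    push_cast
    field_simp
    ring
  rw [h, add_comm, Nat.floor_add_natCast (by positivity), add_comm]

lemma floor_fract {D c : ℕ} {V : ℝ} (hV : 0 ≤ V) :
    ⌊2 ^ D * Int.fract (2 ^ c * V)⌋₊ = ⌊2 ^ (D + c) * V⌋₊ - 2 ^ D * ⌊2 ^ c * V⌋₊ := by
  have h0 : (0 : ℝ) ≤ 2 ^ c * V := by positivity
  have h : (2 : ℝ) ^ D * Int.fract (2 ^ c * V)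
      = 2 ^ (D + c) * V - ((2 ^ D * ⌊2 ^ c * V⌋₊ : ℕ) : ℝ) := by
    push_cast
    rw [Int.fract, ← natCast_floor_eq_intCast_floor h0]
    ring
  rw [h, Nat.floor_sub_natCast]

/-- If enough bits have been extracted, the output does not depend on the initial seed. -/
lemma IsLocal.run_eq_run (hC : C.IsLocal) {n : ℕ} {z : ℕ → S₁} {U U' : ℝ} {D t : ℕ}
    (hU : U ∈ Set.Ico (0 : ℝ) 1) (hU' : U' ∈ Set.Ico (0 : ℝ) 1)
    (hD : ⌊2 ^ D * U⌋₊ = ⌊2 ^ D * U'⌋₊) (hg : C.AllGood (n + 1) z U)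
    (h1 : C.blockEnd n z ≤ t) (h2 : t < C.blockEnd (n + 1) z)
    (hb : C.bitsOut (n + 1) z U ≤ D + C.bitsIn (n + 1) z) : C.run z U' t = C.run z U t := by
  have same : ∀ {z : ℕ → S₁} {U U' : ℝ} {D : ℕ}, U ∈ Set.Ico (0 : ℝ) 1 →
      U' ∈ Set.Ico (0 : ℝ) 1 → ⌊2 ^ D * U⌋₊ = ⌊2 ^ D * U'⌋₊ →
      C.seed z U ∈ C.good (C.len z) →
      C.cost (C.len z) (C.seed z U) ≤ D + C.bits (C.len z) z →
      (C.cost (C.len z) (C.seed z U') = C.cost (C.len z) (C.seed z U) ∧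
        C.out (C.len z) (C.seed z U') = C.out (C.len z) (C.seed z U)) ∧
      ⌊2 ^ (D + C.bits (C.len z) z - C.cost (C.len z) (C.seed z U)) * C.next z U⌋₊ =
        ⌊2 ^ (D + C.bits (C.len z) z - C.cost (C.len z) (C.seed z U)) * C.next z U'⌋₊ := by
    intro z U U' D hU hU' hD hg hc
    have e : ⌊2 ^ (D + C.bits (C.len z) z) * C.seed z U⌋₊
        = ⌊2 ^ (D + C.bits (C.len z) z) * C.seed z U'⌋₊ := by
      rw [seed, seed, floor_seed hU.1, floor_seed hU'.1, hD]
    have e' : ⌊2 ^ C.cost (C.len z) (C.seed z U) * C.seed z U⌋₊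
        = ⌊2 ^ C.cost (C.len z) (C.seed z U) * C.seed z U'⌋₊ := by
      exact floor_two_pow_of_le hc e
    have hst := hC.stable _ _ _ hg (hC.seed_mem z hU') e'
    refine ⟨hst, ?_⟩
    rw [next, next, hst.1, floor_fract (hC.seed_mem z hU).1, floor_fract (hC.seed_mem z hU').1, e',
      Nat.sub_add_cancel hc, e]
  induction n generalizing z U U' D t with
  | zero =>
    simp only [blockEnd, bitsOut, bitsIn, add_zero] at h2 hb
    rw [C.run_of_lt h2, C.run_of_lt h2, (same hU hU' hD hg.1 hb).1.2]
  | succ n ih =>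
    rw [blockEnd] at h1 h2
    rw [bitsOut, bitsIn] at hb
    have hlt : C.len z ≤ t := by omega
    rw [C.run_of_ge hlt, C.run_of_ge hlt]
    by_cases hc : C.cost (C.len z) (C.seed z U) ≤ D + C.bits (C.len z) z
    · exact ih (next_mem z U) (next_mem z U') (same hU hU' hD hg.1 hc).2 hg.2 (by omega) (by omega)
        (by omega)
    · refine ih (D := 0) (next_mem z U) (next_mem z U') ?_ hg.2 (by omega) (by omega) (by omega)
      rw [pow_zero, one_mul, one_mul, Nat.floor_eq_zero.2 (next_mem z U).2,
        Nat.floor_eq_zero.2 (next_mem z U').2]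

end BlockCode

/-! ### The law of the output of a block code -/

section Joint

variable {S : Type*} [Fintype S] [MeasurableSpace S] [DiscreteMeasurableSpace S] [DecidableEq S]
  {P : Matrix S S ℝ} {p : S → ℝ} {ρ : Measure (ℕ → S)} {κ : S → Measure (ℕ → S)}

/-- The Markov property for a function of the past and the future. -/
lemma IsMC.lintegral_past_drop (hp : ∀ i, 0 ≤ p i) (hP : ∀ i j, 0 ≤ P i j) (h : IsMC P p ρ)
    (hκ : ∀ i, IsChainFrom P i (κ i)) (n : ℕ) {F : (ℕ → S) → (ℕ → S) → ℝ≥0∞}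
    (hF : ∀ x y, (∀ k ≤ n, x k = y k) → F x = F y) (hG : ∀ x, Measurable (F x)) :
    ∫⁻ z, F z (drop n z) ∂ρ = ∫⁻ z, ∫⁻ y, F z y ∂κ (z n) ∂ρ := by
  rw [lintegral_eq_sum_words ρ n, lintegral_eq_sum_words ρ n]
  refine Finset.sum_congr rfl fun w _ => ?_
  set u := wordExt w
  have h1 : ∀ z ∈ cyl n u, F z (drop n z) = F u (drop n z) := fun z hz => by
    rw [hF z u hz]
  have h2 : ∀ z ∈ cyl n u, ∫⁻ y, F z y ∂κ (z n) = ∫⁻ y, F u y ∂κ (u n) := fun z hz => by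
    rw [hF z u hz, hz n (Set.mem_Iic.2 le_rfl)]
  rw [setLIntegral_congr_fun (measurableSet_cyl n u) h1,
    setLIntegral_congr_fun (measurableSet_cyl n u) h2,
    h.lintegral_cyl_drop hp hP hκ n u (hG u), setLIntegral_const]
  ring

lemma measurable_countable_index {Ω β : Type*} [MeasurableSpace Ω] [MeasurableSpace β]
    {F : ℕ → Ω → β} {L : Ω → ℕ} (hF : ∀ l, Measurable (F l)) (hL : Measurable L) :
    Measurable fun ω => F (L ω) ω :=
  (measurable_from_prod_countable_right (f := fun q : ℕ × Ω => F q.1 q.2) hF).comp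
    (hL.prodMk measurable_id)

end Joint

namespace BlockCode

variable {S₁ S₂ : Type*} [MeasurableSpace S₁] [MeasurableSpace S₂] {C : BlockCode S₁ S₂}

/-- The stochastic properties of block codes: with respect to the measure `α` on inputs, the bits
extracted from a block are uniform given its probability and their number, and the unused part
of a seed is uniform and independent of the output. -/
structure IsRandom (C : BlockCode S₁ S₂) (P : Matrix S₁ S₁ ℝ) (α : Measure (ℕ → S₁)) : Prop
    extends C.IsLocal where
  measurable_block : ∀ l (G : ℕ → (ℕ → S₂) → ℝ≥0∞), Measurable fun U => G (C.cost l U) (C.out l U)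
  ae_good : ∀ l, ∀ᵐ U ∂unif, U ∈ C.good l
  lintegral_split : ∀ l (G : ℕ → (ℕ → S₂) → ℝ≥0∞) (e : ℝ → ℝ≥0∞), Measurable e →
    ∫⁻ U, G (C.cost l U) (C.out l U) * e (Int.fract (2 ^ C.cost l U * U)) ∂unif
      = (∫⁻ U, G (C.cost l U) (C.out l U) ∂unif) * ∫⁻ U, e U ∂unif
  lintegral_seed : ∀ l (g : ℝ → ℕ → ℝ≥0∞) (H : ℝ → ℝ≥0∞), Measurable H →
    ∫⁻ z in firstMark C.mark C.markEnd l, g (pathProd P z l) (C.bits l z) *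
      ∫⁻ U, H ((C.index l z + U) / 2 ^ C.bits l z) ∂unif ∂α
      = (∫⁻ z in firstMark C.mark C.markEnd l, g (pathProd P z l) (C.bits l z) ∂α)
        * ∫⁻ U, H U ∂unif

/-- One step of the code. -/
def step (C : BlockCode S₁ S₂) (ω : (ℕ → S₁) × ℝ) : (ℕ → S₁) × ℝ :=
  (drop (C.len ω.1) ω.1, C.next ω.1 ω.2)

variable {P : Matrix S₁ S₁ ℝ} {α : Measure (ℕ → S₁)}

lemma IsRandom.measurable_cost (hC : C.IsRandom P α) (l : ℕ) : Measurable (C.cost l) := by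
  refine measurable_to_countable' fun n => ?_
  have := hC.measurable_block l (fun c _ => if c = n then 1 else 0) (measurableSet_singleton 1)
  convert this using 1
  ext U
  simp

variable [Fintype S₁] [DiscreteMeasurableSpace S₁] [DecidableEq S₁]

lemma measurable_len : Measurable C.len := measurable_markLen

lemma IsRandom.measurable_bits (hC : C.IsRandom P α) (l : ℕ) : Measurable (C.bits l) :=
  measurable_of_Iic_dependence l (hC.bits_congr l)

lemma IsRandom.measurable_index (hC : C.IsRandom P α) (l : ℕ) : Measurable (C.index l) :=
  measurable_of_Iic_dependence l (hC.index_congr l)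

lemma IsRandom.measurable_seedAt (hC : C.IsRandom P α) (l : ℕ) :
    Measurable fun ω : (ℕ → S₁) × ℝ => (C.index l ω.1 + ω.2) / (2 : ℝ) ^ C.bits l ω.1 := by
  have h1 : Measurable fun ω : (ℕ → S₁) × ℝ => (C.index l ω.1 : ℝ) :=
    (measurable_of_countable (fun n : ℕ => (n : ℝ))).comp
      ((hC.measurable_index l).comp measurable_fst)
  have h2 : Measurable fun ω : (ℕ → S₁) × ℝ => (2 : ℝ) ^ C.bits l ω.1 :=
    (measurable_of_countable (fun n : ℕ => (2 : ℝ) ^ n)).comp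
      ((hC.measurable_bits l).comp measurable_fst)
  exact (h1.add measurable_snd).div h2

lemma IsRandom.measurable_fractAt (hC : C.IsRandom P α) (l : ℕ) :
    Measurable fun V : ℝ => Int.fract ((2 : ℝ) ^ C.cost l V * V) := by
  have h2 : Measurable fun V : ℝ => (2 : ℝ) ^ C.cost l V :=
    (measurable_of_countable (fun n : ℕ => (2 : ℝ) ^ n)).comp (hC.measurable_cost l)
  exact (h2.mul measurable_id).fract

lemma IsRandom.measurable_seed (hC : C.IsRandom P α) :
    Measurable fun ω : (ℕ → S₁) × ℝ => C.seed ω.1 ω.2 :=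
  measurable_countable_index (fun l => hC.measurable_seedAt l) (measurable_len.comp measurable_fst)

lemma IsRandom.measurable_step (hC : C.IsRandom P α) : Measurable C.step := by
  have hl : Measurable fun ω : (ℕ → S₁) × ℝ => C.len ω.1 := measurable_len.comp measurable_fst
  have h1 : ∀ l, Measurable fun ω : (ℕ → S₁) × ℝ => drop l ω.1 := fun l =>
    (measurable_drop l).comp measurable_fst
  have h2 : ∀ l, Measurable fun ω : (ℕ → S₁) × ℝ =>
      Int.fract ((2 : ℝ) ^ C.cost l (C.seed ω.1 ω.2) * C.seed ω.1 ω.2) := fun l =>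
    (hC.measurable_fractAt l).comp hC.measurable_seed
  exact (measurable_countable_index h1 hl).prodMk (measurable_countable_index h2 hl)

lemma IsRandom.measurableSet_out (hC : C.IsRandom P α) (l : ℕ) (A : Set (ℕ → S₂)) :
    MeasurableSet {U | C.out l U ∈ A} := by
  classical
  have := hC.measurable_block l (fun _ y => if y ∈ A then 1 else 0) (measurableSet_singleton 1)
  convert this using 1
  ext U
  simp

lemma IsRandom.measurable_run (hC : C.IsRandom P α) (t : ℕ) :
    Measurable fun ω : (ℕ → S₁) × ℝ => C.run ω.1 ω.2 t := by
  have hl : Measurable fun ω : (ℕ → S₁) × ℝ => C.len ω.1 := measurable_len.comp measurable_fst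
  induction t using Nat.strong_induction_on with
  | _ t ih =>
    have key : ∀ l, Measurable fun ω : (ℕ → S₁) × ℝ => if t < max l 1 then
        C.out l (C.seed ω.1 ω.2) t else C.run (C.step ω).1 (C.step ω).2 (t - max l 1) := by
      intro l
      split_ifs with h
      · intro A _
        exact hC.measurable_seed (hC.measurableSet_out l {y | y t ∈ A})
      · exact (ih (t - max l 1) (by omega)).comp hC.measurable_step
    convert measurable_countable_index key hl using 2 with ω
    have := C.len_pos ω.1
    rw [max_eq_left (by omega : 1 ≤ C.len ω.1), run]
    rfl

variable {κ : S₁ → Measure (ℕ → S₁)} {a : S₁}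

/-- The law of the first block and of the rest of the run. -/
lemma IsRandom.lintegral_block (hC : C.IsRandom P (κ a)) (hP : ∀ i j, 0 ≤ P i j)
    (hκ : ∀ i, IsChainFrom P i (κ i))
    (ha : ∀ l, ∀ z ∈ firstMark C.mark C.markEnd l, z l = a) (l : ℕ) (g : ℝ → ℕ → ℝ≥0∞)
    (G : ℕ → (ℕ → S₂) → ℝ≥0∞) {Ψ : (ℕ → S₁) × ℝ → ℝ≥0∞} (hΨ : Measurable Ψ) :
    ∫⁻ ω in firstMark C.mark C.markEnd l ×ˢ Set.univ, g (pathProd P ω.1 l) (C.bits l ω.1) *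
        (G (C.cost l (C.seed ω.1 ω.2)) (C.out l (C.seed ω.1 ω.2)) * Ψ (C.step ω))
        ∂(κ a).prod unif
      = (∫⁻ z in firstMark C.mark C.markEnd l, g (pathProd P z l) (C.bits l z) ∂κ a)
        * ((∫⁻ U, G (C.cost l U) (C.out l U) ∂unif) * ∫⁻ ω, Ψ ω ∂(κ a).prod unif) := by
  have : IsProbabilityMeasure (κ a) := (hκ a).isProbabilityMeasure
  set F : Set (ℕ → S₁) := firstMark C.mark C.markEnd l
  have hF : MeasurableSet F := measurableSet_firstMark l
  let V : (ℕ → S₁) → ℝ → ℝ := fun z U => (C.index l z + U) / (2 : ℝ) ^ C.bits l z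
  let ψ : ℝ → ℝ≥0∞ := fun u => ∫⁻ y, Ψ (y, u) ∂κ a
  have hψ : Measurable ψ := hΨ.lintegral_prod_left'
  let gg : (ℕ → S₁) → ℝ≥0∞ := fun z => F.indicator (fun z => g (pathProd P z l) (C.bits l z)) z
  have hFdep : ∀ x y, (∀ k ≤ l, x k = y k) → (x ∈ F ↔ y ∈ F) := fun x y hxy =>
    (dependsOnWindow_firstMark l).iff hxy
  have hgdep : ∀ x y, (∀ k ≤ l, x k = y k) → gg x = gg y := by
    intro x y hxy
    by_cases hx : x ∈ F
    · simp only [gg, Set.indicator_of_mem hx, Set.indicator_of_mem ((hFdep x y hxy).1 hx),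
        pathProd_congr P hxy, hC.bits_congr l x y hxy]
    · simp only [gg, Set.indicator_of_notMem hx,
        Set.indicator_of_notMem fun hy => hx ((hFdep x y hxy).2 hy)]
  have hgg : Measurable gg := measurable_of_Iic_dependence l hgdep
  have hVdep : ∀ x y, (∀ k ≤ l, x k = y k) → V x = V y := by
    intro x y hxy
    simp only [V, hC.bits_congr l x y hxy, hC.index_congr l x y hxy]
  let M : ℝ → ℝ≥0∞ := fun u => G (C.cost l u) (C.out l u)
  have hM : Measurable M := hC.measurable_block l G
  let fr : ℝ → ℝ := fun u => Int.fract (2 ^ C.cost l u * u)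
  have hfr : Measurable fr := hC.measurable_fractAt l
  have hV : Measurable fun ω : (ℕ → S₁) × ℝ => V ω.1 ω.2 := hC.measurable_seedAt l
  let H : ℝ → ℝ≥0∞ := fun u => M u * ψ (fr u)
  have hH : Measurable H := hM.mul (hψ.comp hfr)
  calc _ = ∫⁻ ω, gg ω.1 * (M (V ω.1 ω.2) * Ψ (drop l ω.1, fr (V ω.1 ω.2))) ∂(κ a).prod unif := by
        rw [← lintegral_indicator (hF.prod MeasurableSet.univ)]
        refine lintegral_congr fun ω => ?_
        by_cases hω : ω.1 ∈ F
        · have hl : C.len ω.1 = l := markLen_of_mem_firstMark hω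
          rw [Set.indicator_of_mem (by simpa using hω)]
          simp only [gg, Set.indicator_of_mem hω, M, V, fr, step, seed, next, hl]
        · rw [Set.indicator_of_notMem (by simpa using hω)]
          simp only [gg, Set.indicator_of_notMem hω, zero_mul]
    _ = ∫⁻ U, ∫⁻ z, gg z * (M (V z U) * Ψ (drop l z, fr (V z U))) ∂κ a ∂unif := by
        refine lintegral_prod_symm _ (Measurable.aemeasurable ?_)
        exact (hgg.comp measurable_fst).mul ((hM.comp hV).mul
          (hΨ.comp (((measurable_drop l).comp measurable_fst).prodMk (hfr.comp hV))))
    _ = ∫⁻ U, ∫⁻ z, gg z * H (V z U) ∂κ a ∂unif := by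
        refine lintegral_congr fun U => ?_
        have := (hκ a).lintegral_past_drop (single_one_nonneg a) hP hκ l
          (F := fun z y => gg z * (M (V z U) * Ψ (y, fr (V z U))))
          (fun x y hxy => by simp only [hgdep x y hxy, hVdep x y hxy])
          (fun x => ((hΨ.comp measurable_prodMk_right).const_mul _).const_mul _)
        rw [this]
        refine lintegral_congr fun z => ?_
        have hm : Measurable fun y => Ψ (y, fr (V z U)) := hΨ.comp measurable_prodMk_right
        by_cases hz : z ∈ F
        · rw [ha l z hz, lintegral_const_mul _ (hm.const_mul _), lintegral_const_mul _ hm]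
        · simp only [gg, Set.indicator_of_notMem hz, zero_mul, lintegral_zero]
    _ = ∫⁻ z, ∫⁻ U, gg z * H (V z U) ∂unif ∂κ a := by
        refine lintegral_lintegral_swap (Measurable.aemeasurable ?_)
        exact (hgg.comp measurable_snd).mul (hH.comp (hV.comp measurable_swap))
    _ = ∫⁻ z in F, g (pathProd P z l) (C.bits l z) * ∫⁻ U, H (V z U) ∂unif ∂κ a := by
        rw [← lintegral_indicator hF]
        refine lintegral_congr fun z => ?_
        have hm : Measurable fun U => H (V z U) := hH.comp (hV.comp measurable_prodMk_left)
        rw [lintegral_const_mul _ hm]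
        by_cases hz : z ∈ F
        · simp only [gg, Set.indicator_of_mem hz]
        · simp only [gg, Set.indicator_of_notMem hz, zero_mul]
    _ = _ := by
        rw [hC.lintegral_seed l g H hH, hC.lintegral_split l G ψ hψ,
          lintegral_prod_symm _ hΨ.aemeasurable]

/-- A random block code driven by a recurrent Markov chain. -/
structure IsCoding (C : BlockCode S₁ S₂) (P : Matrix S₁ S₁ ℝ) (κ : S₁ → Measure (ℕ → S₁)) (a : S₁) :
    Prop extends C.IsRandom P (κ a) where
  nonneg : ∀ i j, 0 ≤ P i j
  chain : ∀ i, IsChainFrom P i (κ i)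
  last : ∀ l, ∀ z ∈ firstMark C.mark C.markEnd l, z l = a
  recurrent : ∀ᵐ z ∂κ a, z ∈ ⋃ n, firstMark C.mark C.markEnd n

lemma IsCoding.isProbabilityMeasure (h : C.IsCoding P κ a) : IsProbabilityMeasure (κ a) :=
  (h.chain a).isProbabilityMeasure

lemma IsCoding.lintegral_le_tsum (h : C.IsCoding P κ a) (f : (ℕ → S₁) × ℝ → ℝ≥0∞) :
    ∫⁻ ω, f ω ∂(κ a).prod unif ≤
      ∑' l, ∫⁻ ω in firstMark C.mark C.markEnd l ×ˢ Set.univ, f ω ∂(κ a).prod unif := by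
  have := h.isProbabilityMeasure
  have hae : ∀ᵐ ω ∂(κ a).prod unif, ω ∈ ⋃ l, firstMark C.mark C.markEnd l ×ˢ Set.univ := by
    filter_upwards [Measure.quasiMeasurePreserving_fst.ae h.recurrent] with ω hω
    simpa using hω
  conv_lhs => rw [← Measure.restrict_eq_self_of_ae_mem hae]
  exact lintegral_iUnion_le _ _

lemma IsCoding.measure_le_tsum (h : C.IsCoding P κ a) (E : Set ((ℕ → S₁) × ℝ)) :
    (κ a).prod unif E ≤
      ∑' l, (κ a).prod unif (E ∩ firstMark C.mark C.markEnd l ×ˢ Set.univ) := by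
  have := h.isProbabilityMeasure
  have hae : ∀ᵐ ω ∂(κ a).prod unif, ω ∈ ⋃ l, firstMark C.mark C.markEnd l ×ˢ Set.univ := by
    filter_upwards [Measure.quasiMeasurePreserving_fst.ae h.recurrent] with ω hω
    simpa using hω
  refine le_trans ?_ (measure_iUnion_le _)
  rw [← Set.inter_iUnion]
  refine measure_mono_ae ?_
  filter_upwards [hae] with ω hω hE using ⟨hE, hω⟩

/-- The probability that the first block has length `l`, its output is in `A` and the rest of the
run is in `E`. -/
lemma IsCoding.measure_block (h : C.IsCoding P κ a) (l : ℕ) (A : Set (ℕ → S₂))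
    {E : Set ((ℕ → S₁) × ℝ)} (hE : MeasurableSet E) :
    (κ a).prod unif ({ω | C.out l (C.seed ω.1 ω.2) ∈ A ∧ C.step ω ∈ E} ∩
        firstMark C.mark C.markEnd l ×ˢ Set.univ)
      = κ a (firstMark C.mark C.markEnd l) * (unif {U | C.out l U ∈ A} * (κ a).prod unif E) := by
  classical
  have hm : MeasurableSet {ω : (ℕ → S₁) × ℝ | C.out l (C.seed ω.1 ω.2) ∈ A ∧ C.step ω ∈ E} :=
    (h.measurable_seed (h.measurableSet_out l A)).inter (h.measurable_step hE)
  have key := h.lintegral_block h.nonneg h.chain h.last l (fun _ _ => 1)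
    (fun _ y => if y ∈ A then 1 else 0) (Ψ := E.indicator 1) (measurable_one.indicator hE)
  rw [lintegral_indicator_one hE, setLIntegral_const, one_mul] at key
  have hA : ∫⁻ U, (if C.out l U ∈ A then 1 else 0) ∂unif = unif {U | C.out l U ∈ A} := by
    rw [← lintegral_indicator_one (h.measurableSet_out l A)]
    exact lintegral_congr fun U => by by_cases hU : C.out l U ∈ A <;> simp [hU]
  rw [hA] at key
  rw [← key, ← Measure.restrict_apply hm, ← lintegral_indicator_one hm]
  refine lintegral_congr fun ω => ?_
  by_cases h1 : C.out l (C.seed ω.1 ω.2) ∈ A <;> by_cases h2 : C.step ω ∈ E <;> simp [h1, h2]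

lemma IsCoding.ae_seed_good (h : C.IsCoding P κ a) :
    ∀ᵐ ω ∂(κ a).prod unif, C.seed ω.1 ω.2 ∈ C.good (C.len ω.1) := by
  have := h.isProbabilityMeasure
  rw [ae_iff, ← nonpos_iff_eq_zero]
  refine (h.measure_le_tsum _).trans (le_of_eq (ENNReal.tsum_eq_zero.2 fun l => ?_))
  set F : Set (ℕ → S₁) := firstMark C.mark C.markEnd l
  have hF : MeasurableSet F := measurableSet_firstMark l
  set B := toMeasurable unif (C.good l)ᶜ
  have hB : MeasurableSet B := measurableSet_toMeasurable _ _
  have hB0 : unif B = 0 := (measure_toMeasurable _).trans (ae_iff.1 (h.ae_good l))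
  have key := h.lintegral_seed l (fun _ _ => 1) (B.indicator 1) (measurable_one.indicator hB)
  rw [lintegral_indicator_one hB, hB0, mul_zero] at key
  let E : Set ((ℕ → S₁) × ℝ) :=
    F ×ˢ Set.univ ∩ {ω | (C.index l ω.1 + ω.2) / (2 : ℝ) ^ C.bits l ω.1 ∈ B}
  have hE : MeasurableSet E :=
    (hF.prod MeasurableSet.univ).inter (h.measurable_seedAt l hB)
  refine measure_mono_null (t := E) ?_ ?_
  · rintro ω ⟨h1, h2⟩
    have hl : C.len ω.1 = l := markLen_of_mem_firstMark h2.1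
    refine ⟨h2, subset_toMeasurable _ _ ?_⟩
    have h1' : C.seed ω.1 ω.2 ∉ C.good (C.len ω.1) := h1
    rw [seed, hl] at h1'
    exact h1'
  · rw [Measure.prod_apply hE, ← key, ← lintegral_indicator hF]
    refine lintegral_congr fun z => ?_
    by_cases hz : z ∈ F
    · have hm : MeasurableSet (Prod.mk z ⁻¹' E) := measurable_prodMk_left hE
      rw [Set.indicator_of_mem hz, one_mul, ← lintegral_indicator_one hm]
      refine lintegral_congr fun U => ?_
      have e : U ∈ Prod.mk z ⁻¹' E ↔ (C.index l z + U) / (2 : ℝ) ^ C.bits l z ∈ B :=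
        ⟨fun hU => hU.2, fun hU => ⟨⟨hz, trivial⟩, hU⟩⟩
      by_cases hU : U ∈ Prod.mk z ⁻¹' E
      · rw [Set.indicator_of_mem hU, Set.indicator_of_mem (e.1 hU)]; rfl
      · rw [Set.indicator_of_notMem hU, Set.indicator_of_notMem fun hB => hU (e.2 hB)]
    · rw [Set.indicator_of_notMem hz]
      have : Prod.mk z ⁻¹' E = ∅ := by
        ext U; simp [E, hz]
      rw [this, measure_empty]

lemma IsCoding.ae_step (h : C.IsCoding P κ a) {p : (ℕ → S₁) × ℝ → Prop}
    (hp : ∀ᵐ ω ∂(κ a).prod unif, p ω) : ∀ᵐ ω ∂(κ a).prod unif, p (C.step ω) := by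
  have := h.isProbabilityMeasure
  rw [ae_iff, ← nonpos_iff_eq_zero]
  refine (h.measure_le_tsum _).trans (le_of_eq (ENNReal.tsum_eq_zero.2 fun l => ?_))
  set N := toMeasurable ((κ a).prod unif) {ω | ¬ p ω}
  have hN0 : (κ a).prod unif N = 0 := (measure_toMeasurable _).trans (ae_iff.1 hp)
  have key := h.measure_block l Set.univ (measurableSet_toMeasurable ((κ a).prod unif) {ω | ¬ p ω})
  rw [hN0, mul_zero, mul_zero] at key
  refine measure_mono_null ?_ key
  rintro ω ⟨h1, h2⟩
  exact ⟨⟨trivial, subset_toMeasurable _ _ h1⟩, h2⟩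

lemma IsCoding.ae_allGood (h : C.IsCoding P κ a) :
    ∀ᵐ ω ∂(κ a).prod unif, ∀ n, C.AllGood n ω.1 ω.2 := by
  rw [ae_all_iff]
  intro n
  induction n with
  | zero => simp [AllGood]
  | succ n ih =>
    filter_upwards [h.ae_seed_good, h.ae_step ih] with ω h1 h2 using ⟨h1, h2⟩

end BlockCode

namespace BlockCode

variable {S₁ S₂ : Type*} [MeasurableSpace S₁] [MeasurableSpace S₂] {C : BlockCode S₁ S₂}
  [Fintype S₁] [DiscreteMeasurableSpace S₁] [DecidableEq S₁]
  [Fintype S₂] [DiscreteMeasurableSpace S₂] [DecidableEq S₂]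
  {P : Matrix S₁ S₁ ℝ} {κ : S₁ → Measure (ℕ → S₁)} {a : S₁}
  {Q : Matrix S₂ S₂ ℝ} {κ' : S₂ → Measure (ℕ → S₂)} {b : S₂} {f : ℕ → ℝ≥0∞}

lemma setLIntegral_cyl_stopWeight (hQ : ∀ i j, 0 ≤ Q i j) (hκ' : ∀ i, IsChainFrom Q i (κ' i))
    {l K : ℕ} (hl : 0 < l) (hK : l ≤ K) (u : ℕ → S₂) :
    ∫⁻ y in cyl K u, stopWeight f b l y ∂κ' b =
      (∫⁻ y in cyl (l - 1) u, stopWeight f b l y ∂κ' b) * κ' b (cyl (K - l) (drop l u)) := by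
  let F : (ℕ → S₂) → ℝ≥0∞ := (cyl (l - 1) u).indicator (stopWeight f b l)
  let G : (ℕ → S₂) → ℝ≥0∞ := (cyl (K - l) (drop l u)).indicator 1
  have hF : ∀ x y, (∀ k ≤ l, x k = y k) → F x = F y := by
    intro x y hxy
    have e : x ∈ cyl (l - 1) u ↔ y ∈ cyl (l - 1) u := by
      refine forall₂_congr fun k hk => ?_
      rw [hxy k (by have := Set.mem_Iic.1 hk; omega)]
    by_cases hx : x ∈ cyl (l - 1) u
    · simp only [F, Set.indicator_of_mem hx, Set.indicator_of_mem (e.1 hx),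
        stopWeight_congr f b hxy]
    · simp only [F, Set.indicator_of_notMem hx, Set.indicator_of_notMem fun hy => hx (e.2 hy)]
  have hG : Measurable G := measurable_one.indicator (measurableSet_cyl _ _)
  have key := (hκ' b).lintegral_past_mul_drop (single_one_nonneg b) hQ hκ' l hF hG
  have hGi : ∀ i, ∫⁻ y, G y ∂κ' i = κ' i (cyl (K - l) (drop l u)) := fun i =>
    lintegral_indicator_one (measurableSet_cyl _ _)
  have h1 : ∫⁻ y in cyl K u, stopWeight f b l y ∂κ' b = ∫⁻ y, F y * G (drop l y) ∂κ' b := by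
    rw [← lintegral_indicator (measurableSet_cyl _ _)]
    refine lintegral_congr fun y => ?_
    have e : y ∈ cyl K u ↔ y ∈ cyl (l - 1) u ∧ drop l y ∈ cyl (K - l) (drop l u) := by
      refine ⟨fun hy => ⟨fun k hk => hy k ?_, fun k hk => hy (l + k) ?_⟩, fun hy k hk => ?_⟩
      · have := Set.mem_Iic.1 hk; exact Set.mem_Iic.2 (by omega)
      · have := Set.mem_Iic.1 hk; exact Set.mem_Iic.2 (by omega)
      · have hk' := Set.mem_Iic.1 hk
        rcases lt_or_ge k l with hkl | hkl
        · exact hy.1 k (Set.mem_Iic.2 (by omega))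
        · have := hy.2 (k - l) (Set.mem_Iic.2 (by omega))
          simpa [drop, Nat.add_sub_cancel' hkl] using this
    by_cases hy1 : y ∈ cyl (l - 1) u <;> by_cases hy2 : drop l y ∈ cyl (K - l) (drop l u) <;>
      simp [F, G, Set.indicator, e, hy1, hy2]
  have h2 : ∀ y, F y * ∫⁻ y', G y' ∂κ' (y l) = F y * κ' b (cyl (K - l) (drop l u)) := by
    intro y
    by_cases hy : y l = b
    · rw [hy, hGi]
    · have : F y = 0 := by
        refine Set.indicator_apply_eq_zero.2 fun _ => stopWeight_of_ne f hy
      rw [this, zero_mul, zero_mul]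
  rw [h1, key, lintegral_congr h2, lintegral_mul_const _ (measurable_of_Iic_dependence l hF),
    ← lintegral_indicator (measurableSet_cyl _ _)]

/-- If the output blocks have the law of the blocks of a chain started at `b` with randomized
stopping, the output is a chain started at `b`. -/
lemma IsCoding.measure_run_le (h : C.IsCoding P κ a) (hQ : ∀ i j, 0 ≤ Q i j)
    (hκ' : ∀ i, IsChainFrom Q i (κ' i)) (hf : ∀ t, f t ≤ 1)
    (hlaw : ∀ l K u, K < l → κ a (firstMark C.mark C.markEnd l) * unif {U | C.out l U ∈ cyl K u}
      ≤ ∫⁻ y in cyl K u, stopWeight f b l y ∂κ' b) (K : ℕ) (u : ℕ → S₂) :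
    (κ a).prod unif {ω | C.run ω.1 ω.2 ∈ cyl K u} ≤ κ' b (cyl K u) := by
  have := h.isProbabilityMeasure
  have hm : ∀ K u, MeasurableSet {ω : (ℕ → S₁) × ℝ | C.run ω.1 ω.2 ∈ cyl K u} := fun K u =>
    (measurable_pi_lambda _ fun t => h.measurable_run t) (measurableSet_cyl K u)
  induction K using Nat.strong_induction_on generalizing u with
  | _ K ih =>
    have hterm : ∀ l, (κ a).prod unif ({ω | C.run ω.1 ω.2 ∈ cyl K u} ∩
        firstMark C.mark C.markEnd l ×ˢ Set.univ) ≤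
        if l = 0 then 0 else ∫⁻ y in cyl K u, stopWeight f b l y ∂κ' b := by
      intro l
      split_ifs with hl0
      · subst hl0
        refine le_of_eq (measure_mono_null (t := ∅) ?_ measure_empty)
        rintro ω ⟨-, h2⟩
        have : C.markEnd ≤ 0 := h2.1.1
        have := C.markEnd_pos
        omega
      have hlpos : 0 < l := Nat.pos_of_ne_zero hl0
      rcases lt_or_ge K l with hKl | hlK
      · refine le_trans ?_ (hlaw l K u hKl)
        have key := h.measure_block l (cyl K u) MeasurableSet.univ
        rw [measure_univ, mul_one] at key
        rw [← key]
        refine measure_mono ?_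
        rintro ω ⟨h1, h2⟩
        have hlen : C.len ω.1 = l := markLen_of_mem_firstMark h2.1
        refine ⟨⟨fun k hk => ?_, trivial⟩, h2⟩
        rw [← h1 k hk, C.run_of_lt (by have := Set.mem_Iic.1 hk; omega), hlen]
      · have key := h.measure_block l (cyl (l - 1) u) (hm (K - l) (drop l u))
        rw [setLIntegral_cyl_stopWeight hQ hκ' hlpos hlK]
        refine le_trans ?_ (mul_le_mul' (hlaw l (l - 1) u (by omega))
          (ih (K - l) (by omega) (drop l u)))
        rw [mul_assoc, ← key]
        refine measure_mono ?_
        rintro ω ⟨h1, h2⟩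
        have hlen : C.len ω.1 = l := markLen_of_mem_firstMark h2.1
        refine ⟨⟨fun k hk => ?_, fun k hk => ?_⟩, h2⟩
        · have hk' := Set.mem_Iic.1 hk
          rw [← h1 k (Set.mem_Iic.2 (by omega)), C.run_of_lt (by omega), hlen]
        · have hk' := Set.mem_Iic.1 hk
          have := h1 (l + k) (Set.mem_Iic.2 (by omega))
          rw [C.run_of_ge (by omega), hlen, Nat.add_sub_cancel_left] at this
          rw [step, hlen]
          exact this
    calc _ ≤ ∑' l, if l = 0 then 0 else ∫⁻ y in cyl K u, stopWeight f b l y ∂κ' b :=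
          (h.measure_le_tsum _).trans (ENNReal.tsum_le_tsum hterm)
      _ = ∑' l, ∫⁻ y in cyl K u, stopWeight f b (l + 1) y ∂κ' b := by
          rw [tsum_eq_zero_add' ENNReal.summable]
          simp
      _ = ∫⁻ y in cyl K u, ∑' l, stopWeight f b (l + 1) y ∂κ' b := by
          rw [lintegral_tsum]
          exact fun l => (measurable_of_Iic_dependence (l + 1) fun x y hxy =>
            stopWeight_congr f b hxy).aemeasurable
      _ ≤ ∫⁻ y in cyl K u, 1 ∂κ' b := lintegral_mono fun y => tsum_stopWeight_le hf b y
      _ = _ := by rw [setLIntegral_const, one_mul]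

lemma IsCoding.measure_run_le_of_window (h : C.IsCoding P κ a)
    (hrun : ∀ K u, (κ a).prod unif {ω | C.run ω.1 ω.2 ∈ cyl K u} ≤ κ' b (cyl K u)) {K : ℕ}
    {E : Set (ℕ → S₂)} (hE : DependsOnWindow (Set.Iic K) E) :
    (κ a).prod unif {ω | C.run ω.1 ω.2 ∈ E} ≤ κ' b E := by
  have hm : Measurable fun ω : (ℕ → S₁) × ℝ => C.run ω.1 ω.2 :=
    measurable_pi_lambda _ fun t => h.measurable_run t
  have hEm := hE.measurableSet (Set.finite_Iic K)
  have key := hE.measure_le (Set.finite_Iic K) (μ := ((κ a).prod unif).map fun ω => C.run ω.1 ω.2)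
    (ν := κ' b) fun w _ => by
      change Measure.map _ _ (cyl K w) ≤ κ' b (cyl K w)
      rw [Measure.map_apply hm (measurableSet_cyl K w)]
      exact hrun K w
  rwa [Measure.map_apply hm hEm] at key

end BlockCode

/-! ### The balance of random bits -/

namespace BlockCode

/-- The contribution of an input block of length `l` to the balance. -/
def inWeight (Δ : ℝ) (l : ℕ) (q : ℝ) (n : ℕ) : ℝ≥0∞ :=
  ENNReal.ofReal √(Real.exp (-(Δ * l)) / (2 ^ n * q))

/-- The contribution of an output block of length `l` to the balance. -/
def outWeight {S : Type*} (Q : Matrix S S ℝ) (l c : ℕ) (y : ℕ → S) : ℝ≥0∞ :=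
  ENNReal.ofReal √(2 ^ c * pathProd Q y l)

variable {S₁ S₂ : Type*}

/-- The balance of the first blocks. -/
def weight (C : BlockCode S₁ S₂) (P : Matrix S₁ S₁ ℝ) (Q : Matrix S₂ S₂ ℝ) (Δ : ℝ) :
    ℕ → (ℕ → S₁) × ℝ → ℝ≥0∞
  | 0, _ => 1
  | N + 1, ω => inWeight Δ (C.len ω.1) (pathProd P ω.1 (C.len ω.1)) (C.bits (C.len ω.1) ω.1) *
      (outWeight Q (C.len ω.1) (C.cost (C.len ω.1) (C.seed ω.1 ω.2))
        (C.out (C.len ω.1) (C.seed ω.1 ω.2)) * weight C P Q Δ N (C.step ω))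

variable {C : BlockCode S₁ S₂} {P : Matrix S₁ S₁ ℝ} {Q : Matrix S₂ S₂ ℝ} {Δ : ℝ} {b : S₂}

lemma pathProd_run (h0 : ∀ l U, C.out l U 0 = b) (h1 : ∀ l U, C.out l U l = b) (z : ℕ → S₁) (U : ℝ)
    (k : ℕ) : pathProd Q (C.run z U) (C.len z + k) =
      pathProd Q (C.out (C.len z) (C.seed z U)) (C.len z) *
        pathProd Q (C.run (C.step (z, U)).1 (C.step (z, U)).2) k := by
  have hd : drop (C.len z) (C.run z U) = C.run (C.step (z, U)).1 (C.step (z, U)).2 := by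
    funext t
    rw [drop, C.run_of_ge (Nat.le_add_right _ _), Nat.add_sub_cancel_left]
    rfl
  rw [pathProd_add, hd]
  congr 1
  refine pathProd_congr Q fun k hk => ?_
  rcases hk.lt_or_eq with hk | rfl
  · rw [C.run_of_lt hk]
  · rw [C.run_of_ge le_rfl, Nat.sub_self, h1, C.run_of_lt (C.len_pos _), h0]

lemma weight_eq (hP : ∀ i j, 0 ≤ P i j) (hQ : ∀ i j, 0 ≤ Q i j) (h0 : ∀ l U, C.out l U 0 = b)
    (h1 : ∀ l U, C.out l U l = b) (N : ℕ) (z : ℕ → S₁) (U : ℝ) :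
    C.weight P Q Δ N (z, U) = ENNReal.ofReal √(2 ^ C.bitsOut N z U *
      pathProd Q (C.run z U) (C.blockEnd N z) * Real.exp (-(Δ * C.blockEnd N z)) /
        (2 ^ C.bitsIn N z * pathProd P z (C.blockEnd N z))) := by
  induction N generalizing z U with
  | zero => simp [weight, bitsOut, bitsIn, blockEnd, pathProd_zero]
  | succ N ih =>
    have e : C.step (z, U) = (drop (C.len z) z, C.next z U) := rfl
    have hQ' := pathProd_nonneg hQ
    have hP' := pathProd_nonneg hP
    rw [weight, e, ih, inWeight, outWeight, ← ENNReal.ofReal_mul (Real.sqrt_nonneg _),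
      ← Real.sqrt_mul (mul_nonneg (by positivity) (hQ' _ _)),
      ← ENNReal.ofReal_mul (Real.sqrt_nonneg _),
      ← Real.sqrt_mul (div_nonneg (by positivity) (mul_nonneg (by positivity) (hP' _ _)))]
    congr 2
    rw [bitsOut, bitsIn, blockEnd, pathProd_run h0 h1, pathProd_add, e, pow_add, pow_add,
      Nat.cast_add, mul_add, neg_add, Real.exp_add]
    simp only [div_eq_mul_inv, mul_inv]
    ring

variable [MeasurableSpace S₁] [MeasurableSpace S₂]
  [Fintype S₁] [DiscreteMeasurableSpace S₁] [DecidableEq S₁]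
  [Fintype S₂] [DiscreteMeasurableSpace S₂] [DecidableEq S₂]
  {κ : S₁ → Measure (ℕ → S₁)} {a : S₁} {κ' : S₂ → Measure (ℕ → S₂)}

lemma IsRandom.measurable_weight {α : Measure (ℕ → S₁)} (hC : C.IsRandom P α) (N : ℕ) :
    Measurable (C.weight P Q Δ N) := by
  induction N with
  | zero => exact measurable_one
  | succ N ih =>
    have key : ∀ l, Measurable fun ω : (ℕ → S₁) × ℝ =>
        inWeight Δ l (pathProd P ω.1 l) (C.bits l ω.1) *
        (outWeight Q l (C.cost l (C.seed ω.1 ω.2)) (C.out l (C.seed ω.1 ω.2)) *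
          C.weight P Q Δ N (C.step ω)) := fun l => by
      have h1 : Measurable fun z : ℕ → S₁ => inWeight Δ l (pathProd P z l) (C.bits l z) :=
        measurable_of_Iic_dependence l fun x y hxy => by
          rw [pathProd_congr P hxy, hC.bits_congr l x y hxy]
      exact (h1.comp measurable_fst).mul
        (((hC.measurable_block l (outWeight Q l)).comp hC.measurable_seed).mul
          (ih.comp hC.measurable_step))
    have hl : Measurable fun ω : (ℕ → S₁) × ℝ => C.len ω.1 := measurable_len.comp measurable_fst
    have := measurable_countable_index key hl
    exact this

lemma IsCoding.lintegral_weight_le (h : C.IsCoding P κ a)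
    (hin : ∑' l, ∫⁻ z in firstMark C.mark C.markEnd l,
      inWeight Δ l (pathProd P z l) (C.bits l z) ∂κ a ≤ 1)
    (hout : ∀ l, ∫⁻ U, outWeight Q l (C.cost l U) (C.out l U) ∂unif ≤ 14) (N : ℕ) :
    ∫⁻ ω, C.weight P Q Δ N ω ∂(κ a).prod unif ≤ 14 ^ N := by
  have := h.isProbabilityMeasure
  induction N with
  | zero => simp [weight]
  | succ N ih =>
    have hterm : ∀ l, ∫⁻ ω in firstMark C.mark C.markEnd l ×ˢ Set.univ, C.weight P Q Δ (N + 1) ω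
        ∂(κ a).prod unif ≤ (∫⁻ z in firstMark C.mark C.markEnd l,
          inWeight Δ l (pathProd P z l) (C.bits l z) ∂κ a) * 14 ^ (N + 1) := by
      intro l
      have key := h.lintegral_block h.nonneg h.chain h.last l (inWeight Δ l) (outWeight Q l)
        (h.measurable_weight (Q := Q) (Δ := Δ) N)
      rw [pow_succ']
      refine le_trans (le_of_eq ?_) (mul_le_mul_right (mul_le_mul' (hout l) ih) _)
      rw [← key]
      refine setLIntegral_congr_fun ((measurableSet_firstMark l).prod MeasurableSet.univ) ?_
      rintro ω ⟨hω, -⟩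
      have hl : C.len ω.1 = l := markLen_of_mem_firstMark hω
      simp only [weight, hl]
    calc _ ≤ _ := h.lintegral_le_tsum _
      _ ≤ _ := ENNReal.tsum_le_tsum hterm
      _ ≤ 1 * 14 ^ (N + 1) := by rw [ENNReal.tsum_mul_right]; gcongr
      _ = _ := one_mul _

lemma IsCoding.lintegral_tsum_weight_le (h : C.IsCoding P κ a)
    (hin : ∑' l, ∫⁻ z in firstMark C.mark C.markEnd l,
      inWeight Δ l (pathProd P z l) (C.bits l z) ∂κ a ≤ 1)
    (hout : ∀ l, ∫⁻ U, outWeight Q l (C.cost l U) (C.out l U) ∂unif ≤ 14) :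
    ∫⁻ ω, ∑' N, 28⁻¹ ^ N * C.weight P Q Δ N ω ∂(κ a).prod unif ≤ 2 := by
  have hm := fun N => h.measurable_weight (Q := Q) (Δ := Δ) N
  rw [lintegral_tsum fun N => ((hm N).const_mul _).aemeasurable]
  calc _ ≤ ∑' N, (2⁻¹ : ℝ≥0∞) ^ N := by
        refine ENNReal.tsum_le_tsum fun N => ?_
        rw [lintegral_const_mul _ (hm N)]
        refine (mul_le_mul_right (h.lintegral_weight_le hin hout N) _).trans (le_of_eq ?_)
        rw [← mul_pow]
        congr 1
        rw [show (28 : ℝ≥0∞) = 2 * 14 by norm_num, ENNReal.mul_inv (by simp) (by simp), mul_assoc,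
          ENNReal.inv_mul_cancel (by simp) (by simp), mul_one]
    _ = 2 := by rw [ENNReal.tsum_geometric, ENNReal.one_sub_inv_two, inv_inv]

end BlockCode

namespace BlockCode

variable {S₁ S₂ : Type*} {C : BlockCode S₁ S₂} {P : Matrix S₁ S₁ ℝ} {Q : Matrix S₂ S₂ ℝ} {Δ : ℝ}
  {b : S₂} [Fintype S₁] [DecidableEq S₁] [Fintype S₂] [DecidableEq S₂]

lemma bitsOut_le_bitsIn (hP : IsStochastic P) (hQ : IsStochastic Q) (h0 : ∀ l U, C.out l U 0 = b)
    (h1 : ∀ l U, C.out l U l = b) {N : ℕ} {z : ℕ → S₁} {U : ℝ} {t J : ℕ} {hX hY c : ℝ}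
    (htT : t ≤ C.blockEnd N z) (hTJ : C.blockEnd N z ≤ t + J)
    (hpos : 0 < pathProd P z (C.blockEnd N z)) (hc : 0 < c) (hΔ : 0 < Δ)
    (hw : C.weight P Q Δ N (z, U) ≤ ENNReal.ofReal (28 ^ N * c))
    (hr : 2 * Real.log 28 ≤ Δ * C.markEnd)
    (hx : pathProd P z t ≤ Real.exp (-((hX - Δ) * t)))
    (hy : Real.exp (-((hY + Δ) * (t + J : ℕ))) ≤ pathProd Q (C.run z U) (t + J))
    (hgap : hX = hY + 5 * Δ) (ht : (hY + 3 * Δ) * J + 2 * Real.log c < Δ * t) :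
    C.bitsOut N z U ≤ C.bitsIn N z := by
  by_contra! hlt
  set T := C.blockEnd N z
  rw [weight_eq hP.1 hQ.1 h0 h1, ENNReal.ofReal_le_ofReal_iff (by positivity),
    Real.sqrt_le_left (by positivity)] at hw
  have hTpos : 0 < (2 : ℝ) ^ C.bitsIn N z * pathProd P z T := by positivity
  rw [div_le_iff₀ hTpos] at hw
  have e1 : (2 : ℝ) ^ C.bitsIn N z ≤ 2 ^ C.bitsOut N z U :=
    pow_le_pow_right₀ (by norm_num) hlt.le
  have e2 : Real.exp (-((hY + Δ) * (t + J : ℕ))) ≤ pathProd Q (C.run z U) T :=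
    hy.trans (pathProd_anti hQ _ hTJ)
  have e3 : Real.exp (-(Δ * (t + J : ℕ))) ≤ Real.exp (-(Δ * T)) := by
    have : (T : ℝ) ≤ (t + J : ℕ) := by exact_mod_cast hTJ
    gcongr
  have e4 : pathProd P z T ≤ Real.exp (-((hX - Δ) * t)) := (pathProd_anti hP z htT).trans hx
  have e5 : (28 ^ N * c) ^ 2 ≤ Real.exp (Δ * (t + J : ℕ) + 2 * Real.log c) := by
    have h28 : (28 : ℝ) = Real.exp (Real.log 28) := (Real.exp_log (by norm_num)).symm
    have hN : (N : ℝ) * C.markEnd ≤ (t + J : ℕ) := by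
      exact_mod_cast (mul_le_blockEnd N z).trans hTJ
    have hcc : c ^ 2 = Real.exp (2 * Real.log c) := by
      rw [two_mul, Real.exp_add, Real.exp_log hc, sq]
    rw [mul_pow, Real.exp_add, hcc]
    refine mul_le_mul_of_nonneg_right ?_ (Real.exp_pos _).le
    rw [h28, ← Real.exp_nat_mul, ← Real.exp_nat_mul]
    refine Real.exp_le_exp.2 ?_
    have := mul_le_mul_of_nonneg_left hr (Nat.cast_nonneg (α := ℝ) N)
    have := mul_le_mul_of_nonneg_left hN hΔ.le
    push_cast at *
    nlinarith
  have e6 : (2 : ℝ) ^ C.bitsIn N z * (Real.exp (-((hY + Δ) * (t + J : ℕ))) *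
      Real.exp (-(Δ * (t + J : ℕ)))) ≤ (2 : ℝ) ^ C.bitsIn N z *
        (Real.exp (Δ * (t + J : ℕ) + 2 * Real.log c) * Real.exp (-((hX - Δ) * t))) := by
    calc _ ≤ 2 ^ C.bitsOut N z U * (pathProd Q (C.run z U) T * Real.exp (-(Δ * T))) := by
          gcongr
          exact (Real.exp_pos _).le.trans e2
      _ ≤ (28 ^ N * c) ^ 2 * (2 ^ C.bitsIn N z * pathProd P z T) := by rw [← mul_assoc]; exact hw
      _ ≤ Real.exp (Δ * (t + J : ℕ) + 2 * Real.log c) *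
          (2 ^ C.bitsIn N z * Real.exp (-((hX - Δ) * t))) := by gcongr
      _ = _ := by ring
  rw [mul_le_mul_iff_right₀ (by positivity), ← Real.exp_add, ← Real.exp_add, Real.exp_le_exp] at e6
  subst hgap
  push_cast at e6
  nlinarith

/-- Inputs for which the output at time `t` depends on the initial seed. -/
def undetermined (C : BlockCode S₁ S₂) (t : ℕ) : Set (ℕ → S₁) :=
  {z | ∃ U ∈ Set.Ico (0 : ℝ) 1, ∃ U' ∈ Set.Ico (0 : ℝ) 1, C.run z U t ≠ C.run z U' t}

lemma IsLocal.notMem_undetermined (hC : C.IsLocal) {z : ℕ → S₁} {U : ℝ} {n t : ℕ}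
    (hU : U ∈ Set.Ico (0 : ℝ) 1) (hg : C.AllGood (n + 1) z U) (h1 : C.blockEnd n z ≤ t)
    (h2 : t < C.blockEnd (n + 1) z) (hb : C.bitsOut (n + 1) z U ≤ C.bitsIn (n + 1) z) :
    z ∉ C.undetermined t := by
  have key : ∀ U' ∈ Set.Ico (0 : ℝ) 1, C.run z U' t = C.run z U t := fun U' hU' => by
    refine hC.run_eq_run (D := 0) hU hU' ?_ hg h1 h2 (by omega)
    rw [pow_zero, one_mul, one_mul, Nat.floor_eq_zero.2 hU.2, Nat.floor_eq_zero.2 hU'.2]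
  rintro ⟨U₁, hU₁, U₂, hU₂, hne⟩
  exact hne ((key U₁ hU₁).trans (key U₂ hU₂).symm)

variable [MeasurableSpace S₁] [MeasurableSpace S₂]
  [DiscreteMeasurableSpace S₁] [DiscreteMeasurableSpace S₂]
  {κ : S₁ → Measure (ℕ → S₁)} {a : S₁} {κ' : S₂ → Measure (ℕ → S₂)}

/-- The output at late times does not depend on the initial seed, with high probability. -/
theorem IsCoding.tendsto_undetermined (h : C.IsCoding P κ a) (hP : IsStochastic P)
    (hQ : IsStochastic Q) (h0 : ∀ l U, C.out l U 0 = b) (h1 : ∀ l U, C.out l U l = b) (hΔ : 0 < Δ)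
    (hr : 2 * Real.log 28 ≤ Δ * C.markEnd)
    (hin : ∑' l, ∫⁻ z in firstMark C.mark C.markEnd l,
      inWeight Δ l (pathProd P z l) (C.bits l z) ∂κ a ≤ 1)
    (hout : ∀ l, ∫⁻ U, outWeight Q l (C.cost l U) (C.out l U) ∂unif ≤ 14)
    (hrun : ∀ K u, (κ a).prod unif {ω | C.run ω.1 ω.2 ∈ cyl K u} ≤ κ' b (cyl K u))
    (hJ : ∀ ε : ℝ≥0∞, 0 < ε → ∃ J, ∀ i, κ i (noMark C.mark C.markEnd J) ≤ ε)
    {hX hY : ℝ} (hgap : hX = hY + 5 * Δ)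
    (hx : Tendsto (fun n : ℕ => κ a {z | ¬ (Real.exp (-((hX + Δ) * n)) ≤ pathProd P z n ∧
      pathProd P z n ≤ Real.exp (-((hX - Δ) * n)))}) atTop (nhds 0))
    (hy : Tendsto (fun n : ℕ => κ' b {z | ¬ (Real.exp (-((hY + Δ) * n)) ≤ pathProd Q z n ∧
      pathProd Q z n ≤ Real.exp (-((hY - Δ) * n)))}) atTop (nhds 0)) :
    Tendsto (fun t => κ a (C.undetermined t)) atTop (nhds 0) := by
  have := h.isProbabilityMeasure
  set lam := (κ a).prod unif
  rw [ENNReal.tendsto_atTop_zero]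
  intro ε₀ hε₀
  obtain ⟨ε, hε, hεε₀⟩ : ∃ ε : ℝ, 0 < ε ∧ 4 * ENNReal.ofReal ε ≤ ε₀ := by
    rcases eq_or_ne ε₀ ⊤ with rfl | htop
    · exact ⟨1, one_pos, le_top⟩
    · refine ⟨ε₀.toReal / 4, div_pos (ENNReal.toReal_pos hε₀.ne' htop) (by norm_num), ?_⟩
      rw [show (4 : ℝ≥0∞) = ENNReal.ofReal 4 by simp, ← ENNReal.ofReal_mul (by norm_num),
        mul_div_cancel₀ _ (by norm_num), ENNReal.ofReal_toReal htop]
  have hε' : (0 : ℝ≥0∞) < ENNReal.ofReal ε := ENNReal.ofReal_pos.2 hε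
  obtain ⟨J, hJ⟩ := hJ _ hε'
  obtain ⟨tx, htx⟩ := ENNReal.tendsto_atTop_zero.1 hx _ hε'
  obtain ⟨ty, hty⟩ := ENNReal.tendsto_atTop_zero.1 hy _ hε'
  obtain ⟨tz, htz⟩ := exists_nat_gt (((hY + 3 * Δ) * J + 2 * Real.log (2 / ε)) / Δ)
  refine ⟨max tx (max ty tz), fun t ht => le_trans ?_ hεε₀⟩
  have ht1 : tx ≤ t := (le_max_left _ _).trans ht
  have ht2 : ty ≤ t := ((le_max_left _ _).trans (le_max_right _ _)).trans ht
  have ht3 : tz ≤ t := ((le_max_right _ _).trans (le_max_right _ _)).trans ht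
  have htt : (hY + 3 * Δ) * J + 2 * Real.log (2 / ε) < Δ * t := by
    rw [div_lt_iff₀ hΔ] at htz
    have : (tz : ℝ) ≤ t := by exact_mod_cast ht3
    nlinarith
  let Z : (ℕ → S₁) × ℝ → ℝ≥0∞ := fun ω => ∑' N, 28⁻¹ ^ N * C.weight P Q Δ N ω
  have hZm : Measurable Z :=
    Measurable.tsum fun N => (h.measurable_weight (Q := Q) (Δ := Δ) N).const_mul _
  let A1 : Set ((ℕ → S₁) × ℝ) := {ω | ENNReal.ofReal (2 / ε) ≤ Z ω}
  let B2 : Set (ℕ → S₁) := {z | ¬ (Real.exp (-((hX + Δ) * t)) ≤ pathProd P z t ∧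
      pathProd P z t ≤ Real.exp (-((hX - Δ) * t)))}
  let B3 : Set (ℕ → S₂) := {y | ¬ (Real.exp (-((hY + Δ) * (t + J : ℕ))) ≤ pathProd Q y (t + J) ∧
      pathProd Q y (t + J) ≤ Real.exp (-((hY - Δ) * (t + J : ℕ))))}
  let A3 : Set ((ℕ → S₁) × ℝ) := {ω | C.run ω.1 ω.2 ∈ B3}
  let B4 : Set (ℕ → S₁) := drop t ⁻¹' noMark C.mark C.markEnd J
  have m1 : lam A1 ≤ ENNReal.ofReal ε := by
    have h2 := (mul_meas_ge_le_lintegral (μ := lam) hZm (ENNReal.ofReal (2 / ε))).trans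
      (h.lintegral_tsum_weight_le hin hout)
    have hne : ENNReal.ofReal (2 / ε) ≠ 0 := (ENNReal.ofReal_pos.2 (by positivity)).ne'
    refine (ENNReal.mul_le_mul_iff_right hne ENNReal.ofReal_ne_top).1 (h2.trans (le_of_eq ?_))
    rw [← ENNReal.ofReal_mul (by positivity), div_mul_cancel₀ _ hε.ne']
    simp
  have m2 : lam (B2 ×ˢ Set.univ) ≤ ENNReal.ofReal ε := by
    rw [Measure.prod_prod, measure_univ, mul_one]
    exact htx t ht1
  have m3 : lam A3 ≤ ENNReal.ofReal ε := by
    refine (h.measure_run_le_of_window hrun (K := t + J) ?_).trans (hty (t + J) (by omega))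
    intro x y hxy hx
    change ¬ _
    rw [← pathProd_congr Q hxy]
    exact hx
  have m4 : lam (B4 ×ˢ Set.univ) ≤ ENNReal.ofReal ε := by
    rw [Measure.prod_prod, measure_univ, mul_one]
    exact noMark_drop_le hP h.chain (single_one_nonneg a) (by simp) (h.chain a) hJ t
  have hae : ∀ᵐ ω ∂lam, ω ∈ C.undetermined t ×ˢ (Set.univ : Set ℝ) →
      ω ∈ (A1 ∪ B2 ×ˢ Set.univ) ∪ (A3 ∪ B4 ×ˢ Set.univ) := by
    have hpos : ∀ᵐ z ∂κ a, ∀ n, 0 < pathProd P z n :=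
      ae_all_iff.2 fun n => IsMC.ae_pathProd_pos hP.1 (h.chain a) n
    filter_upwards [h.ae_allGood, Measure.quasiMeasurePreserving_fst.ae hpos,
      Measure.quasiMeasurePreserving_snd.ae ae_unif_mem] with ω hg hp hU hω
    obtain ⟨z, U⟩ := ω
    by_contra hnot
    simp only [Set.mem_union, not_or] at hnot
    obtain ⟨⟨n1, n2⟩, n3, n4⟩ := hnot
    have n2' : pathProd P z t ≤ Real.exp (-((hX - Δ) * t)) := by
      by_contra hcon
      exact n2 ⟨fun hh => hcon hh.2, trivial⟩
    have n3' : Real.exp (-((hY + Δ) * (t + J : ℕ))) ≤ pathProd Q (C.run z U) (t + J) := by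
      by_contra hcon
      exact n3 fun hh => hcon hh.1
    obtain ⟨s, hsJ, hs⟩ : ∃ s, s + C.markEnd ≤ J ∧ MarkAt C.mark C.markEnd z (t + s) := by
      by_contra! hcon
      refine n4 ⟨fun s hs hm => hcon s hs ?_, trivial⟩
      exact (markAt_drop _ _ _).1 hm
    obtain ⟨n, hn1, hn2⟩ := exists_block (C := C) z t
    have hpm := C.markEnd_pos
    have hn3 := h.blockEnd_succ_le hs (by omega) hn1
    refine h.notMem_undetermined hU (hg (n + 1)) hn1 hn2 ?_ hω.1
    have hn4 : C.blockEnd (n + 1) z ≤ t + J := by omega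
    refine bitsOut_le_bitsIn hP hQ h0 h1 (t := t) (J := J) (c := 2 / ε) hn2.le hn4 (hp _)
      (by positivity) hΔ ?_ hr n2' n3' hgap htt
    have hZ : Z (z, U) < ENNReal.ofReal (2 / ε) := not_le.1 n1
    have h28 : (28⁻¹ : ℝ≥0∞) ^ (n + 1) * C.weight P Q Δ (n + 1) (z, U) ≤ ENNReal.ofReal (2 / ε) :=
      (ENNReal.le_tsum (f := fun N => 28⁻¹ ^ N * C.weight P Q Δ N (z, U)) (n + 1)).trans hZ.le
    rw [ENNReal.ofReal_mul (by positivity), ENNReal.ofReal_pow (by norm_num),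
      show ENNReal.ofReal 28 = 28 by simp]
    calc _ = (28 : ℝ≥0∞) ^ (n + 1) * (28⁻¹ ^ (n + 1) * C.weight P Q Δ (n + 1) (z, U)) := by
          rw [← mul_assoc, ← mul_pow, ENNReal.mul_inv_cancel (by simp) (by simp), one_pow, one_mul]
      _ ≤ _ := by gcongr
  calc κ a (C.undetermined t) = lam (C.undetermined t ×ˢ Set.univ) := by
        rw [Measure.prod_prod, measure_univ, mul_one]
    _ ≤ lam ((A1 ∪ B2 ×ˢ Set.univ) ∪ (A3 ∪ B4 ×ˢ Set.univ)) := measure_mono_ae hae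
    _ ≤ (ENNReal.ofReal ε + ENNReal.ofReal ε) + (ENNReal.ofReal ε + ENNReal.ofReal ε) :=
        (measure_union_le _ _).trans (add_le_add ((measure_union_le _ _).trans (add_le_add m1 m2))
          ((measure_union_le _ _).trans (add_le_add m3 m4)))
    _ = 4 * ENNReal.ofReal ε := by ring

end BlockCode

/-! ### Construction of the block code -/

namespace BlockCode

section Input

variable {S : Type*} [Fintype S] [MeasurableSpace S] [DiscreteMeasurableSpace S] [DecidableEq S]
  {P : Matrix S S ℝ} {α : Measure (ℕ → S)} {a : S}

open Classical in
/-- The words on `[0, l]` starting from `a` in the set `F`. -/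
def wordsIn (a : S) (F : Set (ℕ → S)) (l : ℕ) : Finset (Fin (l + 1) → S) :=
  Finset.univ.filter fun w => wordExt w 0 = a ∧ wordExt w ∈ F

lemma setLIntegral_eq_sum_wordsIn (hα : IsChainFrom P a α) {l : ℕ} {F : Set (ℕ → S)}
    (hF : DependsOnWindow (Set.Iic l) F) {H : (ℕ → S) → ℝ≥0∞}
    (hH : ∀ x y, (∀ k ≤ l, x k = y k) → H x = H y) :
    ∫⁻ z in F, H z ∂α
      = ∑ w ∈ wordsIn a F l, H (wordExt w) * ENNReal.ofReal (pathProd P (wordExt w) l) := by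
  classical
  rw [← lintegral_indicator (hF.measurableSet (Set.finite_Iic l)), lintegral_eq_sum_words α l,
    wordsIn, Finset.sum_filter]
  refine Finset.sum_congr rfl fun w _ => ?_
  set u := wordExt w
  have h1 : ∀ z ∈ cyl l u, F.indicator H z = F.indicator H u := fun z hz => by
    by_cases hu : u ∈ F
    · rw [Set.indicator_of_mem hu, Set.indicator_of_mem ((hF.iff hz).2 hu), hH z u hz]
    · rw [Set.indicator_of_notMem hu, Set.indicator_of_notMem fun hz' => hu ((hF.iff hz).1 hz')]
  rw [setLIntegral_congr_fun (measurableSet_cyl l u) h1, setLIntegral_const]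
  by_cases ha : u 0 = a
  · rw [hα.cyl_self l ha]
    by_cases hu : u ∈ F
    · rw [if_pos ⟨ha, hu⟩, Set.indicator_of_mem hu]
    · rw [if_neg fun hh => hu hh.2, Set.indicator_of_notMem hu, zero_mul]
  · rw [if_neg fun hh => ha hh.1, hα l u, Pi.single_eq_of_ne ha]
    simp

/-- The bound for the input side of the balance. -/
def inBound (S : Type*) [Fintype S] (Δ : ℝ) (l : ℕ) : ℝ :=
  (l + 1 : ℝ) ^ (Fintype.card S ^ 2) * (Fintype.card S * (l + 1)) * Real.exp (-(Δ * l))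

/-- Extraction of random bits from the words in `F`. -/
lemma exists_extraction (hP : ∀ i j, 0 ≤ P i j) (hα : IsChainFrom P a α) {l : ℕ}
    {F : Set (ℕ → S)} (hF : DependsOnWindow (Set.Iic l) F) (Δ : ℝ) :
    ∃ bits index : (ℕ → S) → ℕ,
      (∀ z z', (∀ k ≤ l, z k = z' k) → bits z = bits z') ∧
      (∀ z z', (∀ k ≤ l, z k = z' k) → index z = index z') ∧
      (∀ z, index z < 2 ^ bits z) ∧
      (∀ (g : ℝ → ℕ → ℝ≥0∞) (H : ℝ → ℝ≥0∞), Measurable H →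
        ∫⁻ z in F, g (pathProd P z l) (bits z) *
          ∫⁻ U, H ((index z + U) / 2 ^ bits z) ∂unif ∂α
        = (∫⁻ z in F, g (pathProd P z l) (bits z) ∂α) * ∫⁻ U, H U ∂unif) ∧
      ∫⁻ z in F, inWeight Δ l (pathProd P z l) (bits z) ∂α
        ≤ (α F + ENNReal.ofReal (inBound S Δ l)) / 2 := by
  classical
  set T := wordsIn a F l
  set f : (Fin (l + 1) → S) → ℝ := fun w => pathProd P (wordExt w) l
  have hf : ∀ w, 0 ≤ f w := fun w => pathProd_nonneg hP _ _
  have hT : T.card < 2 ^ (Fintype.card S * (l + 1)) := by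
    refine (Finset.card_le_univ T).trans_lt ?_
    rw [Fintype.card_fun, Fintype.card_fin, pow_mul]
    exact Nat.pow_lt_pow_left Nat.lt_two_pow_self (by omega)
  obtain ⟨nb, ix, hD, hnb⟩ := exists_isDyadicIndex T f hT
  have hres : ∀ w : Fin (l + 1) → S, wordRes l (wordExt w) = w := fun w =>
    wordRes_eq_iff.2 fun k _ => rfl
  have hc : ∀ {z z' : ℕ → S}, (∀ k ≤ l, z k = z' k) → wordRes l z = wordRes l z' :=
    fun h => wordRes_congr h
  have hpc : ∀ {z z' : ℕ → S}, (∀ k ≤ l, z k = z' k) → pathProd P z l = pathProd P z' l :=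
    fun h => pathProd_congr P h
  refine ⟨fun z => if wordRes l z ∈ T then nb (wordRes l z) else 0,
    fun z => if wordRes l z ∈ T then ix (wordRes l z) else 0,
    fun z z' h => by simp only [hc h], fun z z' h => by simp only [hc h], fun z => ?_,
    fun g H hH => ?_, ?_⟩
  · by_cases hz : wordRes l z ∈ T
    · simpa [hz] using (hD _ hz).1
    · simp [hz]
  · rw [setLIntegral_eq_sum_wordsIn hα hF fun x y h => by simp only [hc h, hpc h],
      setLIntegral_eq_sum_wordsIn hα hF fun x y h => by simp only [hc h, hpc h]]
    have := hD.sum_lintegral (fun q n => g q n * ENNReal.ofReal q) hH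
    calc _ = ∑ w ∈ T, g (f w) (nb w) * ENNReal.ofReal (f w) *
          ∫⁻ U, H ((ix w + U) / 2 ^ nb w) ∂unif := by
          refine Finset.sum_congr rfl fun w hw => ?_
          simp only [hres, if_pos hw]
          ring
      _ = _ := this
      _ = _ := by
          congr 1
          refine Finset.sum_congr rfl fun w hw => ?_
          simp only [hres, if_pos (show w ∈ T from hw)]
          rfl
  · rw [setLIntegral_eq_sum_wordsIn hα hF fun x y h => by simp only [hc h, hpc h]]
    have hθ : 0 ≤ Real.exp (-(Δ * l)) := (Real.exp_pos _).le
    have h1 := hD.sum_sqrt_le hf hθ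
    have hαF : α F = ∑ w ∈ T, ENNReal.ofReal (f w) := by
      have := setLIntegral_eq_sum_wordsIn hα hF (H := fun _ => 1) fun _ _ _ => rfl
      simpa using this
    have hN : ((dyadicPieces T f nb).card : ℝ) * Real.exp (-(Δ * l)) ≤ inBound S Δ l := by
      refine mul_le_mul_of_nonneg_right ?_ hθ
      have := card_dyadicPieces_le (card_image_pathProd_le P l T wordExt) hnb
      exact_mod_cast this
    have hB : 0 ≤ inBound S Δ l := by unfold inBound; positivity
    calc _ = ∑ w ∈ T, ENNReal.ofReal √(f w * Real.exp (-(Δ * l)) / 2 ^ nb w) := by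
          refine Finset.sum_congr rfl fun w hw => ?_
          simp only [hres, if_pos hw, inWeight]
          rw [← ENNReal.ofReal_mul (Real.sqrt_nonneg _)]
          congr 1
          change √(Real.exp (-(Δ * l)) / (2 ^ nb w * f w)) * f w = _
          rcases (hf w).eq_or_lt with h0 | h0
          · rw [← h0]; simp
          · nth_rewrite 2 [← Real.sqrt_sq (hf w)]
            rw [← Real.sqrt_mul' _ (by positivity)]
            congr 1
            field_simp
      _ = ENNReal.ofReal (∑ w ∈ T, √(f w * Real.exp (-(Δ * l)) / 2 ^ nb w)) :=
          (ENNReal.ofReal_sum_of_nonneg fun _ _ => Real.sqrt_nonneg _).symm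
      _ ≤ ENNReal.ofReal ((∑ w ∈ T, f w + inBound S Δ l) / 2) :=
          ENNReal.ofReal_le_ofReal (h1.trans (by linarith))
      _ = _ := by
          rw [ENNReal.ofReal_div_of_pos (by norm_num), ENNReal.ofReal_add
            (Finset.sum_nonneg fun w _ => hf w) hB, ENNReal.ofReal_sum_of_nonneg fun w _ => hf w,
            hαF, ENNReal.ofReal_ofNat]

end Input

section Output

variable {S : Type*} [Fintype S] [MeasurableSpace S] [DiscreteMeasurableSpace S] [DecidableEq S]
  {Q : Matrix S S ℝ} {β : Measure (ℕ → S)} {b : S}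

/-- The output block of length `l` spelled by a word. -/
def blockOf (b : S) {l : ℕ} (v : Fin (l + 1) → S) (t : ℕ) : S :=
  if 0 < t ∧ t < l then wordExt v t else b

lemma blockOf_eq {l : ℕ} {v : Fin (l + 1) → S} (h0 : wordExt v 0 = b) (hl : wordExt v l = b)
    {t : ℕ} (ht : t ≤ l) : blockOf b v t = wordExt v t := by
  unfold blockOf
  split_ifs with h
  · rfl
  · have : t = 0 ∨ t = l := by omega
    rcases this with rfl | rfl
    · exact h0.symm
    · exact hl.symm

/-- The law of the output block of length `l`. -/
lemma exists_blockLaw (hβ : IsChainFrom Q b β) {f : ℕ → ℝ≥0∞} {l : ℕ} {ρ : ℝ} (hρ : 0 ≤ ρ)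
    (hst : 0 < l → ∫⁻ y, stopWeight f b l y ∂β = ENNReal.ofReal ρ) :
    ∃ q : (Fin (l + 1) → S) → ℝ, (∀ v, 0 ≤ q v) ∧ ∑ v, q v = 1 ∧
      (∀ v, q v ≠ 0 → wordExt v 0 = b ∧ wordExt v l = b) ∧
      (0 < l → ∀ v, ENNReal.ofReal ρ * ENNReal.ofReal (q v)
        ≤ ∫⁻ y in cyl l (wordExt v), stopWeight f b l y ∂β) := by
  classical
  by_cases hl : 0 < l ∧ 0 < ρ
  · obtain ⟨hl, hρ'⟩ := hl
    set σ : (Fin (l + 1) → S) → ℝ≥0∞ := fun v => ∫⁻ y in cyl l (wordExt v), stopWeight f b l y ∂β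
    have hsum : ∑ v, σ v = ENNReal.ofReal ρ := by
      rw [← hst hl, lintegral_eq_sum_words β l]
    have hfin : ∀ v, σ v ≠ ⊤ := fun v =>
      ((Finset.single_le_sum (f := σ) (fun _ _ => bot_le) (Finset.mem_univ v)).trans_lt
        (hsum ▸ ENNReal.ofReal_lt_top)).ne
    refine ⟨fun v => (σ v).toReal / ρ, fun v => by positivity, ?_, fun v hv => ?_, fun _ v => ?_⟩
    · rw [← Finset.sum_div, ← ENNReal.toReal_sum fun v _ => hfin v, hsum,
        ENNReal.toReal_ofReal hρ, div_self hρ'.ne']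
    · have hσ : σ v ≠ 0 := fun h0 => hv (by simp [h0])
      constructor
      · by_contra hne
        refine hσ (setLIntegral_measure_zero _ _ ?_)
        rw [hβ l, Pi.single_eq_of_ne hne]
        simp
      · by_contra hne
        refine hσ ?_
        rw [show σ v = ∫⁻ y in cyl l (wordExt v), 0 ∂β from
          setLIntegral_congr_fun (measurableSet_cyl _ _) fun y hy =>
            stopWeight_of_ne f (by rw [hy l (Set.mem_Iic.2 le_rfl)]; exact hne)]
        simp
    · rw [← ENNReal.ofReal_mul hρ, mul_div_cancel₀ _ hρ'.ne', ENNReal.ofReal_toReal (hfin v)]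
  · refine ⟨Pi.single (fun _ => b) 1, single_one_nonneg _, by simp, fun v hv => ?_,
      fun hl' v => ?_⟩
    · have : v = fun _ => b := by
        by_contra hne
        exact hv (Pi.single_eq_of_ne hne _)
      subst this
      exact ⟨rfl, rfl⟩
    · have : ρ = 0 := by
        rcases hρ.eq_or_lt with h | h
        · exact h.symm
        · exact absurd ⟨hl', h⟩ hl
      simp [this]

/-- Production of the output block of length `l`. -/
lemma exists_production (hQ : IsStochastic Q) (hβ : IsChainFrom Q b β) {f : ℕ → ℝ≥0∞} {l : ℕ}
    {ρ : ℝ} (hρ : 0 ≤ ρ) (hst : 0 < l → ∫⁻ y, stopWeight f b l y ∂β = ENNReal.ofReal ρ) :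
    ∃ (cost : ℝ → ℕ) (out : ℝ → ℕ → S) (good : Set ℝ),
      (∀ U, out U 0 = b) ∧ (∀ U, out U l = b) ∧
      (∀ U U', U ∈ good → U' ∈ Set.Ico (0 : ℝ) 1 →
        ⌊2 ^ cost U * U⌋₊ = ⌊2 ^ cost U * U'⌋₊ → cost U' = cost U ∧ out U' = out U) ∧
      (∀ G : ℕ → (ℕ → S) → ℝ≥0∞, Measurable fun U => G (cost U) (out U)) ∧
      (∀ᵐ U ∂unif, U ∈ good) ∧
      (∀ (G : ℕ → (ℕ → S) → ℝ≥0∞) (e : ℝ → ℝ≥0∞), Measurable e →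
        ∫⁻ U, G (cost U) (out U) * e (Int.fract (2 ^ cost U * U)) ∂unif
          = (∫⁻ U, G (cost U) (out U) ∂unif) * ∫⁻ U, e U ∂unif) ∧
      ∫⁻ U, outWeight Q l (cost U) (out U) ∂unif ≤ 14 ∧
      (∀ K u, K < l → ENNReal.ofReal ρ * unif {U | out U ∈ cyl K u}
        ≤ ∫⁻ y in cyl K u, stopWeight f b l y ∂β) := by
  classical
  obtain ⟨q, hq, hq1, hqb, hqσ⟩ := exists_blockLaw hβ hρ hst
  have : Nonempty (Fin (l + 1) → S) := ⟨fun _ => b⟩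
  obtain ⟨c, pick, good, hg⟩ := exists_generator q hq hq1
  have hpm : ∀ v, MeasurableSet (pick ⁻¹' {v}) := fun v => hg.measurableSet_pick _
  refine ⟨c, fun U => blockOf b (pick U), good, fun U => by simp [blockOf],
    fun U => by simp [blockOf], fun U U' hU hU' hfl => ?_, fun G => ?_, hg.ae_good,
    fun G e he => hg.lintegral_mul (fun n v => G n (blockOf b v)) he, ?_, fun K u hK => ?_⟩
  · obtain ⟨-, h2, h3⟩ := hg.stable U hU U' hU' hfl
    exact ⟨h2, congrArg (blockOf b) h3⟩
  · let _ : MeasurableSpace (Fin (l + 1) → S) := ⊤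
    have hp : Measurable pick := fun A _ => hg.measurableSet_pick A
    exact (measurable_of_countable fun y : ℕ × (Fin (l + 1) → S) => G y.1 (blockOf b y.2)).comp
      (hg.measurable_cost.prodMk hp)
  · set k : (Fin (l + 1) → S) → ℝ := fun v => pathProd Q (blockOf b v) l
    have hk : ∀ v, 0 ≤ k v := fun v => pathProd_nonneg hQ.1 _ _
    have hone : ∀ v, ∫⁻ U in pick ⁻¹' {v}, outWeight Q l (c U) (blockOf b (pick U)) ∂unif
        ≤ ENNReal.ofReal (14 * √(q v * k v)) := fun v => by
      have hm : Measurable fun U => ENNReal.ofReal √(2 ^ c U) :=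
        (measurable_of_countable fun n : ℕ => ENNReal.ofReal √(2 ^ n)).comp hg.measurable_cost
      calc _ = ∫⁻ U in pick ⁻¹' {v}, ENNReal.ofReal √(k v) * ENNReal.ofReal √(2 ^ c U) ∂unif := by
            refine setLIntegral_congr_fun (hpm v) fun U hU => ?_
            have hU' : pick U = v := hU
            rw [hU', outWeight, Real.sqrt_mul (by positivity),
              ENNReal.ofReal_mul (Real.sqrt_nonneg _), mul_comm]
        _ = ENNReal.ofReal √(k v) * ∫⁻ U in pick ⁻¹' {v}, ENNReal.ofReal √(2 ^ c U) ∂unif :=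
            lintegral_const_mul _ hm
        _ ≤ ENNReal.ofReal √(k v) * ENNReal.ofReal (14 * √(q v)) := by
            gcongr
            exact hg.cost_le v
        _ = _ := by
            rw [← ENNReal.ofReal_mul (Real.sqrt_nonneg _), Real.sqrt_mul (hq v)]
            congr 1
            ring
    have hksum : ∑ v ∈ Finset.univ.filter (fun v => q v ≠ 0), k v ≤ 1 := by
      have : IsProbabilityMeasure β := hβ.isProbabilityMeasure
      have h1 := lintegral_eq_sum_words β l (fun _ => 1)
      simp only [lintegral_one, Measure.restrict_apply_univ, measure_univ] at h1
      rw [← ENNReal.ofReal_le_ofReal_iff zero_le_one, ENNReal.ofReal_one,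
        ENNReal.ofReal_sum_of_nonneg fun v _ => hk v, h1]
      refine le_trans (Finset.sum_le_sum fun v hv => ?_)
        (Finset.sum_le_univ_sum_of_nonneg fun _ => bot_le)
      obtain ⟨e0, el⟩ := hqb v (Finset.mem_filter.1 hv).2
      rw [hβ.cyl_self l e0]
      exact (congrArg ENNReal.ofReal (pathProd_congr Q fun t ht => blockOf_eq e0 el ht)).le
    have hs : ∑ v, √(q v * k v) ≤ 1 := by
      calc ∑ v, √(q v * k v) = ∑ v ∈ Finset.univ.filter (fun v => q v ≠ 0), √(q v * k v) := by
            rw [Finset.sum_filter]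
            refine Finset.sum_congr rfl fun v _ => ?_
            by_cases h0 : q v = 0 <;> simp [h0]
        _ ≤ ∑ v ∈ Finset.univ.filter (fun v => q v ≠ 0), (q v + k v) / 2 := by
            refine Finset.sum_le_sum fun v _ => ?_
            refine Real.sqrt_le_iff.2 ⟨by linarith [hq v, hk v], ?_⟩
            nlinarith [sq_nonneg (q v - k v)]
        _ ≤ 1 := by
            rw [← Finset.sum_div, Finset.sum_add_distrib]
            have : ∑ v ∈ Finset.univ.filter (fun v => q v ≠ 0), q v ≤ 1 :=
              hq1 ▸ Finset.sum_le_univ_sum_of_nonneg hq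
            linarith
    rw [lintegral_eq_sum_fiber unif hpm]
    calc _ ≤ ∑ v, ENNReal.ofReal (14 * √(q v * k v)) := Finset.sum_le_sum fun v _ => hone v
      _ = ENNReal.ofReal (14 * ∑ v, √(q v * k v)) := by
          rw [Finset.mul_sum, ENNReal.ofReal_sum_of_nonneg fun v _ => by positivity]
      _ ≤ ENNReal.ofReal 14 := ENNReal.ofReal_le_ofReal (by linarith)
      _ = 14 := by simp
  · set T := Finset.univ.filter fun v : Fin (l + 1) → S => blockOf b v ∈ cyl K u
    have h1 : unif {U | blockOf b (pick U) ∈ cyl K u} ≤ ∑ v ∈ T, ENNReal.ofReal (q v) := by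
      calc _ ≤ unif (⋃ v ∈ T, pick ⁻¹' {v}) := measure_mono fun U hU =>
            Set.mem_biUnion (x := pick U) (by simpa [T] using hU) rfl
        _ ≤ ∑ v ∈ T, unif (pick ⁻¹' {v}) := measure_biUnion_finset_le _ _
        _ ≤ _ := Finset.sum_le_sum fun v _ => hg.pick_le v
    refine (mul_le_mul_right h1 _).trans ?_
    have hcm := measurableSet_cyl (S := S) K u
    rw [Finset.mul_sum, ← lintegral_indicator hcm, lintegral_eq_sum_words β l]
    refine le_trans (Finset.sum_le_sum fun v hv => ?_)
      (Finset.sum_le_univ_sum_of_nonneg fun _ => bot_le)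
    by_cases h0 : q v = 0
    · simp [h0]
    obtain ⟨e0, el⟩ := hqb v h0
    refine (hqσ (by omega) v).trans (le_of_eq ?_)
    refine setLIntegral_congr_fun (measurableSet_cyl _ _) fun y hy => ?_
    have hyK : y ∈ cyl K u := fun t ht => by
      have htl : t ≤ l := (Set.mem_Iic.1 ht).trans hK.le
      rw [hy t htl, ← blockOf_eq e0 el htl]
      exact (Finset.mem_filter.1 hv).2 t ht
    rw [Set.indicator_of_mem hyK]

end Output

end BlockCode

namespace BlockCode

lemma exists_tsum_inBound_le (S : Type*) [Fintype S] {Δ : ℝ} (hΔ : 0 < Δ) :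
    ∃ R, ∀ r ≥ R, ∑' l, ENNReal.ofReal (inBound S Δ (l + r)) ≤ 1 := by
  have h0 : ∀ l, 0 ≤ inBound S Δ l := fun l => by unfold inBound; positivity
  have hs : Summable (inBound S Δ) := by
    have h1 := (summable_nat_add_iff 1).2
      (Real.summable_pow_mul_exp_neg_nat_mul (Fintype.card S ^ 2 + 1) hΔ)
    refine (h1.mul_left (Fintype.card S * Real.exp Δ)).congr fun l => ?_
    have : Real.exp (-(Δ * l)) = Real.exp Δ * Real.exp (-Δ * (l + 1 : ℕ)) := by
      rw [← Real.exp_add]; congr 1; push_cast; ring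
    rw [inBound, this]
    push_cast
    ring
  have ht := ENNReal.tendsto_sum_nat_add (fun l => ENNReal.ofReal (inBound S Δ l))
    (by rw [← ENNReal.ofReal_tsum_of_nonneg h0 hs]; exact ENNReal.ofReal_ne_top)
  exact ENNReal.tendsto_atTop_zero.1 ht 1 one_pos

end BlockCode

lemma IsPrimitive.exists_pow_ge {S : Type*} [Fintype S] [DecidableEq S] {Q : Matrix S S ℝ}
    (hQ : IsStochastic Q) (h : IsPrimitive Q) :
    ∃ n η, 0 < n ∧ 0 < η ∧ ∀ i j, η ≤ (Q ^ n) i j := by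
  obtain ⟨n, hn⟩ := h
  have hpos : ∀ i j, 0 < (Q ^ (n + 1)) i j := fun i j => by
    rw [pow_succ', Matrix.mul_apply]
    by_contra! hcon
    have hz := (Finset.sum_eq_zero_iff_of_nonneg
      (fun k _ => mul_nonneg (hQ.1 i k) (hn k j).le)).1
        (le_antisymm hcon (Finset.sum_nonneg fun k _ => mul_nonneg (hQ.1 i k) (hn k j).le))
    have : ∑ k, Q i k = 0 := Finset.sum_eq_zero fun k hk =>
      (mul_eq_zero.1 (hz k hk)).resolve_right (hn k j).ne'
    linarith [hQ.2 i]
  rcases isEmpty_or_nonempty S with hS | hS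
  · exact ⟨1, 1, one_pos, one_pos, fun i => isEmptyElim i⟩
  · obtain ⟨y, hy⟩ := Finite.exists_min fun y : S × S => (Q ^ (n + 1)) y.1 y.2
    exact ⟨n + 1, _, n.succ_pos, hpos y.1 y.2, fun i j => hy (i, j)⟩

namespace BlockCode

variable {S₁ S₂ : Type*} [Fintype S₁] [DecidableEq S₁] [Fintype S₂] [DecidableEq S₂]
  [MeasurableSpace S₁] [DiscreteMeasurableSpace S₁]
  [MeasurableSpace S₂] [DiscreteMeasurableSpace S₂]
  {P : Matrix S₁ S₁ ℝ} {Q : Matrix S₂ S₂ ℝ} {p₁ : S₁ → ℝ} {p₂ : S₂ → ℝ}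
  {κ : S₁ → Measure (ℕ → S₁)} {κ' : S₂ → Measure (ℕ → S₂)}

/-- Existence of a block code whose output has the law of the target chain and is eventually
determined by the input. -/
theorem exists_coding (hP : IsStochastic P) (hPirr : IsIrreducibleMat P)
    (hp₁ : IsStationaryVector P p₁) (hκ : ∀ i, IsChainFrom P i (κ i)) (hQ : IsStochastic Q)
    (hQprim : IsPrimitive Q) (hQirr : IsIrreducibleMat Q) (hp₂ : IsStationaryVector Q p₂)
    (hκ' : ∀ i, IsChainFrom Q i (κ' i)) (hH : markovEntropy Q p₂ < markovEntropy P p₁) (b : S₂) :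
    ∃ (C : BlockCode S₁ S₂) (a : S₁), IsMarker P a C.mark C.markEnd ∧ C.IsCoding P κ a ∧
      (∀ K u, (κ a).prod unif {ω | C.run ω.1 ω.2 ∈ cyl K u} ≤ κ' b (cyl K u)) ∧
      Tendsto (fun t => κ a (C.undetermined t)) atTop (nhds 0) := by
  have hpos : 0 < markovEntropy P p₁ := (markovEntropy_nonneg hQ hp₂.1).trans_lt hH
  obtain ⟨n₀, η, hn₀, hη, hηQ⟩ := hQprim.exists_pow_ge hQ
  obtain ⟨Δ, hΔ, hgap⟩ : ∃ Δ : ℝ, 0 < Δ ∧ markovEntropy P p₁ = markovEntropy Q p₂ + 5 * Δ :=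
    ⟨(markovEntropy P p₁ - markovEntropy Q p₂) / 5, by linarith, by ring⟩
  obtain ⟨R₁, hR₁⟩ := exists_tsum_inBound_le S₁ hΔ
  obtain ⟨R₂, hR₂⟩ := exists_nat_ge (2 * Real.log 28 / Δ)
  obtain ⟨a, ha⟩ := exists_isMarker hP hPirr hpos
  obtain ⟨m, r, hr, hpr, hM⟩ := ha (max n₀ (max R₁ R₂)) (min (1 / 4) (η / 2))
    (lt_min (by norm_num) (by positivity))
  have hr₀ : n₀ ≤ r := (le_max_left _ _).trans hr
  have hr₁ : R₁ ≤ r := ((le_max_left _ _).trans (le_max_right _ _)).trans hr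
  have hr₂ : R₂ ≤ r := ((le_max_right _ _).trans (le_max_right _ _)).trans hr
  have hprob : IsProbabilityMeasure (κ a) := (hκ a).isProbabilityMeasure
  set ρ : ℕ → ℝ := fun l => (κ a (firstMark m r l)).toReal
  set R : ℕ → ℝ := fun l => (κ a (noMark m r l)).toReal
  have hρ : ∀ l, ENNReal.ofReal (ρ l) = κ a (firstMark m r l) := fun l =>
    ENNReal.ofReal_toReal (measure_ne_top _ _)
  have hρ0 : ∀ l, 0 ≤ ρ l := fun l => ENNReal.toReal_nonneg
  have hR0 : ∀ l, 0 ≤ R l := fun l => ENNReal.toReal_nonneg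
  have hrec : ∀ n, R n = R (n + 1) + ρ (n + 1) := fun n => by
    change (κ a (noMark m r n)).toReal = _
    rw [noMark_eq_union n, measure_union (disjoint_noMark_firstMark _) (measurableSet_firstMark _),
      ENNReal.toReal_add (measure_ne_top _ _) (measure_ne_top _ _)]
  have hempty : ∀ n < r, firstMark m r n = ∅ := fun n hn =>
    Set.eq_empty_of_forall_notMem fun z hz => absurd hz.1 (by omega)
  have hlt : ∀ n < r, ρ n = 0 := fun n hn => by simp [ρ, hempty n hn]
  have hpp := hM.prob_pos.le
  have hle : ∀ n, ρ (n + r) ≤ R n * pathProd P m r := fun n => by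
    have h1 := hM.firstMark_le hP hκ a n
    have h2 := ENNReal.toReal_mono (ENNReal.mul_ne_top (measure_ne_top _ _)
      ENNReal.ofReal_ne_top) h1
    rwa [ENNReal.toReal_mul, ENNReal.toReal_ofReal hpp] at h2
  have hhaz := hazard_le hM.pos hR0 hρ0 hrec hlt hpp hle (hpr.trans (min_le_left _ _))
  have hδη : n₀ * (2 * pathProd P m r) ≤ η := by
    have h1 : (n₀ : ℝ) ≤ r := by exact_mod_cast hr₀
    have h2 := hpr.trans (min_le_right _ _)
    nlinarith
  have hmass := stopMass_nonneg (b := b) hQ (by simp [R, noMark_zero hM.pos]) hR0 hρ0 hrec hn₀ hr₀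
    hlt hηQ (by positivity) hhaz hδη
  obtain ⟨f, hf, hst⟩ := exists_stopping hQ hκ' hmass hρ0
  choose bits index hbits hindex hindex_lt hseed hin using fun l =>
    exists_extraction hP.1 (hκ a) (dependsOnWindow_firstMark (m := m) (r := r) l) Δ
  choose cost out good h0 h1 hstable hmeas hgood hsplit hout hlaw using fun l =>
    exists_production hQ (hκ' b) (hρ0 l) (hst l)
  let C : BlockCode S₁ S₂ := ⟨m, r, hM.pos, bits, index, cost, out, good⟩
  have hC : C.IsCoding P κ a :=
    { bits_congr := hbits
      index_congr := hindex
      index_lt := hindex_lt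
      add_le := fun z s s' hs hs' hss => hM.add_le hs hs' hss
      stable := hstable
      measurable_block := hmeas
      ae_good := hgood
      lintegral_split := hsplit
      lintegral_seed := hseed
      nonneg := hP.1
      chain := hκ
      last := fun l z hz => hM.eq_last hz
      recurrent := hM.ae_mem_iUnion_firstMark hP hPirr hκ a }
  have hrun := hC.measure_run_le hQ.1 hκ' hf fun l K u hK => by
    rw [← hρ l]
    exact hlaw l K u hK
  refine ⟨C, a, hM, hC, hrun, hC.tendsto_undetermined hP hQ h0 h1 hΔ ?_ ?_ hout hrun
    (fun ε hε => hM.exists_noMark_le hP hPirr hκ hε) hgap (aep hP hPirr hp₁ hκ a hΔ)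
    (aep hQ hQirr hp₂ hκ' b hΔ)⟩
  · rw [div_le_iff₀ hΔ] at hR₂
    have : (R₂ : ℝ) ≤ r := by exact_mod_cast hr₂
    change 2 * Real.log 28 ≤ Δ * r
    nlinarith
  · have hsum : ∑' l, κ a (firstMark m r l) ≤ 1 := by
      rw [← measure_iUnion disjoint_firstMark fun l => measurableSet_firstMark l]
      exact prob_le_one
    set w : ℕ → ℝ≥0∞ := fun l => ∫⁻ z in firstMark C.mark C.markEnd l,
      inWeight Δ l (pathProd P z l) (C.bits l z) ∂κ a
    have hw0 : ∀ l ∈ Finset.range r, w l = 0 := fun l hl => by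
      have : firstMark C.mark C.markEnd l = ∅ := hempty l (Finset.mem_range.1 hl)
      simp [w, this]
    calc ∑' l, w l = ∑' l, w (l + r) := by
          rw [← Summable.sum_add_tsum_nat_add' (f := w) (k := r) ENNReal.summable,
            Finset.sum_eq_zero hw0, zero_add]
      _ ≤ ∑' l, (κ a (firstMark m r (l + r)) + ENNReal.ofReal (inBound S₁ Δ (l + r))) / 2 :=
          ENNReal.tsum_le_tsum fun l => hin (l + r)
      _ = (∑' l, κ a (firstMark m r (l + r)) +
          ∑' l, ENNReal.ofReal (inBound S₁ Δ (l + r))) / 2 := by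
          simp_rw [div_eq_mul_inv]
          rw [ENNReal.tsum_mul_right, ENNReal.tsum_add]
      _ ≤ (1 + 1) / 2 := by
          gcongr
          · exact (ENNReal.tsum_comp_le_tsum_of_injective (add_left_injective r) _).trans hsum
          · exact hR₁ r hr₁
      _ = 1 := by rw [one_add_one_eq_two]; exact ENNReal.div_self (by simp) (by simp)

end BlockCode

/-! ### The two-sided code -/

lemma drop_fut {S : Type*} (n : ℕ) (τ : ℤ) (x : ℤ → S) : drop n (fut τ x) = fut (τ + n) x := by
  funext k
  simp only [drop, fut]
  congr 1
  push_cast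
  ring

lemma fut_seqTranslate {S : Type*} (τ j : ℤ) (x : ℤ → S) :
    fut τ (seqTranslate j x) = fut (τ + j) x := by
  funext k
  simp only [fut, seqTranslate]
  congr 1
  ring

namespace BlockCode

variable {S₁ S₂ : Type*} {C : BlockCode S₁ S₂}

/-- A marker occurrence in `x` ends at time `τ`. -/
def CutAt (C : BlockCode S₁ S₂) (x : ℤ → S₁) (τ : ℤ) : Prop :=
  MarkAt C.mark C.markEnd (fut (τ - C.markEnd) x) 0

/-- The output at time `t` is determined to be `v` by the input between two cuts. -/
def OutputAt (C : BlockCode S₁ S₂) (x : ℤ → S₁) (t : ℤ) (v : S₂) : Prop :=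
  ∃ τ σ : ℤ, τ ≤ t ∧ t < σ ∧ C.CutAt x τ ∧ C.CutAt x σ ∧
    ∀ U ∈ Set.Ico (0 : ℝ) 1, C.run (fut τ x) U (t - τ).toNat = v

lemma cutAt_iff_markAt {x : ℤ → S₁} {τ : ℤ} {s : ℕ} :
    C.CutAt x (τ + s + C.markEnd) ↔ MarkAt C.mark C.markEnd (fut τ x) s := by
  have h := markAt_drop (m := C.mark) (r := C.markEnd) (fut τ x) s 0
  rw [drop_fut, add_zero] at h
  rw [← h, CutAt, add_sub_cancel_right]

lemma CutAt.congr {x y : ℤ → S₁} {τ : ℤ} (h : C.CutAt x τ)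
    (hxy : ∀ i, τ - C.markEnd ≤ i → i ≤ τ → x i = y i) : C.CutAt y τ := fun k hk => by
  rw [← h k hk]
  exact (hxy _ (by omega) (by push_cast; omega)).symm

lemma IsLocal.exists_markAt (hC : C.IsLocal) {x : ℤ → S₁} {τ σ : ℤ} (hτ : C.CutAt x τ)
    (hσ : C.CutAt x σ) (hlt : τ < σ) :
    ∃ s : ℕ, MarkAt C.mark C.markEnd (fut τ x) s ∧ σ = τ + s + C.markEnd := by
  obtain ⟨n, hn⟩ := Int.eq_ofNat_of_zero_le (sub_nonneg.2 hlt.le)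
  have hσ' : σ = τ - C.markEnd + n + C.markEnd := by omega
  have h1 := hσ
  rw [hσ', cutAt_iff_markAt] at h1
  have h2 := hC.add_le _ 0 n hτ h1 (by omega)
  refine ⟨n - C.markEnd, ?_, by omega⟩
  rw [← cutAt_iff_markAt]
  convert hσ using 1
  omega

lemma IsLocal.outputAt_unique (hC : C.IsLocal) {x : ℤ → S₁} {t : ℤ} {v v' : S₂}
    (h : C.OutputAt x t v) (h' : C.OutputAt x t v') : v = v' := by
  obtain ⟨τ, -, hτ, -, hc, -, hv⟩ := h
  obtain ⟨τ', -, hτ', -, hc', -, hv'⟩ := h'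
  have key : ∀ (τ τ' : ℤ) (v v' : S₂), τ ≤ τ' → τ' ≤ t → C.CutAt x τ → C.CutAt x τ' →
      (∀ U ∈ Set.Ico (0 : ℝ) 1, C.run (fut τ x) U (t - τ).toNat = v) →
      (∀ U ∈ Set.Ico (0 : ℝ) 1, C.run (fut τ' x) U (t - τ').toNat = v') → v = v' := by
    intro τ τ' v v' hle hτ' hc hc' hv hv'
    have h0 : (0 : ℝ) ∈ Set.Ico (0 : ℝ) 1 := by simp
    rcases hle.eq_or_lt with rfl | hlt
    · rw [← hv 0 h0, ← hv' 0 h0]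
    · obtain ⟨s, hs, rfl⟩ := hC.exists_markAt hc hc' hlt
      obtain ⟨U, hU, hrun⟩ := hC.exists_run_drop hs 0
      rw [← hv 0 h0, ← hv' U hU]
      have h1 := hrun (t - (τ + s + C.markEnd)).toNat
      rw [drop_fut] at h1
      convert h1 using 3
      · omega
      · push_cast; ring
  rcases le_total τ τ' with hle | hle
  · exact key _ _ _ _ hle hτ' hc hc' hv hv'
  · exact (key _ _ _ _ hle hτ hc' hc hv' hv).symm

lemma IsLocal.outputAt_congr (hC : C.IsLocal) {x y : ℤ → S₁} {t τ σ : ℤ} {v : S₂} (hτ : τ ≤ t)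
    (hσ : t < σ) (hcτ : C.CutAt x τ) (hcσ : C.CutAt x σ)
    (hv : ∀ U ∈ Set.Ico (0 : ℝ) 1, C.run (fut τ x) U (t - τ).toNat = v)
    (hxy : ∀ i, τ - C.markEnd ≤ i → i ≤ σ → x i = y i) : C.CutAt y τ ∧ C.CutAt y σ ∧
      ∀ U ∈ Set.Ico (0 : ℝ) 1, C.run (fut τ y) U (t - τ).toNat = v := by
  obtain ⟨s, hs, hσs⟩ := hC.exists_markAt hcτ hcσ (hτ.trans_lt hσ)
  refine ⟨hcτ.congr fun i h1 h2 => hxy i h1 (by omega),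
    hcσ.congr fun i h1 h2 => hxy i (by omega) h2, fun U hU => ?_⟩
  rw [← hv U hU]
  refine hC.run_congr hs (fun k hk => hxy _ (by omega) (by omega)) (by omega) U

lemma outputAt_seqTranslate_imp {x : ℤ → S₁} {t j : ℤ} {v : S₂}
    (h : C.OutputAt (seqTranslate j x) t v) : C.OutputAt x (t + j) v := by
  obtain ⟨τ, σ, h1, h2, h3, h4, h5⟩ := h
  refine ⟨τ + j, σ + j, by omega, by omega, ?_, ?_, fun U hU => ?_⟩
  · rw [CutAt, fut_seqTranslate] at h3
    rwa [CutAt, show τ + j - (C.markEnd : ℤ) = τ - C.markEnd + j by ring]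
  · rw [CutAt, fut_seqTranslate] at h4
    rwa [CutAt, show σ + j - (C.markEnd : ℤ) = σ - C.markEnd + j by ring]
  · rw [← h5 U hU, fut_seqTranslate]
    congr 2
    ring

lemma outputAt_seqTranslate {x : ℤ → S₁} {t j : ℤ} {v : S₂} :
    C.OutputAt (seqTranslate j x) t v ↔ C.OutputAt x (t + j) v := by
  refine ⟨outputAt_seqTranslate_imp, fun h => ?_⟩
  have hx : x = seqTranslate (-j) (seqTranslate j x) := by
    funext i; simp [seqTranslate]
  rw [hx] at h
  simpa using outputAt_seqTranslate_imp h

open Classical in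
/-- The two-sided code: the determined outputs, with default value `b`. -/
def factor (C : BlockCode S₁ S₂) (b : S₂) (x : ℤ → S₁) (t : ℤ) : S₂ :=
  if h : ∃ v, C.OutputAt x t v then h.choose else b

lemma IsLocal.factor_eq (hC : C.IsLocal) (b : S₂) {x : ℤ → S₁} {t : ℤ} {v : S₂}
    (h : C.OutputAt x t v) : C.factor b x t = v := by
  have hex : ∃ v, C.OutputAt x t v := ⟨v, h⟩
  rw [factor, dif_pos hex]
  exact hC.outputAt_unique hex.choose_spec h

lemma factor_seqTranslate (b : S₂) (j : ℤ) (x : ℤ → S₁) :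
    C.factor b (seqTranslate j x) = seqTranslate j (C.factor b x) := by
  funext t
  have h : C.OutputAt (seqTranslate j x) t = C.OutputAt x (t + j) :=
    funext fun v => propext outputAt_seqTranslate
  classical
  have key : ∀ p q : S₂ → Prop, p = q →
      (if hp : ∃ v, p v then hp.choose else b) = if hq : ∃ v, q v then hq.choose else b := by
    rintro p _ rfl
    rfl
  exact key _ _ h

/-- Wherever the output is determined, it is determined by finitely many input coordinates. -/
lemma IsLocal.determinesAt_factor (hC : C.IsLocal) (b : S₂) {x : ℤ → S₁} {v : S₂}
    (h : C.OutputAt x 0 v) : ∃ q r : ℕ, DeterminesAt Set.univ (C.factor b) q r x := by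
  obtain ⟨τ, σ, h1, h2, h3, h4, h5⟩ := h
  refine ⟨(C.markEnd - τ).toNat, σ.toNat, fun y _ hy => ?_⟩
  obtain ⟨h6, h7, h8⟩ := hC.outputAt_congr h1 h2 h3 h4 h5
    (y := y) fun i hi hi' => (hy i (by omega) (by omega)).symm
  rw [hC.factor_eq b ⟨τ, σ, h1, h2, h3, h4, h5⟩, hC.factor_eq b ⟨τ, σ, h1, h2, h6, h7, h8⟩]

variable [Fintype S₁] [MeasurableSpace S₁] [DiscreteMeasurableSpace S₁]

lemma IsLocal.measurableSet_outputAt (hC : C.IsLocal) (t : ℤ) (v : S₂) :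
    MeasurableSet {x | C.OutputAt x t v} := by
  have : {x | C.OutputAt x t v} = ⋃ τ : ℤ, ⋃ σ : ℤ, {x | τ ≤ t ∧ t < σ ∧ C.CutAt x τ ∧
      C.CutAt x σ ∧ ∀ U ∈ Set.Ico (0 : ℝ) 1, C.run (fut τ x) U (t - τ).toNat = v} := by
    ext x
    simp only [Set.mem_iUnion]
    rfl
  rw [this]
  refine MeasurableSet.iUnion fun τ => MeasurableSet.iUnion fun σ => ?_
  refine DependsOnWindow.measurableSet (Set.finite_Icc (τ - C.markEnd) σ) fun x y hxy hx => ?_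
  obtain ⟨h1, h2, h3, h4, h5⟩ := hx
  exact ⟨h1, h2, hC.outputAt_congr h1 h2 h3 h4 h5 fun i hi hi' => hxy i ⟨hi, hi'⟩⟩

lemma IsLocal.measurable_factor [Fintype S₂] [MeasurableSpace S₂] (hC : C.IsLocal) (b : S₂) :
    Measurable (C.factor b) := by
  classical
  refine measurable_pi_lambda _ fun t => measurable_to_countable' fun v => ?_
  have hset : (fun x => C.factor b x t) ⁻¹' {v} = {x | C.OutputAt x t v} ∪
      ({x | v = b} ∩ (⋃ v', {x | C.OutputAt x t v'})ᶜ) := by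
    ext x
    simp only [Set.mem_preimage, Set.mem_singleton_iff, Set.mem_union, Set.mem_inter_iff,
      Set.mem_compl_iff, Set.mem_iUnion, Set.mem_ofPred_eq]
    by_cases hex : ∃ v, C.OutputAt x t v
    · obtain ⟨w, hw⟩ := hex
      rw [hC.factor_eq b hw]
      refine ⟨fun h => Or.inl (h ▸ hw), fun h => h.elim (fun h => hC.outputAt_unique hw h)
        fun h => absurd ⟨w, hw⟩ h.2⟩
    · rw [factor, dif_neg hex]
      exact ⟨fun h => Or.inr ⟨h.symm, hex⟩, fun h => h.elim (fun h => absurd ⟨v, h⟩ hex)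
        fun h => h.1.symm⟩
  rw [hset]
  exact (hC.measurableSet_outputAt t v).union ((MeasurableSet.const _).inter
    (MeasurableSet.iUnion fun v' => hC.measurableSet_outputAt t v').compl)

end BlockCode

/-! ### The law of the two-sided code -/

section Covering

variable {S : Type*} [Fintype S] [DecidableEq S] [MeasurableSpace S] [DiscreteMeasurableSpace S]
  {P : Matrix S S ℝ} {p : S → ℝ} {κ : S → Measure (ℕ → S)}

lemma IsChainFrom.measure_drop_cyl (hP : IsStochastic P) (hκ : ∀ i, IsChainFrom P i (κ i))
    (s k : ℕ) (v : ℕ → S) (i : S) :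
    κ i (drop s ⁻¹' cyl k v) = ENNReal.ofReal ((P ^ s) i (v 0) * pathProd P v k) := by
  induction s generalizing i with
  | zero =>
    have h0 : drop 0 ⁻¹' cyl k v = cyl k v := by
      ext z; rw [Set.mem_preimage, drop_zero]
    rw [h0, hκ i k v, pow_zero, Matrix.one_apply, Pi.single_apply]
    simp only [eq_comm]
  | succ s ih =>
    have hm : MeasurableSet (drop (s + 1) ⁻¹' cyl k v) :=
      measurable_drop (s + 1) (measurableSet_cyl k v)
    have hm' : MeasurableSet (drop s ⁻¹' cyl k v) := measurable_drop s (measurableSet_cyl k v)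
    rw [← lintegral_indicator_one hm, IsChainFrom.lintegral_first_step hP.1 hκ i
      (measurable_one.indicator hm), pow_succ', Matrix.mul_apply, Finset.sum_mul,
      ENNReal.ofReal_sum_of_nonneg fun j _ => mul_nonneg (mul_nonneg (hP.1 _ _)
        ((hP.pow s).1 _ _)) (pathProd_nonneg hP.1 _ _)]
    refine Finset.sum_congr rfl fun j _ => ?_
    rw [mul_assoc, ENNReal.ofReal_mul (hP.1 i j), ← ih j, ← lintegral_indicator_one hm']
    congr 1
    refine lintegral_congr fun z => ?_
    have hz : drop (s + 1) (glue 1 (fun _ => i) z) = drop s z := by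
      have h := congrArg (drop s) (drop_glue 1 (fun _ => i) z)
      rwa [drop_drop, add_comm] at h
    have hmem : glue 1 (fun _ => i) z ∈ drop (s + 1) ⁻¹' cyl k v ↔ z ∈ drop s ⁻¹' cyl k v := by
      change drop (s + 1) (glue 1 (fun _ => i) z) ∈ cyl k v ↔ _
      rw [hz]
      rfl
    by_cases hcase : z ∈ drop s ⁻¹' cyl k v
    · rw [Set.indicator_of_mem hcase, Set.indicator_of_mem (hmem.2 hcase)]
      rfl
    · rw [Set.indicator_of_notMem hcase, Set.indicator_of_notMem fun h => hcase (hmem.1 h)]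

variable {m : ℕ → S} {r : ℕ} {a : S} {μ : Measure (ℤ → S)}

lemma measure_le_add_sum_firstMark (hP : IsStochastic P) (hp : IsStationaryVector P p)
    (hκ : ∀ i, IsChainFrom P i (κ i)) (hμ : IsMarkovMeasure μ P p) (hM : IsMarker P a m r)
    {J : ℕ} {ε : ℝ≥0∞} (hJ : ∀ i, κ i (noMark m r J) ≤ ε) (T : ℕ) {A : Set (ℤ → S)}
    {F : ℕ → Set (ℕ → S)} (hA : ∀ x ∈ A, ∀ τ ≤ J, fut 0 x ∈ firstMark m r τ →
      fut T x ∉ noMark m r J → fut τ x ∈ F τ) :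
    μ A ≤ ε + ε + ∑ τ ∈ Finset.range (J + 1), μ.map (fut 0) (firstMark m r τ) * κ a (F τ) := by
  have hρ := hμ.isMC_fut 0
  have hno : ∀ n : ℕ, μ (fut n ⁻¹' noMark m r J) ≤ ε := fun n => by
    have h := noMark_drop_le hP hκ hp.1 hp.2.1 (hμ.isMC_fut n) hJ 0
    rw [Measure.map_apply (measurable_fut _)
      (measurable_drop 0 (measurableSet_noMark J))] at h
    refine le_trans (measure_mono fun x hx => ?_) h
    change drop 0 (fut n x) ∈ noMark m r J
    rwa [drop_zero]
  have hsub : A ⊆ (fut (0 : ℕ) ⁻¹' noMark m r J ∪ fut T ⁻¹' noMark m r J) ∪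
      ⋃ τ ∈ Finset.range (J + 1), fut 0 ⁻¹' (firstMark m r τ ∩
        drop τ ⁻¹' toMeasurable (κ a) (F τ)) := by
    intro x hx
    by_cases h0 : fut 0 x ∈ noMark m r J
    · exact Or.inl (Or.inl h0)
    by_cases hT : fut T x ∈ noMark m r J
    · exact Or.inl (Or.inr hT)
    obtain ⟨s, hs, hs'⟩ : ∃ s, s + r ≤ J ∧ MarkAt m r (fut 0 x) s := by
      by_contra! hcon
      exact h0 hcon
    obtain ⟨h1, h2⟩ := mem_firstMark_markLen hs'
    refine Or.inr (Set.mem_iUnion₂.2 ⟨markLen m r (fut 0 x), Finset.mem_range.2 (by omega), h1, ?_⟩)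
    change drop _ (fut 0 x) ∈ toMeasurable (κ a) (F _)
    rw [drop_fut, zero_add]
    exact subset_toMeasurable _ _ (hA x hx _ (by omega) h1 hT)
  refine (measure_mono hsub).trans ((measure_union_le _ _).trans (add_le_add
    ((measure_union_le _ _).trans (add_le_add (hno 0) (hno T)))
    ((measure_biUnion_finset_le _ _).trans (Finset.sum_le_sum fun τ _ => ?_))))
  rw [← Measure.map_apply (measurable_fut 0) ((measurableSet_firstMark τ).inter
    (measurable_drop τ (measurableSet_toMeasurable _ _)))]
  refine hρ.past_inter_drop_le hp.1 hP.1 hκ (dependsOnWindow_firstMark τ)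
    (measurableSet_toMeasurable _ _) fun w hw => ?_
  rw [hM.eq_last hw, measure_toMeasurable]

lemma sum_firstMark_le_one (ρ : Measure (ℕ → S)) [IsProbabilityMeasure ρ] (s : Finset ℕ) :
    ∑ τ ∈ s, ρ (firstMark m r τ) ≤ 1 := by
  rw [← measure_biUnion_finset (fun i _ j _ hij => disjoint_firstMark hij)
    fun τ _ => measurableSet_firstMark τ]
  exact prob_le_one

end Covering

namespace BlockCode

variable {S₁ S₂ : Type*} [Fintype S₁] [DecidableEq S₁] [Fintype S₂] [DecidableEq S₂]
  [MeasurableSpace S₁] [DiscreteMeasurableSpace S₁]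
  [MeasurableSpace S₂] [DiscreteMeasurableSpace S₂]
  {P : Matrix S₁ S₁ ℝ} {Q : Matrix S₂ S₂ ℝ} {p₁ : S₁ → ℝ} {p₂ : S₂ → ℝ}
  {κ : S₁ → Measure (ℕ → S₁)} {κ' : S₂ → Measure (ℕ → S₂)} {C : BlockCode S₁ S₂}
  {a : S₁} {b : S₂} {μ : Measure (ℤ → S₁)}

lemma outputAt_of_firstMark {x : ℤ → S₁} {τ t T J : ℕ}
    (h : fut 0 x ∈ firstMark C.mark C.markEnd τ) (hT : fut T x ∉ noMark C.mark C.markEnd J)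
    (hτ : τ ≤ t) (ht : t < T) (hdet : fut τ x ∉ C.undetermined (t - τ)) {U : ℝ}
    (hU : U ∈ Set.Ico (0 : ℝ) 1) : C.OutputAt x t (C.run (fut τ x) U (t - τ)) := by
  obtain ⟨s, hs⟩ : ∃ s, MarkAt C.mark C.markEnd (fut T x) s := by
    by_contra! hcon
    exact hT fun s _ => hcon s
  refine ⟨τ, T + s + C.markEnd, by omega, by omega, ?_, cutAt_iff_markAt.2 hs, fun U' hU' => ?_⟩
  · have h1 := cutAt_iff_markAt.2 h.2.1
    have h2 := h.1
    convert h1 using 1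
    omega
  · by_contra hne
    rw [show ((t : ℤ) - τ).toNat = t - τ by omega] at hne
    exact hdet ⟨U', hU', U, hU, hne⟩

/-- Almost surely every output symbol is determined. -/
lemma IsLocal.ae_exists_outputAt (hC : C.IsLocal) (hP : IsStochastic P) (hirr : IsIrreducibleMat P)
    (hp : IsStationaryVector P p₁) (hκ : ∀ i, IsChainFrom P i (κ i)) (hμ : IsMarkovMeasure μ P p₁)
    (hM : IsMarker P a C.mark C.markEnd)
    (hdet : Tendsto (fun t => κ a (C.undetermined t)) atTop (nhds 0)) (t : ℤ) :
    ∀ᵐ x ∂μ, ∃ v, C.OutputAt x t v := by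
  have hprob := (hμ.isMC_fut 0).isProbabilityMeasure hp.1 hp.2.1
  have hmeas : ∀ t : ℤ, MeasurableSet {x | ¬ ∃ v, C.OutputAt x t v} := fun t => by
    have : {x | ¬ ∃ v, C.OutputAt x t v} = (⋃ v, {x | C.OutputAt x t v})ᶜ := by
      ext x
      simp
    rw [this]
    exact (MeasurableSet.iUnion fun v => hC.measurableSet_outputAt t v).compl
  have hinv : ∀ n : ℤ, μ {x | ¬ ∃ v, C.OutputAt x t v} = μ {x | ¬ ∃ v, C.OutputAt x n v} :=
    fun n => by
      conv_lhs => rw [← hμ.map_seqTranslate hp (n - t)]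
      rw [Measure.map_apply (measurable_seqTranslate _) (hmeas t)]
      congr 1
      ext x
      change (¬ ∃ v, C.OutputAt (seqTranslate (n - t) x) t v) ↔ _
      simp only [outputAt_seqTranslate, add_sub_cancel]
      rfl
  rw [ae_iff]
  refine nonpos_iff_eq_zero.1 (ENNReal.le_of_forall_pos_le_add fun e he _ => ?_)
  rw [zero_add]
  have he3 : (0 : ℝ≥0∞) < (e / 3 : NNReal) := by
    exact_mod_cast div_pos he (by norm_num)
  obtain ⟨J, hJ⟩ := hM.exists_noMark_le hP hirr hκ he3
  obtain ⟨N, hN⟩ := eventually_atTop.1 (hdet.eventually_le_const he3)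
  rw [hinv ((N + J : ℕ) : ℤ)]
  refine (measure_le_add_sum_firstMark hP hp hκ hμ hM hJ (N + J + 1)
    (F := fun τ => C.undetermined (N + J - τ)) fun x hx τ hτ hfirst hT => ?_).trans ?_
  · by_contra hz
    exact hx ⟨_, outputAt_of_firstMark hfirst hT (by omega) (by omega) hz
      (U := 0) (by simp)⟩
  · calc _ ≤ ((e / 3 : NNReal) : ℝ≥0∞) + (e / 3 : NNReal) + ∑ τ ∈ Finset.range (J + 1),
        μ.map (fut 0) (firstMark C.mark C.markEnd τ) * (e / 3 : NNReal) := by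
          gcongr with τ hτ
          exact hN _ (by have := Finset.mem_range.1 hτ; omega)
      _ ≤ ((e / 3 : NNReal) : ℝ≥0∞) + (e / 3 : NNReal) + 1 * (e / 3 : NNReal) := by
          rw [← Finset.sum_mul]
          gcongr
          exact sum_firstMark_le_one _ _
      _ = e := by
          rw [one_mul]
          norm_cast
          rw [← NNReal.coe_inj]
          push_cast
          ring

lemma IsCoding.measure_forall_run_le (h : C.IsCoding P κ a) (hQ : IsStochastic Q)
    (hκ' : ∀ i, IsChainFrom Q i (κ' i))
    (hrun : ∀ K u, (κ a).prod unif {ω | C.run ω.1 ω.2 ∈ cyl K u} ≤ κ' b (cyl K u))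
    (s k : ℕ) (v : ℕ → S₂) :
    κ a {z | ∀ U ∈ Set.Ico (0 : ℝ) 1, drop s (C.run z U) ∈ cyl k v} ≤
      ENNReal.ofReal ((Q ^ s) b (v 0) * pathProd Q v k) := by
  have := h.isProbabilityMeasure
  rw [← IsChainFrom.measure_drop_cyl hQ hκ']
  refine le_trans ?_ (h.measure_run_le_of_window hrun (K := s + k) ?_)
  · rw [← mul_one (κ a _), ← measure_univ (μ := unif), ← Measure.prod_prod]
    refine measure_mono_ae ?_
    filter_upwards [Measure.quasiMeasurePreserving_snd.ae ae_unif_mem] with ω hω hz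
    exact hz.1 ω.2 hω
  · intro x y hxy hx i hi
    have hi' : i ≤ k := hi
    rw [← hx i hi]
    exact (hxy (s + i) (Set.mem_Iic.2 (by omega))).symm

lemma IsCoding.measure_fut_factor_le_cyl (h : C.IsCoding P κ a) (hP : IsStochastic P)
    (hirr : IsIrreducibleMat P) (hp : IsStationaryVector P p₁) (hμ : IsMarkovMeasure μ P p₁)
    (hM : IsMarker P a C.mark C.markEnd) (hQ : IsStochastic Q) (hQirr : IsIrreducibleMat Q)
    (hp₂ : IsStationaryVector Q p₂) (hκ' : ∀ i, IsChainFrom Q i (κ' i))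
    (hrun : ∀ K u, (κ a).prod unif {ω | C.run ω.1 ω.2 ∈ cyl K u} ≤ κ' b (cyl K u))
    (hdet : Tendsto (fun t => κ a (C.undetermined t)) atTop (nhds 0))
    (t₀ : ℤ) (k : ℕ) (v : ℕ → S₂) :
    μ {x | fut t₀ (C.factor b x) ∈ cyl k v} ≤ ENNReal.ofReal (p₂ (v 0) * pathProd Q v k) := by
  have hC := h.toIsRandom.toIsLocal
  have hprobμ := hμ.isProbabilityMeasure hp
  have hprob := (hμ.isMC_fut 0).isProbabilityMeasure hp.1 hp.2.1
  have hmeas : ∀ t : ℤ, MeasurableSet {x | fut t (C.factor b x) ∈ cyl k v} := fun t =>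
    hC.measurable_factor b (measurable_fut t (measurableSet_cyl k v))
  have hinv : ∀ n : ℤ, μ {x | fut t₀ (C.factor b x) ∈ cyl k v} =
      μ {x | fut n (C.factor b x) ∈ cyl k v} := fun n => by
    conv_lhs => rw [← hμ.map_seqTranslate hp (n - t₀)]
    rw [Measure.map_apply (measurable_seqTranslate _) (hmeas t₀)]
    congr 1
    ext x
    change fut t₀ (C.factor b (seqTranslate (n - t₀) x)) ∈ cyl k v ↔ _
    rw [factor_seqTranslate, fut_seqTranslate, add_sub_cancel]
    rfl
  obtain ⟨B, hB⟩ := exists_cesaro_bound hQ hQirr hp₂ b (v 0)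
  have hpp := pathProd_nonneg hQ.1 v k
  have hpp1 := pathProd_le_one hQ v k
  set X := μ {x | fut t₀ (C.factor b x) ∈ cyl k v}
  have hXfin : X ≠ ⊤ := measure_ne_top _ _
  rw [← ENNReal.ofReal_toReal hXfin]
  refine ENNReal.ofReal_le_ofReal (le_of_forall_pos_le_add fun e he => ?_)
  have hδ : 0 < ENNReal.ofReal (e / 4) := by simpa using by positivity
  obtain ⟨J, hJ⟩ := hM.exists_noMark_le hP hirr h.chain hδ
  have hδ' : 0 < ENNReal.ofReal (e / 4 / (k + 1)) := by simpa using by positivity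
  obtain ⟨N, hN⟩ := eventually_atTop.1 (hdet.eventually_le_const hδ')
  have hbound : ∀ t, N + J ≤ t → X ≤ ENNReal.ofReal (e / 4) + ENNReal.ofReal (e / 4) +
      ∑ τ ∈ Finset.range (J + 1), μ.map (fut 0) (firstMark C.mark C.markEnd τ) *
        (ENNReal.ofReal (e / 4) + ENNReal.ofReal ((Q ^ (t - τ)) b (v 0) * pathProd Q v k)) := by
    intro t ht
    rw [hinv t]
    refine (measure_le_add_sum_firstMark hP hp h.chain hμ hM hJ (t + k + 1)
      (F := fun τ => (⋃ i ∈ Finset.range (k + 1), C.undetermined (t + i - τ)) ∪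
        {z | ∀ U ∈ Set.Ico (0 : ℝ) 1, drop (t - τ) (C.run z U) ∈ cyl k v})
      fun x hx τ hτ hfirst hT => ?_).trans ?_
    · by_contra hz
      simp only [Set.mem_union, not_or, Set.mem_iUnion, not_exists, Finset.mem_range] at hz
      refine hz.2 fun U hU i hi => ?_
      have hi' : i ≤ k := hi
      have h1 := outputAt_of_firstMark (t := t + i) hfirst hT (by omega) (by omega)
        (hz.1 i (by omega)) hU
      have h2 := hC.factor_eq b h1
      have h3 := hx i hi
      rw [fut, ← Nat.cast_add, h2] at h3
      rw [← h3, drop]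
      congr 1
      omega
    · gcongr with τ hτ
      have hτ' : τ ≤ J := by have := Finset.mem_range.1 hτ; omega
      refine (measure_union_le _ _).trans (add_le_add ?_
        (h.measure_forall_run_le hQ hκ' hrun _ _ _))
      refine (measure_biUnion_finset_le _ _).trans ((Finset.sum_le_sum fun i _ =>
        hN _ (by omega)).trans (le_of_eq ?_))
      rw [Finset.sum_const, Finset.card_range, nsmul_eq_mul, ← ENNReal.ofReal_natCast,
        ← ENNReal.ofReal_mul (by positivity)]
      congr 1
      push_cast
      field_simp
  obtain ⟨M, hMB⟩ := exists_nat_gt (4 * |B| / e)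
  have hMpos : (0 : ℝ) < M := lt_of_le_of_lt (by positivity) hMB
  have hsum := Finset.sum_le_sum fun (j : ℕ) (_ : j ∈ Finset.range M) =>
    hbound (N + J + j) (by omega)
  have hinner : ∀ τ ∈ Finset.range (J + 1), ∑ j ∈ Finset.range M, (ENNReal.ofReal (e / 4) +
      ENNReal.ofReal ((Q ^ (N + J + j - τ)) b (v 0) * pathProd Q v k)) ≤
      ENNReal.ofReal (M * (e / 4) + (M * p₂ (v 0) + B) * pathProd Q v k) := by
    intro τ hτ
    have hτ' : τ ≤ J := by have := Finset.mem_range.1 hτ; omega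
    have hnn : ∀ j, 0 ≤ (Q ^ (N + J + j - τ)) b (v 0) * pathProd Q v k := fun j =>
      mul_nonneg ((hQ.pow _).1 _ _) hpp
    rw [Finset.sum_congr rfl fun j _ => (ENNReal.ofReal_add (by positivity) (hnn j)).symm,
      ← ENNReal.ofReal_sum_of_nonneg fun j _ => add_nonneg (by positivity) (hnn j)]
    refine ENNReal.ofReal_le_ofReal ?_
    rw [Finset.sum_add_distrib, Finset.sum_const, Finset.card_range, nsmul_eq_mul,
      ← Finset.sum_mul]
    gcongr
    refine le_trans (le_of_eq (Finset.sum_congr rfl fun j _ => ?_)) (hB (N + J - τ) M)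
    rw [show N + J + j - τ = N + J - τ + j by omega]
  have hnn : 0 ≤ M * p₂ (v 0) + B :=
    (Finset.sum_nonneg fun j _ => (hQ.pow _).1 b (v 0)).trans (hB 0 M)
  have hfinal : (M : ℝ≥0∞) * X ≤ ENNReal.ofReal (M * (e / 4 + e / 4) +
      (M * (e / 4) + (M * p₂ (v 0) + B) * pathProd Q v k)) := by
    rw [Finset.sum_const, Finset.card_range, nsmul_eq_mul, Finset.sum_add_distrib,
      Finset.sum_const, Finset.card_range, nsmul_eq_mul, Finset.sum_comm] at hsum
    refine hsum.trans ?_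
    rw [ENNReal.ofReal_add (by positivity) (by positivity)]
    refine add_le_add (le_of_eq ?_) ?_
    · rw [ENNReal.ofReal_mul (by positivity), ENNReal.ofReal_add (by positivity) (by positivity),
        ENNReal.ofReal_natCast]
    · calc _ ≤ ∑ τ ∈ Finset.range (J + 1), μ.map (fut 0) (firstMark C.mark C.markEnd τ) *
            ENNReal.ofReal (M * (e / 4) + (M * p₂ (v 0) + B) * pathProd Q v k) := by
            refine Finset.sum_le_sum fun τ hτ => ?_
            rw [← Finset.mul_sum]
            gcongr
            exact hinner τ hτ
        _ ≤ 1 * ENNReal.ofReal (M * (e / 4) + (M * p₂ (v 0) + B) * pathProd Q v k) := by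
            rw [← Finset.sum_mul]
            gcongr
            exact sum_firstMark_le_one _ _
        _ = _ := one_mul _
  rw [← ENNReal.ofReal_toReal hXfin, ← ENNReal.ofReal_natCast, ← ENNReal.ofReal_mul hMpos.le,
    ENNReal.ofReal_le_ofReal_iff (by positivity)] at hfinal
  rw [div_lt_iff₀ he] at hMB
  have hBpp : B * pathProd Q v k ≤ |B| :=
    (le_abs_self _).trans (by
      rw [abs_mul, abs_of_nonneg hpp]
      exact mul_le_of_le_one_right (abs_nonneg _) hpp1)
  refine le_of_mul_le_mul_left ?_ hMpos
  nlinarith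

/-- The two-sided code has the law of the target Markov shift. -/
lemma IsCoding.map_factor (h : C.IsCoding P κ a) (hP : IsStochastic P)
    (hirr : IsIrreducibleMat P) (hp : IsStationaryVector P p₁) (hμ : IsMarkovMeasure μ P p₁)
    (hM : IsMarker P a C.mark C.markEnd) (hQ : IsStochastic Q) (hQirr : IsIrreducibleMat Q)
    (hp₂ : IsStationaryVector Q p₂) (hκ' : ∀ i, IsChainFrom Q i (κ' i))
    (hrun : ∀ K u, (κ a).prod unif {ω | C.run ω.1 ω.2 ∈ cyl K u} ≤ κ' b (cyl K u))
    (hdet : Tendsto (fun t => κ a (C.undetermined t)) atTop (nhds 0))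
    {ν : Measure (ℤ → S₂)} (hν : IsMarkovMeasure ν Q p₂) : μ.map (C.factor b) = ν := by
  have hm := h.toIsRandom.toIsLocal.measurable_factor b
  have hprobμ := hμ.isProbabilityMeasure hp
  have hprobν := hν.isProbabilityMeasure hp₂
  have hprob : IsProbabilityMeasure (μ.map (C.factor b)) :=
    Measure.isProbabilityMeasure_map hm.aemeasurable
  refine measure_ext_int fun m n hmn w => ?_
  obtain ⟨k, rfl⟩ : ∃ k : ℕ, n = m + k := ⟨(n - m).toNat, by omega⟩
  have hcyl : ∀ w : ℤ → S₂, {x : ℤ → S₂ | ∀ i ∈ Set.Icc m (m + k), x i = w i} =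
      fut m ⁻¹' cyl k (fut m w) := fun w => by
    ext x
    refine ⟨fun hx i hi => hx _ ?_, fun hx i hi => ?_⟩
    · have hi' : i ≤ k := hi
      exact ⟨by omega, by omega⟩
    · have h1 := hx (i - m).toNat (Set.mem_Iic.2 (by have := hi.2; omega))
      have h2 := hi.1
      simp only [fut] at h1
      rwa [show m + ((i - m).toNat : ℤ) = i by omega] at h1
  have hle : ∀ w : ℤ → S₂, μ.map (C.factor b) {x | ∀ i ∈ Set.Icc m (m + k), x i = w i} ≤
      ν {x | ∀ i ∈ Set.Icc m (m + k), x i = w i} := fun w => by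
    have hmc := hν.isMC_fut m k (fut m w)
    rw [Measure.map_apply (measurable_fut m) (measurableSet_cyl _ _)] at hmc
    rw [hcyl, hmc, Measure.map_apply hm (measurable_fut m (measurableSet_cyl _ _))]
    exact h.measure_fut_factor_le_cyl hP hirr hp hμ hM hQ hQirr hp₂ hκ' hrun hdet m k _
  have hset : {x : ℤ → S₂ | ∀ i : ℤ, m ≤ i → i ≤ m + k → x i = w i} =
      {x | ∀ i ∈ Set.Icc m (m + k), x i = w i} := by
    ext x
    exact ⟨fun hx i hi => hx i hi.1 hi.2, fun hx i h1 h2 => hx i ⟨h1, h2⟩⟩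
  rw [hset]
  have hE : DependsOnWindow (Set.Icc m (m + k)) {x : ℤ → S₂ | ∀ i ∈ Set.Icc m (m + k), x i = w i} :=
    fun x y hxy hx i hi => (hxy i hi).symm.trans (hx i hi)
  have hEm := hE.measurableSet (Set.finite_Icc _ _)
  have hEc : DependsOnWindow (Set.Icc m (m + k))
      {x : ℤ → S₂ | ∀ i ∈ Set.Icc m (m + k), x i = w i}ᶜ :=
    fun x y hxy hx hy => hx (hE y x (fun i hi => (hxy i hi).symm) hy)
  refine le_antisymm (hle w) ?_
  have hc := hEc.measure_le (Set.finite_Icc _ _) fun w _ => hle w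
  rw [prob_compl_eq_one_sub hEm, prob_compl_eq_one_sub hEm] at hc
  exact (ENNReal.sub_le_sub_iff_left prob_le_one one_ne_top).1 hc

end BlockCode

lemma IsPrimitive.isIrreducibleMat {S : Type*} [Fintype S] [DecidableEq S] {Q : Matrix S S ℝ}
    (hQ : IsStochastic Q) (h : IsPrimitive Q) : IsIrreducibleMat Q := by
  obtain ⟨n, η, hn, hη, hle⟩ := h.exists_pow_ge hQ
  exact fun i j => ⟨n, hn, hη.trans_le (hle i j)⟩

/-- **Akcoglu–del Junco–Rahe.** If `X` is an ergodic Markov shift and `Y` a mixing Markov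
shift with `h(X) > h(Y)`, then there is a finitary homomorphism from `X` to `Y`. -/
theorem finitary_factor_markov_of_entropy_gt
    {S₁ S₂ : Type*} [Fintype S₁] [DecidableEq S₁] [Fintype S₂] [DecidableEq S₂]
    [MeasurableSpace S₁] [DiscreteMeasurableSpace S₁]
    [MeasurableSpace S₂] [DiscreteMeasurableSpace S₂]
    (P : Matrix S₁ S₁ ℝ) (hPstoch : IsStochastic P) (hPirr : IsIrreducibleMat P)
    (ppi₁ : S₁ → ℝ) (hppi₁ : IsStationaryVector P ppi₁)
    (μ : Measure (ℤ → S₁)) (hμ : IsMarkovMeasure μ P ppi₁)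
    (Q : Matrix S₂ S₂ ℝ) (hQstoch : IsStochastic Q) (hQprim : IsPrimitive Q)
    (ppi₂ : S₂ → ℝ) (hppi₂ : IsStationaryVector Q ppi₂)
    (ν : Measure (ℤ → S₂)) (hν : IsMarkovMeasure ν Q ppi₂)
    (hH : markovEntropy Q ppi₂ < markovEntropy P ppi₁) :
    ∃ (D : Set (ℤ → S₁)) (φ : (ℤ → S₁) → (ℤ → S₂)),
      IsFactorMap μ ν D φ ∧ IsFinitary μ D φ := by
  have hQirr := hQprim.isIrreducibleMat hQstoch
  obtain ⟨b⟩ : Nonempty S₂ := by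
    by_contra hcon
    rw [not_nonempty_iff] at hcon
    simpa using hppi₂.2.1
  obtain ⟨κ, hκ⟩ := (hμ.isMC_fut 0).exists_chains (hppi₁.pos hPstoch hPirr)
  obtain ⟨κ', hκ'⟩ := (hν.isMC_fut 0).exists_chains (hppi₂.pos hQstoch hQirr)
  obtain ⟨C, a, hM, hC, hrun, hdet⟩ := BlockCode.exists_coding hPstoch hPirr hppi₁ hκ hQstoch
    hQprim hQirr hppi₂ hκ' hH b
  have hloc := hC.toIsRandom.toIsLocal
  have := hμ.isProbabilityMeasure hppi₁
  refine ⟨Set.univ, C.factor b, ⟨hloc.measurable_factor b, MeasurableSet.univ, rfl, measure_univ,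
    (hC.map_factor hPstoch hPirr hppi₁ hμ hM hQstoch hQirr hppi₂ hκ' hrun hdet hν).symm,
    fun x _ => BlockCode.factor_seqTranslate b 1 x⟩, ?_⟩
  filter_upwards [hloc.ae_exists_outputAt hPstoch hPirr hppi₁ hκ hμ hM hdet 0] with x hx _
  exact hloc.determinesAt_factor b hx.choose_spec
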